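/- For every integer k ≥ 2, every ℓ ∈ {1, …, k−1}, and every constant γ > 0 there exist constants c₁, c₂ > 0 and n₀ ∈ ℕ such that for all n ≥ n₀ with (k−ℓ) ∣ n, every k-graph G on n vertices with δ(G) ≥ (1/2 + γ)n contains at least exp(n ln n − c₂ n) and at most exp(n ln n − c₁ n) Hamilton ℓ-cycles. -/

import Mathlib

open scoped Classical

/-- The set of Hamilton `l`-cycles of the `k`-graph on vertex set `Fin n` with edge set
`E` (for `(k-l) ∣ n`): each Hamilton `l`-cycle is encoded as its edge set, a subset of
`E` whose edges are exactly the `n/(k-l)` sets of `k` cyclically consecutive vertices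
starting at the positions `i·(k-l)`, with respect to some cyclic ordering (bijective
enumeration) `v` of all the vertices; consecutive edges then intersect in exactly `l`
vertices. -/
noncomputable def hamLCycles (n k l : ℕ) (E : Finset (Finset (Fin n))) :
    Finset (Finset (Finset (Fin n))) :=
  E.powerset.filter (fun C =>
    ∃ v : Fin n → Fin n, Function.Bijective v ∧
      C = Finset.image (fun i : Fin (n / (k - l)) =>
            Finset.image (fun j : Fin k =>
              v ⟨((i : ℕ) * (k - l) + (j : ℕ)) % n,
                 Nat.mod_lt _ (Nat.lt_of_lt_of_le i.pos (Nat.div_le_self n (k - l)))⟩)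
              Finset.univ)
          Finset.univ)

universe u

section Lists
variable {α : Type*} [DecidableEq α]

/-- Every `j + 1` consecutive entries of the list form an edge of `E`. -/
def TightList (j : ℕ) (E : Finset (Finset α)) (l : List α) : Prop :=
  ∀ w, w <:+: l → w.length = j + 1 → w.toFinset ∈ E

lemma TightList.of_isInfix {j : ℕ} {E : Finset (Finset α)} {l l' : List α}
    (h : TightList j E l) (hl : l' <:+: l) : TightList j E l' :=
  fun w hw hlen => h w (hw.trans hl) hlen

lemma TightList.of_length_le {j : ℕ} {E : Finset (Finset α)} {l : List α}
    (h : l.length ≤ j) : TightList j E l := by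
  intro w hw hlen
  have := hw.length_le
  omega

lemma TightList.glue {j : ℕ} {E : Finset (Finset α)} {x m y : List α} (hm : j ≤ m.length)
    (h₁ : TightList j E (x ++ m)) (h₂ : TightList j E (m ++ y)) :
    TightList j E (x ++ m ++ y) := by
  rintro w ⟨s, t, hst⟩ hlen
  by_cases hs : s.length + (j + 1) ≤ x.length + m.length
  · refine h₁ w ?_ hlen
    have h1 : (s ++ w) <+: (x ++ m ++ y) := ⟨t, hst⟩
    have h2 : (x ++ m) <+: (x ++ m ++ y) := ⟨y, rfl⟩
    have h3 := List.prefix_of_prefix_length_le h1 h2 (by simp; omega)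
    exact (List.suffix_append s w).isInfix.trans h3.isInfix
  · refine h₂ w ?_ hlen
    have hl := congrArg List.length hst
    simp only [List.length_append] at hl
    have h1 : (w ++ t) <:+ (x ++ m ++ y) := ⟨s, by rw [← hst, List.append_assoc]⟩
    have h2 : (m ++ y) <:+ (x ++ m ++ y) := ⟨x, by rw [List.append_assoc]⟩
    have h3 := List.suffix_of_suffix_length_le h1 h2 (by simp; omega)
    exact (List.prefix_append w t).isInfix.trans h3.isInfix

omit [DecidableEq α] in
lemma List.eq_take_drop_of_append {s w t l : List α} (h : s ++ w ++ t = l) :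
    w = (l.drop s.length).take w.length := by
  subst h
  simp

lemma TightList.sandwich {j : ℕ} {E : Finset (Finset α)} {A B : List α} {x : α}
    (hA : A.length = j) (hB : B.length = j)
    (h : ∀ i ≤ j, (A.drop i ++ x :: B.take i).toFinset ∈ E) :
    TightList j E (A ++ x :: B) := by
  rintro w ⟨s, t, hst⟩ hlen
  have hl := congrArg List.length hst
  simp only [List.length_append, List.length_cons] at hl
  have hs : s.length ≤ j := by omega
  have hw := List.eq_take_drop_of_append hst
  have : w = A.drop s.length ++ x :: B.take s.length := by
    rw [hw, hlen, List.drop_append, List.take_append]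
    have h1 : s.length - A.length = 0 := by omega
    rw [h1, List.drop_zero, List.length_drop, List.take_of_length_le (by simp; omega)]
    have h2 : j + 1 - (A.length - s.length) = s.length + 1 := by omega
    rw [h2, List.take_succ_cons]
  rw [this]
  exact h _ hs

lemma TightList.append_of_windows {j : ℕ} {E : Finset (Finset α)} {A B : List α}
    (hA : A.length = j) (hB : B.length = j)
    (h : ∀ i < j, (A.drop i ++ B.take (i + 1)).toFinset ∈ E) :
    TightList j E (A ++ B) := by
  rintro w ⟨s, t, hst⟩ hlen
  have hl := congrArg List.length hst
  simp only [List.length_append] at hl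
  have hs : s.length < j := by omega
  have hw := List.eq_take_drop_of_append hst
  have : w = A.drop s.length ++ B.take (s.length + 1) := by
    rw [hw, hlen, List.drop_append, List.take_append]
    have h1 : s.length - A.length = 0 := by omega
    rw [h1, List.drop_zero, List.length_drop, List.take_of_length_le (by simp; omega)]
    have h2 : j + 1 - (A.length - s.length) = s.length + 1 := by omega
    rw [h2]
  rw [this]
  exact h _ hs

lemma TightList.insert_mid {j : ℕ} {E : Finset (Finset α)} {x a b y : List α} {v : α}
    (ha : a.length = j) (hb : b.length = j) (h : TightList j E (x ++ (a ++ b) ++ y))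
    (hv : TightList j E (a ++ v :: b)) : TightList j E (x ++ (a ++ v :: b) ++ y) := by
  have h1 : TightList j E (x ++ a) := h.of_isInfix ⟨[], b ++ y, by simp⟩
  have h2 : TightList j E (b ++ y) := h.of_isInfix ⟨x ++ a, [], by simp⟩
  have h3 := TightList.glue (x := x) (m := a) (y := v :: b) ha.ge h1 hv
  have h4 := TightList.glue (x := x ++ a ++ [v]) (m := b) (y := y) hb.ge (by simpa using h3) h2
  simpa using h4

omit [DecidableEq α] in
lemma List.infix_or_infix_of_disjoint {w x u y : List α} (h : w <:+: x ++ u ++ y) (hw : w ≠ [])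
    (hu : u ≠ []) (hd : ∀ a ∈ w, a ∉ u) : w <:+: x ∨ w <:+: y := by
  obtain ⟨s, t, hst⟩ := h
  have hl := congrArg List.length hst
  simp only [List.length_append] at hl
  have hwl := List.length_pos_iff.2 hw
  have hul := List.length_pos_iff.2 hu
  by_cases h1 : s.length + w.length ≤ x.length
  · left
    have h3 := List.prefix_of_prefix_length_le (l₁ := s ++ w) (l₂ := x) (l₃ := x ++ u ++ y)
      ⟨t, hst⟩ ⟨u ++ y, by simp⟩ (by simpa using h1)
    exact (List.suffix_append s w).isInfix.trans h3.isInfix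
  by_cases h2 : x.length + u.length ≤ s.length
  · right
    have h3 := List.suffix_of_suffix_length_le (l₁ := w ++ t) (l₂ := y) (l₃ := x ++ u ++ y)
      ⟨s, by rw [← hst, List.append_assoc]⟩ ⟨x ++ u, rfl⟩ (by simp; omega)
    exact (List.prefix_append w t).isInfix.trans h3.isInfix
  exfalso
  obtain ⟨p, hp1, hp2, hp3, hp4⟩ : ∃ p, s.length ≤ p ∧ p < s.length + w.length ∧ x.length ≤ p ∧
      p < x.length + u.length := ⟨max s.length x.length, by omega, by omega, by omega, by omega⟩
  have e1 : (s ++ w ++ t)[p]? = w[p - s.length]? := by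
    rw [List.append_assoc, List.getElem?_append_right hp1, List.getElem?_append_left (by omega)]
  have e2 : (x ++ u ++ y)[p]? = u[p - x.length]? := by
    rw [List.append_assoc, List.getElem?_append_right hp3, List.getElem?_append_left (by omega)]
  rw [hst, e2, List.getElem?_eq_getElem (by omega), List.getElem?_eq_getElem (by omega)] at e1
  refine hd (w[p - s.length]'(by omega)) (List.getElem_mem _) ?_
  rw [← Option.some.inj e1]
  exact List.getElem_mem _

end Lists

section Dirac
variable {α : Type*} [DecidableEq α]

/-- The vertices of `R` that extend `S` to an edge. -/
def extensions (E : Finset (Finset α)) (R S : Finset α) : Finset α :=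
  R.filter (fun x => insert x S ∈ E)

/-- Every `j`-subset of `Ω` has relative degree at least `1/2 + θ` into `R`. -/
def DiracInto (j : ℕ) (E : Finset (Finset α)) (Ω R : Finset α) (θ : ℝ) : Prop :=
  ∀ S ⊆ Ω, S.card = j → (1 / 2 + θ) * (R.card : ℝ) ≤ ((extensions E R S).card : ℝ)

lemma mem_extensions {E : Finset (Finset α)} {R S : Finset α} {x : α} :
    x ∈ extensions E R S ↔ x ∈ R ∧ insert x S ∈ E := Finset.mem_filter

lemma DiracInto.mono {j : ℕ} {E : Finset (Finset α)} {Ω Ω' R : Finset α} {θ θ' : ℝ}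
    (h : DiracInto j E Ω R θ) (hΩ : Ω' ⊆ Ω) (hθ : θ' ≤ θ) : DiracInto j E Ω' R θ' := by
  intro S hS hc
  refine le_trans ?_ (h S (hS.trans hΩ) hc)
  gcongr

lemma DiracInto.sdiff {j : ℕ} {E : Finset (Finset α)} {Ω R Z : Finset α} {θ ε : ℝ}
    (h : DiracInto j E Ω R θ) (hθ : 0 ≤ 1 / 2 + (θ - ε)) (hZ : (Z.card : ℝ) ≤ ε * R.card) :
    DiracInto j E Ω (R \ Z) (θ - ε) := by
  intro S hS hc
  have h1 := h S hS hc
  have h2 : (extensions E R S).card ≤ (extensions E (R \ Z) S).card + Z.card := by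
    rw [← Finset.card_sdiff_add_card_inter (extensions E R S) Z]
    gcongr
    · intro x
      simp only [Finset.mem_sdiff, mem_extensions]
      tauto
    · exact Finset.inter_subset_right
  have h3 : ((R \ Z).card : ℝ) ≤ R.card := by exact_mod_cast Finset.card_le_card Finset.sdiff_subset
  have h4 : ((extensions E R S).card : ℝ) ≤ (extensions E (R \ Z) S).card + Z.card := by
    exact_mod_cast h2
  nlinarith [mul_le_mul_of_nonneg_left h3 hθ]

lemma not_mem_of_insert_mem {j : ℕ} {E : Finset (Finset α)} (hE : ∀ e ∈ E, e.card = j + 1)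
    {S : Finset α} (hS : S.card = j) {x : α} (hx : insert x S ∈ E) : x ∉ S := by
  intro h
  have := hE _ hx
  rw [Finset.insert_eq_of_mem h] at this
  omega

lemma card_le_inter_add {U A B : Finset α} (hA : A ⊆ U) (hB : B ⊆ U) :
    A.card + B.card ≤ (A ∩ B).card + U.card := by
  have := Finset.card_union_add_card_inter A B
  have := Finset.card_le_card (Finset.union_subset hA hB)
  omega

/-- Two `j`-sets have many common extensions, even after forbidding a few vertices. -/
lemma DiracInto.two_le_card {j : ℕ} {E : Finset (Finset α)} {Ω R : Finset α} {θ : ℝ}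
    (h : DiracInto j E Ω R θ) {S T : Finset α} (hS : S ⊆ Ω) (hSc : S.card = j) (hT : T ⊆ Ω)
    (hTc : T.card = j) (Z : Finset α) :
    2 * θ * R.card - Z.card ≤ (((extensions E R S ∩ extensions E R T) \ Z).card : ℝ) := by
  have h1 := h S hS hSc
  have h2 := h T hT hTc
  have h3 := card_le_inter_add (U := R) (A := extensions E R S) (B := extensions E R T)
    (Finset.filter_subset _ _) (Finset.filter_subset _ _)
  have h4 := Finset.le_card_sdiff Z (extensions E R S ∩ extensions E R T)
  have h3' : ((extensions E R S).card : ℝ) + (extensions E R T).card ≤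
    (extensions E R S ∩ extensions E R T).card + R.card := by exact_mod_cast h3
  have h4' : ((extensions E R S ∩ extensions E R T).card : ℝ) ≤
    ((extensions E R S ∩ extensions E R T) \ Z).card + Z.card := by
    exact_mod_cast (by omega)
  linarith

end Dirac

section BlowUp
variable {α ι : Type*} [DecidableEq α] [Fintype ι] [DecidableEq ι]

omit [DecidableEq α] in
lemma sum_card_update (R : Finset α) (i : ι) (P : (ι → α) → Prop) [DecidablePred P] :
    ∑ t ∈ Fintype.piFinset (fun _ : ι => R), (R.filter (fun x => P (Function.update t i x))).card
      = R.card * ((Fintype.piFinset (fun _ : ι => R)).filter P).card := by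
  have h1 : ∀ t : ι → α, (R.filter (fun x => P (Function.update t i x))).card =
      ∑ x ∈ R, if P (Function.update t i x) then 1 else 0 := fun t => by
    rw [Finset.card_filter]
  simp_rw [h1]
  rw [← Finset.sum_product', Finset.card_filter, Finset.mul_sum]
  have h2 : ∑ t ∈ Fintype.piFinset (fun _ : ι => R), R.card * (if P t then 1 else 0) =
      ∑ p ∈ Fintype.piFinset (fun _ : ι => R) ×ˢ R, if P p.1 then 1 else 0 := by
    rw [Finset.sum_product]
    exact Finset.sum_congr rfl fun t _ => by split_ifs <;> simp
  rw [h2]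
  refine Finset.sum_nbij' (fun p => (Function.update p.1 i p.2, p.1 i))
    (fun p => (Function.update p.1 i p.2, p.1 i)) ?_ ?_ ?_ ?_ ?_
  · rintro ⟨t, x⟩ h
    simp only [Finset.mem_product, Fintype.mem_piFinset] at h ⊢
    refine ⟨fun a => ?_, h.1 i⟩
    by_cases ha : a = i
    · subst ha; simpa using h.2
    · simpa [ha] using h.1 a
  · rintro ⟨t, x⟩ h
    simp only [Finset.mem_product, Fintype.mem_piFinset] at h ⊢
    refine ⟨fun a => ?_, h.1 i⟩
    by_cases ha : a = i
    · subst ha; simpa using h.2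
    · simpa [ha] using h.1 a
  · rintro ⟨t, x⟩ h
    simp
  · rintro ⟨t, x⟩ h
    simp
  · rintro ⟨t, x⟩ h
    simp

omit [DecidableEq α] in
lemma card_greedy_step {R : Finset α} (hR : 0 < R.card) (i : ι) {P₀ P₁ : (ι → α) → Prop}
    [DecidablePred P₀] [DecidablePred P₁] {c : ℝ}
    (h₀ : ∀ t x, P₀ t → P₀ (Function.update t i x))
    (h₁ : ∀ t ∈ Fintype.piFinset (fun _ : ι => R), P₀ t →
      c * R.card ≤ ((R.filter (fun x => P₁ (Function.update t i x))).card : ℝ)) :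
    c * ((Fintype.piFinset (fun _ : ι => R)).filter P₀).card ≤
      (((Fintype.piFinset (fun _ : ι => R)).filter (fun t => P₀ t ∧ P₁ t)).card : ℝ) := by
  have h := sum_card_update R i (fun t => P₀ t ∧ P₁ t)
  have h' : (∑ t ∈ Fintype.piFinset (fun _ : ι => R), ((R.filter (fun x =>
      P₀ (Function.update t i x) ∧ P₁ (Function.update t i x))).card : ℝ))
      = R.card * ((Fintype.piFinset (fun _ : ι => R)).filter (fun t => P₀ t ∧ P₁ t)).card := by
    exact_mod_cast h
  have h2 : ∑ t ∈ (Fintype.piFinset (fun _ : ι => R)).filter P₀, c * (R.card : ℝ) ≤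
      ∑ t ∈ Fintype.piFinset (fun _ : ι => R), ((R.filter (fun x =>
      P₀ (Function.update t i x) ∧ P₁ (Function.update t i x))).card : ℝ) := by
    refine le_trans (Finset.sum_le_sum (g := fun t => ((R.filter (fun x =>
      P₀ (Function.update t i x) ∧ P₁ (Function.update t i x))).card : ℝ)) ?_)
      (Finset.sum_le_sum_of_subset_of_nonneg (Finset.filter_subset _ _) (by intros; positivity))
    intro t ht
    rw [Finset.mem_filter] at ht
    refine (h₁ t ht.1 ht.2).trans ?_
    simp only [h₀ t _ ht.2, true_and, le_refl]
  rw [h', Finset.sum_const, nsmul_eq_mul] at h2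
  have : (0 : ℝ) < R.card := by exact_mod_cast hR
  nlinarith

omit [DecidableEq α] in
lemma card_greedy {L : ℕ} {R : Finset α} (hR : 0 < R.card) {c : ℝ} (hc : 0 ≤ c)
    (C : Fin L → (Fin L → α) → Prop)
    (hdep : ∀ i t t', (∀ a ≤ i, t a = t' a) → C i t → C i t')
    (hext : ∀ i, ∀ t ∈ Fintype.piFinset (fun _ : Fin L => R), (∀ a < i, C a t) →
      c * R.card ≤ ((R.filter (fun x => C i (Function.update t i x))).card : ℝ)) :
    c ^ L * (R.card : ℝ) ^ L ≤
      (((Fintype.piFinset (fun _ : Fin L => R)).filter (fun t => ∀ i, C i t)).card : ℝ) := by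
  have key : ∀ m ≤ L, c ^ m * (R.card : ℝ) ^ L ≤
      (((Fintype.piFinset (fun _ : Fin L => R)).filter
        (fun t => ∀ i : Fin L, i.val < m → C i t)).card : ℝ) := by
    intro m
    induction m with
    | zero => intro _; simp
    | succ m ih =>
      intro hm
      have h1 := ih (by omega)
      have h2 := card_greedy_step (R := R) hR (⟨m, hm⟩ : Fin L)
        (P₀ := fun t => ∀ i : Fin L, i.val < m → C i t) (P₁ := C ⟨m, hm⟩) (c := c) ?_ ?_
      · rw [pow_succ, mul_comm (c ^ m) c, mul_assoc]
        refine (mul_le_mul_of_nonneg_left h1 hc).trans (le_trans h2 ?_)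
        refine Nat.cast_le.2 (Finset.card_le_card fun t => ?_)
        simp only [Finset.mem_filter]
        rintro ⟨ht, h3, h4⟩
        refine ⟨ht, fun i hi => ?_⟩
        rcases Nat.lt_succ_iff_lt_or_eq.1 hi with h | h
        · exact h3 i h
        · obtain rfl : i = ⟨m, hm⟩ := Fin.ext h
          exact h4
      · intro t x ht i hi
        refine hdep i t _ (fun a ha => ?_) (ht i hi)
        have : a ≠ ⟨m, hm⟩ := by
          rintro rfl
          have : m ≤ i.val := ha
          omega
        simp [this]
      · intro t ht h3
        exact hext _ t ht (fun a ha => h3 a ha)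
  refine (key L le_rfl).trans ?_
  norm_cast
  refine Finset.card_le_card fun t => ?_
  simp only [Finset.mem_filter]
  exact fun h => ⟨h.1, fun i => h.2 i i.2⟩

end BlowUp

section BlowUp

lemma exists_popular_subset (ι : Type*) [Fintype ι] [DecidableEq ι] (r : ℕ) {δ : ℝ} (hδ : 0 < δ) :
    ∃ δ' > 0, ∃ n₀ : ℕ, ∀ {α : Type u} [DecidableEq α] (R : Finset α), n₀ ≤ R.card → ∀ (i : ι) (P : (ι → α) → Prop),
      δ * (R.card : ℝ) ^ Fintype.card ι ≤
        (((Fintype.piFinset (fun _ : ι => R)).filter P).card : ℝ) →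
      ∃ Y ⊆ R, Y.card = r ∧ δ' * (R.card : ℝ) ^ Fintype.card ι ≤
        (((Fintype.piFinset (fun _ : ι => R)).filter
          (fun t => ∀ y ∈ Y, P (Function.update t i y))).card : ℝ) := by
  obtain ⟨n₀, hn₀⟩ := exists_nat_ge (4 * r / δ)
  refine ⟨δ / 2 * (δ / 4) ^ r, by positivity, n₀ + r + 1, fun {α} _ R hR i P hP => ?_⟩
  set cube := Fintype.piFinset (fun _ : ι => R) with hcube
  set N := Fintype.card ι
  set n := R.card with hn
  have hcard : (cube.card : ℝ) = (n : ℝ) ^ N := by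
    rw [hcube, Fintype.card_piFinset]; simp [N, hn]
  have hnpos : (0 : ℝ) < n := by
    have : 0 < n := by omega
    exact_mod_cast this
  have hrn : (r : ℝ) ≤ δ * n / 4 := by
    have h1 : (n₀ : ℝ) ≤ n := by exact_mod_cast (by omega : n₀ ≤ n)
    have h2 := hn₀.trans h1
    rw [div_le_iff₀ hδ] at h2
    linarith
  let F : (ι → α) → Finset α := fun t => R.filter (fun x => P (Function.update t i x))
  have hsum : (∑ t ∈ cube, ((F t).card : ℝ)) = n * (cube.filter P).card := by
    exact_mod_cast sum_card_update R i P
  set H := cube.filter (fun t => δ * n / 2 ≤ ((F t).card : ℝ)) with hH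
  have hHcard : δ / 2 * (n : ℝ) ^ N ≤ H.card := by
    have h1 : ∑ t ∈ cube, ((F t).card : ℝ) ≤ ∑ t ∈ cube, (δ * n / 2 +
        if δ * n / 2 ≤ ((F t).card : ℝ) then (n : ℝ) else 0) := by
      refine Finset.sum_le_sum fun t _ => ?_
      have h2 : ((F t).card : ℝ) ≤ n := by exact_mod_cast Finset.card_filter_le _ _
      split_ifs with h
      · have : 0 ≤ δ * n / 2 := by positivity
        linarith
      · linarith
    rw [hsum, Finset.sum_add_distrib, Finset.sum_const, ← Finset.sum_filter, Finset.sum_const,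
      nsmul_eq_mul, nsmul_eq_mul, hcard] at h1
    have h3 : (n : ℝ) * (δ * n ^ N) ≤ n * (cube.filter P).card :=
      mul_le_mul_of_nonneg_left hP hnpos.le
    have h4 : (n : ℝ) * (δ / 2 * n ^ N) ≤ n * H.card := by
      rw [hH]; linarith
    exact le_of_mul_le_mul_left h4 hnpos
  have hswap : ∑ Y ∈ R.powersetCard r,
      (cube.filter (fun t => ∀ y ∈ Y, P (Function.update t i y))).card =
      ∑ t ∈ cube, (F t).card.choose r := by
    simp_rw [Finset.card_filter]
    rw [Finset.sum_comm]
    refine Finset.sum_congr rfl fun t _ => ?_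
    rw [← Finset.card_filter, ← Finset.card_powersetCard]
    congr 1
    ext Y
    simp only [Finset.mem_filter, Finset.mem_powersetCard, F]
    constructor
    · rintro ⟨⟨h1, h2⟩, h3⟩
      exact ⟨fun y hy => Finset.mem_filter.2 ⟨h1 hy, h3 y hy⟩, h2⟩
    · rintro ⟨h1, h2⟩
      exact ⟨⟨fun y hy => (Finset.mem_filter.1 (h1 hy)).1, h2⟩,
        fun y hy => (Finset.mem_filter.1 (h1 hy)).2⟩
  have hchoose : ∀ t ∈ H, (δ * n / 4) ^ r ≤ ((F t).card.choose r : ℝ) * r.factorial := by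
    intro t ht
    have h1 := (Finset.mem_filter.1 ht).2
    have h2 : ((F t).card.choose r : ℝ) * r.factorial = ((F t).card.descFactorial r : ℝ) := by
      rw [Nat.descFactorial_eq_factorial_mul_choose]; push_cast; ring
    rw [h2]
    have h3 := Nat.pow_sub_le_descFactorial (F t).card r
    have h3' : (((F t).card + 1 - r : ℕ) : ℝ) ^ r ≤ ((F t).card.descFactorial r : ℝ) := by
      exact_mod_cast h3
    refine le_trans (pow_le_pow_left₀ (by positivity) ?_ r) h3'
    have h4 : ((F t).card : ℝ) + 1 ≤ ((F t).card + 1 - r : ℕ) + r := by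
      exact_mod_cast (by omega)
    linarith
  have hchoose' : (n.choose r : ℝ) * r.factorial ≤ (n : ℝ) ^ r := by
    have := Nat.descFactorial_le_pow n r
    rw [Nat.descFactorial_eq_factorial_mul_choose] at this
    have h : ((r.factorial * n.choose r : ℕ) : ℝ) ≤ ((n ^ r : ℕ) : ℝ) := by exact_mod_cast this
    push_cast at h
    linarith
  have hfac : (0 : ℝ) < r.factorial := by exact_mod_cast r.factorial_pos
  have hne : (R.powersetCard r).Nonempty := Finset.powersetCard_nonempty.2 (by omega)
  obtain ⟨Y, hY, hYle⟩ := Finset.exists_le_of_sum_le hne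
    (f := fun _ => δ / 2 * (δ / 4) ^ r * (n : ℝ) ^ N)
    (g := fun Y => ((cube.filter (fun t => ∀ y ∈ Y, P (Function.update t i y))).card : ℝ)) (by
      rw [Finset.sum_const, nsmul_eq_mul, Finset.card_powersetCard]
      have h1 : (∑ Y ∈ R.powersetCard r,
        ((cube.filter (fun t => ∀ y ∈ Y, P (Function.update t i y))).card : ℝ)) =
        ∑ t ∈ cube, ((F t).card.choose r : ℝ) := by exact_mod_cast hswap
      rw [h1]
      have h2 : ∑ t ∈ H, ((F t).card.choose r : ℝ) ≤ ∑ t ∈ cube, ((F t).card.choose r : ℝ) :=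
        Finset.sum_le_sum_of_subset_of_nonneg (Finset.filter_subset _ _) (by intros; positivity)
      refine le_trans ?_ h2
      refine le_of_mul_le_mul_right ?_ hfac
      rw [Finset.sum_mul]
      refine le_trans ?_ (Finset.sum_le_sum hchoose)
      rw [Finset.sum_const, nsmul_eq_mul]
      calc (n.choose r : ℝ) * (δ / 2 * (δ / 4) ^ r * (n : ℝ) ^ N) * r.factorial
          = ((n.choose r : ℝ) * r.factorial) * (δ / 4) ^ r * (δ / 2 * (n : ℝ) ^ N) := by ring
        _ ≤ (n : ℝ) ^ r * (δ / 4) ^ r * H.card := by gcongr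
        _ = H.card * (δ * n / 4) ^ r := by rw [← mul_pow]; ring)
  rw [Finset.mem_powersetCard] at hY
  exact ⟨Y, hY.1, hY.2, hYle⟩

lemma exists_blowup (ι : Type*) [Fintype ι] [DecidableEq ι] (r : ℕ) {δ : ℝ} (hδ : 0 < δ) :
    ∃ n₀ : ℕ, ∀ {α : Type u} [DecidableEq α] (R : Finset α), n₀ ≤ R.card → ∀ (P : (ι → α) → Prop),
      δ * (R.card : ℝ) ^ Fintype.card ι ≤
        (((Fintype.piFinset (fun _ : ι => R)).filter P).card : ℝ) →
      ∃ Y : ι → Finset α, (∀ i, Y i ⊆ R ∧ (Y i).card = r) ∧ ∀ t, (∀ i, t i ∈ Y i) → P t := by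
  have key : ∀ s : Finset ι, ∃ δ' > 0, ∃ n₀ : ℕ, ∀ {α : Type u} [DecidableEq α] (R : Finset α),
      n₀ ≤ R.card →
      ∀ (P : (ι → α) → Prop), δ * (R.card : ℝ) ^ Fintype.card ι ≤
        (((Fintype.piFinset (fun _ : ι => R)).filter P).card : ℝ) →
      ∃ Y : ι → Finset α, (∀ i ∈ s, Y i ⊆ R ∧ (Y i).card = r) ∧
        δ' * (R.card : ℝ) ^ Fintype.card ι ≤
        (((Fintype.piFinset (fun _ : ι => R)).filter (fun t => ∀ t', (∀ i ∈ s, t' i ∈ Y i) →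
          (∀ i ∉ s, t' i = t i) → P t')).card : ℝ) := by
    intro s
    induction s using Finset.induction_on with
    | empty =>
      refine ⟨δ, hδ, 0, fun {α} _ R _ P hP => ⟨fun _ => ∅, by simp, hP.trans ?_⟩⟩
      norm_cast
      refine Finset.card_le_card fun t => ?_
      simp only [Finset.mem_filter]
      rintro ⟨h1, h2⟩
      refine ⟨h1, fun t' _ h3 => ?_⟩
      have : t' = t := funext fun i => h3 i (Finset.notMem_empty i)
      rwa [this]
    | insert i s his ih =>
      obtain ⟨δ₁, hδ₁, n₁, h₁⟩ := ih
      obtain ⟨δ₂, hδ₂, n₂, h₂⟩ := exists_popular_subset.{u} ι r hδ₁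
      refine ⟨δ₂, hδ₂, max n₁ n₂, fun {α} _ R hR P hP => ?_⟩
      obtain ⟨Y, hY, hYc⟩ := h₁ R (le_trans (le_max_left _ _) hR) P hP
      obtain ⟨Z, hZR, hZc, hZ⟩ := h₂ R (le_trans (le_max_right _ _) hR) i _ hYc
      refine ⟨Function.update Y i Z, fun a ha => ?_, hZ.trans ?_⟩
      · by_cases h : a = i
        · subst h; simpa using ⟨hZR, hZc⟩
        · simpa [h] using hY a (Finset.mem_of_mem_insert_of_ne ha h)
      · norm_cast
        refine Finset.card_le_card fun t => ?_
        simp only [Finset.mem_filter]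
        rintro ⟨h1, h2⟩
        refine ⟨h1, fun t' h3 h4 => ?_⟩
        have hi : t' i ∈ Z := by simpa using h3 i (Finset.mem_insert_self _ _)
        refine h2 (t' i) hi t' (fun a ha => ?_) (fun a ha => ?_)
        · have hai : a ≠ i := by rintro rfl; exact his ha
          simpa [hai] using h3 a (Finset.mem_insert_of_mem ha)
        · by_cases hai : a = i
          · subst hai; simp
          · simpa [hai] using h4 a (by simp [hai, ha])
  obtain ⟨δ', hδ', n₀, h⟩ := key Finset.univ
  refine ⟨n₀ + 1, fun {α} _ R hR P hP => ?_⟩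
  obtain ⟨Y, hY, hYc⟩ := h R (by omega) P hP
  refine ⟨Y, fun i => hY i (Finset.mem_univ i), fun t ht => ?_⟩
  have hpos : (0 : ℝ) < R.card := by exact_mod_cast (by omega : 0 < R.card)
  have h1 : (0 : ℝ) < (((Fintype.piFinset (fun _ : ι => R)).filter (fun t => ∀ t',
      (∀ i ∈ Finset.univ, t' i ∈ Y i) → (∀ i ∉ Finset.univ, t' i = t i) → P t')).card : ℝ) :=
    lt_of_lt_of_le (by positivity) hYc
  have h2 : 0 < ((Fintype.piFinset (fun _ : ι => R)).filter (fun t => ∀ t',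
      (∀ i ∈ Finset.univ, t' i ∈ Y i) → (∀ i ∉ Finset.univ, t' i = t i) → P t')).card := by
    exact_mod_cast h1
  obtain ⟨t₀, ht₀⟩ := Finset.card_pos.1 h2
  exact (Finset.mem_filter.1 ht₀).2 t (fun i _ => ht i) (fun i hi => absurd (Finset.mem_univ i) hi)


lemma Finset.exists_enum {α : Type*} [DecidableEq α] (Y : Finset α) (a₀ : α) :
    ∃ f : ℕ → α, (∀ c < Y.card, f c ∈ Y) ∧ Set.InjOn f (Set.Iio Y.card) := by
  refine ⟨fun c => if h : c < Y.card then (Y.equivFin.symm ⟨c, h⟩ : α) else a₀, ?_, ?_⟩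
  · intro c hc
    simp [hc]
  · intro a ha b hb hab
    simp only [Set.mem_Iio] at ha hb
    simp only [ha, hb, dif_pos] at hab
    have := Y.equivFin.symm.injective (Subtype.ext hab)
    simpa using this

/-- Sequences built greedily, with linearly many choices in each step, can be chosen in `r`
copies such that arbitrary mixtures of the copies are still valid. -/
lemma exists_blowup_greedy (L r : ℕ) {c : ℝ} (hc : 0 < c) :
    ∃ n₀ : ℕ, ∀ {α : Type u} [DecidableEq α] (R : Finset α), n₀ ≤ R.card →
      ∀ C : ℕ → (ℕ → α) → Prop, (∀ i t t', (∀ a ≤ i, t a = t' a) → C i t → C i t') →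
      (∀ i < L, ∀ t, (∀ a < i, t a ∈ R) → (∀ a < i, C a t) →
        c * R.card ≤ ((R.filter (fun x => C i (Function.update t i x))).card : ℝ)) →
      ∃ e : ℕ → ℕ → α, (∀ i < L, ∀ b < r, e i b ∈ R) ∧ (∀ i < L, Set.InjOn (e i) (Set.Iio r)) ∧
        ∀ σ : ℕ → ℕ, (∀ i, σ i < r) → ∀ i < L, C i (fun a => e a (σ a)) := by
  obtain ⟨n₀, h₀⟩ := exists_blowup.{u} (Fin L) r (δ := c ^ L) (by positivity)
  refine ⟨n₀ + 1, fun {α} _ R hR C hdep hext => ?_⟩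
  have hpos : 0 < R.card := by omega
  obtain ⟨a₀, -⟩ := Finset.card_pos.1 hpos
  let ext : (Fin L → α) → ℕ → α := fun t a => if h : a < L then t ⟨a, h⟩ else a₀
  have hcount := card_greedy (L := L) hpos hc.le (fun i t => C i (ext t)) (by
      intro i t t' h
      refine hdep _ _ _ fun a ha => ?_
      have haL : a < L := lt_of_le_of_lt ha i.2
      simp only [ext, haL, dif_pos]
      exact h _ ha) (by
      intro i t ht h
      refine (hext i i.2 (ext t) (fun a ha => ?_) (fun a ha => ?_)).trans (le_of_eq ?_)
      · have haL : a < L := lt_trans ha i.2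
        simp only [ext, haL, dif_pos]
        exact Fintype.mem_piFinset.1 ht _
      · exact h ⟨a, lt_trans ha i.2⟩ ha
      · congr 3
        ext x
        have : Function.update (ext t) i x = ext (Function.update t i x) := by
          funext a
          by_cases hai : a = i
          · subst hai; simp [ext]
          · by_cases haL : a < L
            · have : (⟨a, haL⟩ : Fin L) ≠ i := by
                rintro rfl; exact hai rfl
              simp [ext, haL, hai, this]
            · simp [ext, haL, hai]
        rw [this])
  obtain ⟨Y, hY, hYt⟩ := h₀ R (by omega) (fun t => ∀ i : Fin L, C i (ext t)) (by
    rw [Fintype.card_fin]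
    convert hcount)
  have hen := fun i : Fin L => (Y i).exists_enum a₀
  choose e he₁ he₂ using hen
  refine ⟨fun i b => if h : i < L then e ⟨i, h⟩ b else a₀, ?_, ?_, ?_⟩
  · intro i hi b hb
    simp only [hi, dif_pos]
    exact (hY _).1 (he₁ _ b (by rw [(hY _).2]; exact hb))
  · intro i hi
    simp only [hi, dif_pos]
    have := he₂ ⟨i, hi⟩
    rwa [(hY _).2] at this
  · intro σ hσ i hi
    have h1 := hYt (fun i => e i (σ i)) (fun i => he₁ i _ (by rw [(hY _).2]; exact hσ i)) ⟨i, hi⟩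
    exact h1

end BlowUp

section Connect

lemma List.mem_drop_map_range {α : Type*} {h : ℕ → α} {i j : ℕ} {a : α} :
    a ∈ ((List.range j).map h).drop i ↔ ∃ q, i ≤ q ∧ q < j ∧ h q = a := by
  rw [List.mem_drop_iff_getElem]
  constructor
  · rintro ⟨m, hm, rfl⟩
    simp only [List.length_map, List.length_range] at hm
    exact ⟨i + m, by omega, by omega, by simp⟩
  · rintro ⟨q, h1, h2, rfl⟩
    exact ⟨q - i, by simp; omega, by simp [Nat.add_sub_cancel' h1]⟩

lemma List.mem_take_map_range {α : Type*} {h : ℕ → α} {i j : ℕ} {a : α} :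
    a ∈ ((List.range j).map h).take i ↔ ∃ q < i, q < j ∧ h q = a := by
  rw [List.mem_take_iff_getElem]
  constructor
  · rintro ⟨m, hm, rfl⟩
    simp only [List.length_map, List.length_range] at hm
    exact ⟨m, by omega, by omega, by simp⟩
  · rintro ⟨q, h1, h2, rfl⟩
    exact ⟨q, by simp; omega, by simp⟩

variable {α : Type*} [DecidableEq α]

/-- The `j`-set which the `i`-th vertex of the connecting structure has to extend. The vertices
`0, …, j - 1` continue the tuple `f`, the vertices `j, …, 2 * j - 1` (read backwards) precede the
tuple `g`, and the vertex `2 * j + b` is a common extension of two `j`-sets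
which differ only in that the `b`-th vertex next to `f` is exchanged for one next to `g`. -/
def connectSet (j : ℕ) (f g : List α) (s i : ℕ) (T : ℕ → α) : Finset α :=
  if i < j then (f.drop i).toFinset ∪ (Finset.range i).image T
  else if i < 2 * j then
    (g.reverse.drop (i - j)).toFinset ∪ (Finset.range (i - j)).image (fun a => T (j + a))
  else (Finset.range j).image (fun a => if a < i - 2 * j + s then T (j + (j - 1 - a)) else T a)

lemma connectSet_congr {j : ℕ} {f g : List α} {s i : ℕ} {T T' : ℕ → α}
    (h : ∀ a < i, T a = T' a) : connectSet j f g s i T = connectSet j f g s i T' := by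
  unfold connectSet
  split_ifs with h1 h2
  · congr 1
    exact Finset.image_congr fun a ha => h a (by simpa using ha)
  · congr 1
    exact Finset.image_congr fun a ha => h _ (by
      have : a < i - j := by simpa using ha
      omega)
  · refine Finset.image_congr fun a ha => ?_
    have ha' : a < j := by simpa using ha
    rw [h a (by omega), h (j + (j - 1 - a)) (by omega)]

lemma card_connect_end {j i : ℕ} {f : List α} {R : Finset α} {T : ℕ → α} (hf : f.length = j)
    (hfn : f.Nodup) (hfR : ∀ a ∈ f, a ∉ R) (hi : i ≤ j) (hT : ∀ a < i, T a ∈ R)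
    (hinj : Set.InjOn T (Set.Iio i)) :
    ((f.drop i).toFinset ∪ (Finset.range i).image T).card = j := by
  rw [Finset.card_union_of_disjoint, Finset.card_image_of_injOn, Finset.card_range,
    List.toFinset_card_of_nodup (hfn.sublist (List.drop_sublist i f)), List.length_drop, hf]
  · omega
  · intro a ha b hb
    exact hinj (by simpa using ha) (by simpa using hb)
  · rw [Finset.disjoint_left]
    intro a ha hb
    simp only [Finset.mem_image, Finset.mem_range] at hb
    obtain ⟨b, hb, rfl⟩ := hb
    exact hfR _ (List.mem_of_mem_drop (List.mem_toFinset.1 ha)) (hT b hb)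

lemma card_connectSet {j : ℕ} {f g : List α} {s i : ℕ} {T : ℕ → α} {R : Finset α}
    (hf : f.length = j) (hfn : f.Nodup) (hfR : ∀ a ∈ f, a ∉ R)
    (hg : g.length = j) (hgn : g.Nodup) (hgR : ∀ a ∈ g, a ∉ R)
    (hT : ∀ a < i, T a ∈ R) (hinj : Set.InjOn T (Set.Iio i)) :
    (connectSet j f g s i T).card = j := by
  unfold connectSet
  split_ifs with h1 h2
  · exact card_connect_end hf hfn hfR h1.le hT hinj
  · refine card_connect_end (by simpa using hg) (List.nodup_reverse.2 hgn)
      (fun a ha => hgR a (List.mem_reverse.1 ha)) (by omega) (fun a ha => hT _ (by omega)) ?_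
    intro a ha b hb hab
    have := hinj (Set.mem_Iio.2 (by simp at ha; omega)) (Set.mem_Iio.2 (by simp at hb; omega)) hab
    omega
  · rw [Finset.card_image_of_injOn, Finset.card_range]
    intro a ha b hb hab
    simp only [Finset.coe_range, Set.mem_Iio] at ha hb
    simp only at hab
    split_ifs at hab
    all_goals
      have := hinj (Set.mem_Iio.2 (by omega)) (Set.mem_Iio.2 (by omega)) hab
      omega

lemma connectSet_subset {j : ℕ} {f g : List α} {s i : ℕ} {T : ℕ → α} {Ω : Finset α}
    (hf : ∀ a ∈ f, a ∈ Ω) (hg : ∀ a ∈ g, a ∈ Ω) (hT : ∀ a < i, T a ∈ Ω) :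
    connectSet j f g s i T ⊆ Ω := by
  unfold connectSet
  split_ifs with h1 h2
  · refine Finset.union_subset (fun a ha => hf a (List.mem_of_mem_drop (List.mem_toFinset.1 ha))) ?_
    intro a ha
    simp only [Finset.mem_image, Finset.mem_range] at ha
    obtain ⟨b, hb, rfl⟩ := ha
    exact hT b hb
  · refine Finset.union_subset (fun a ha => hg a (List.mem_reverse.1
      (List.mem_of_mem_drop (List.mem_toFinset.1 ha)))) ?_
    intro a ha
    simp only [Finset.mem_image, Finset.mem_range] at ha
    obtain ⟨b, hb, rfl⟩ := ha
    exact hT _ (by omega)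
  · intro a ha
    simp only [Finset.mem_image, Finset.mem_range] at ha
    obtain ⟨b, hb, rfl⟩ := ha
    split_ifs
    · exact hT _ (by omega)
    · exact hT _ (by omega)

/-- The validity condition for the `i`-th vertex of the connecting structure. -/
def ConnectValid (j : ℕ) (E : Finset (Finset α)) (f g : List α) (i : ℕ) (T : ℕ → α) : Prop :=
  T i ∉ (Finset.range i).image T ∧ ∀ s < 2, insert (T i) (connectSet j f g s i T) ∈ E

lemma ConnectValid.congr {j : ℕ} {E : Finset (Finset α)} {f g : List α} {i : ℕ} {T T' : ℕ → α}
    (h : ∀ a ≤ i, T a = T' a) (hT : ConnectValid j E f g i T) : ConnectValid j E f g i T' := by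
  refine ⟨?_, fun s hs => ?_⟩
  · rw [← h i le_rfl, ← Finset.image_congr (f := T) (g := T')]
    · exact hT.1
    · intro a ha
      exact h a (by simp at ha; omega)
  · rw [← h i le_rfl, ← connectSet_congr (T := T) (T' := T') fun a ha => h a ha.le]
    exact hT.2 s hs

lemma ConnectValid.injOn {j : ℕ} {E : Finset (Finset α)} {f g : List α} {i : ℕ} {T : ℕ → α}
    (h : ∀ a < i, ConnectValid j E f g a T) : Set.InjOn T (Set.Iio i) := by
  have key : ∀ a b, a < b → b < i → T a ≠ T b := by
    intro a b hab hb he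
    exact (h b hb).1 (Finset.mem_image.2 ⟨a, Finset.mem_range.2 hab, he⟩)
  intro a ha b hb hab
  rcases lt_trichotomy a b with h1 | h1 | h1
  · exact absurd hab (key a b h1 hb)
  · exact h1
  · exact absurd hab.symm (key b a h1 ha)

lemma ConnectValid.card_le {j : ℕ} {E : Finset (Finset α)} {Ω R : Finset α} {θ : ℝ}
    (hD : DiracInto j E Ω R θ) (hRΩ : R ⊆ Ω) {f g : List α}
    (hf : f.length = j) (hfn : f.Nodup) (hfR : ∀ a ∈ f, a ∉ R) (hfΩ : ∀ a ∈ f, a ∈ Ω)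
    (hg : g.length = j) (hgn : g.Nodup) (hgR : ∀ a ∈ g, a ∉ R) (hgΩ : ∀ a ∈ g, a ∈ Ω)
    {i : ℕ} (hi : (i : ℝ) ≤ θ * R.card) {T : ℕ → α} (hT : ∀ a < i, T a ∈ R)
    (hv : ∀ a < i, ConnectValid j E f g a T) :
    θ * R.card ≤
      ((R.filter (fun x => ConnectValid j E f g i (Function.update T i x))).card : ℝ) := by
  have hinj := ConnectValid.injOn hv
  have hS := fun s => connectSet_subset (j := j) (s := s) hfΩ hgΩ (fun a ha => hRΩ (hT a ha))
  have hc := fun s => card_connectSet (s := s) hf hfn hfR hg hgn hgR hT hinj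
  have h1 := hD.two_le_card (hS 0) (hc 0) (hS 1) (hc 1) ((Finset.range i).image T)
  have h2 : (((Finset.range i).image T).card : ℝ) ≤ i := by
    exact_mod_cast Finset.card_image_le.trans (Finset.card_range i).le
  refine le_trans (by linarith : θ * R.card ≤ 2 * θ * R.card - ((Finset.range i).image T).card)
    (h1.trans ?_)
  refine Nat.cast_le.2 (Finset.card_le_card fun x hx => ?_)
  simp only [Finset.mem_sdiff, Finset.mem_inter, mem_extensions] at hx
  refine Finset.mem_filter.2 ⟨hx.1.1.1, ?_, ?_⟩
  · rw [Function.update_self, Finset.image_congr (g := T)]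
    · exact hx.2
    · intro a ha
      have : a ≠ i := by simp at ha; omega
      simp [this]
  · intro s hs
    rw [Function.update_self, connectSet_congr (T' := T)]
    · interval_cases s
      · exact hx.1.1.2
      · exact hx.1.2.2
    · intro a ha
      simp [ha.ne]

/-- The role of position `a` in the `b`-th block of the connecting walk. -/
def connectRole (j b a : ℕ) : ℕ := if a < b then j + (j - 1 - a) else a

def connectBlock (j b : ℕ) : List (ℕ × ℕ) := (List.range j).map (fun a => (connectRole j b a, b))

def connectWalk (j : ℕ) : ℕ → List (ℕ × ℕ)
  | 0 => connectBlock j 0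
  | b + 1 => connectWalk j b ++ (2 * j + b, b) :: connectBlock j (b + 1)

lemma connectRole_lt {j b a : ℕ} (ha : a < j) : connectRole j b a < 2 * j := by
  unfold connectRole; split_ifs <;> omega

lemma mem_connectBlock {j b : ℕ} {x : ℕ × ℕ} (hx : x ∈ connectBlock j b) :
    x.1 < 2 * j ∧ x.2 = b := by
  simp only [connectBlock, List.mem_map, List.mem_range] at hx
  obtain ⟨a, ha, rfl⟩ := hx
  exact ⟨connectRole_lt ha, rfl⟩

lemma mem_connectWalk {j b : ℕ} (hb : b ≤ j) {x : ℕ × ℕ} (hx : x ∈ connectWalk j b) :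
    x.1 < 2 * j + b ∧ x.2 ≤ b := by
  induction b with
  | zero => have := mem_connectBlock hx; omega
  | succ b ih =>
    simp only [connectWalk, List.mem_append, List.mem_cons] at hx
    rcases hx with hx | rfl | hx
    · have := ih (by omega) hx
      omega
    · simp
    · have := mem_connectBlock hx
      omega

lemma nodup_connectBlock (j b : ℕ) : (connectBlock j b).Nodup := by
  refine List.Nodup.map_on ?_ List.nodup_range
  intro x hx y hy hxy
  simp only [List.mem_range] at hx hy
  simp only [connectRole, Prod.mk.injEq, and_true] at hxy
  split_ifs at hxy <;> omega

lemma nodup_connectWalk {j b : ℕ} (hb : b ≤ j) : (connectWalk j b).Nodup := by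
  induction b with
  | zero => exact nodup_connectBlock j 0
  | succ b ih =>
    rw [connectWalk, List.nodup_append]
    refine ⟨ih (by omega), List.nodup_cons.2 ⟨fun h => ?_, nodup_connectBlock _ _⟩, ?_⟩
    · have := mem_connectBlock h
      simp at this
    · rintro x hx y hy rfl
      have h1 := mem_connectWalk (by omega) hx
      rcases List.mem_cons.1 hy with rfl | hy
      · simp at h1
      · have := mem_connectBlock hy
        omega

lemma length_connectBlock (j b : ℕ) : (connectBlock j b).length = j := by simp [connectBlock]

lemma length_connectWalk (j b : ℕ) : (connectWalk j b).length = j + b * (j + 1) := by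
  induction b with
  | zero => simp [connectWalk, length_connectBlock]
  | succ b ih => simp [connectWalk, length_connectBlock, ih]; ring

lemma connectWalk_eq_append (j b : ℕ) : ∃ x, connectWalk j b = x ++ connectBlock j b := by
  cases b with
  | zero => exact ⟨[], rfl⟩
  | succ b => exact ⟨connectWalk j b ++ [(2 * j + b, b)], by simp [connectWalk]⟩

section
variable {j : ℕ} {E : Finset (Finset α)} {f g : List α} {e : ℕ → ℕ → α}

lemma tight_connect_start (hf : f.length = j)
    (he : ∀ σ : ℕ → ℕ, (∀ i, σ i < j + 1) → ∀ i < 3 * j,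
      ConnectValid j E f g i (fun a => e a (σ a))) :
    TightList j E (f ++ (connectBlock j 0).map (fun q => e q.1 q.2)) := by
  refine TightList.append_of_windows hf (by simp [length_connectBlock]) fun i hi => ?_
  have h := (he (fun _ => 0) (by simp) i (by omega)).2 0 (by simp)
  convert h using 1
  ext a
  simp only [connectSet, hi, if_true, connectBlock, List.map_map, List.mem_toFinset,
    List.mem_append, List.mem_take_map_range, Finset.mem_insert, Finset.mem_union,
    Finset.mem_image, Finset.mem_range, Function.comp, connectRole, Nat.not_lt_zero, if_false]
  constructor
  · rintro (h | ⟨q, hq, hqj, rfl⟩)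
    · exact Or.inr (Or.inl h)
    · rcases Nat.lt_succ_iff_lt_or_eq.1 hq with h | rfl
      · exact Or.inr (Or.inr ⟨q, h, rfl⟩)
      · exact Or.inl rfl
  · rintro (rfl | h | ⟨q, hq, rfl⟩)
    · exact Or.inr ⟨i, by omega, hi, rfl⟩
    · exact Or.inl h
    · exact Or.inr ⟨q, by omega, by omega, rfl⟩

lemma tight_connect_end (hg : g.length = j)
    (he : ∀ σ : ℕ → ℕ, (∀ i, σ i < j + 1) → ∀ i < 3 * j,
      ConnectValid j E f g i (fun a => e a (σ a))) :
    TightList j E ((connectBlock j j).map (fun q => e q.1 q.2) ++ g) := by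
  refine TightList.append_of_windows (by simp [length_connectBlock]) hg fun i hi => ?_
  have h := (he (fun _ => j) (by simp) (j + (j - 1 - i)) (by omega)).2 0 (by simp)
  convert h using 1
  ext a
  have h1 : ¬ (j + (j - 1 - i) < j) := by omega
  have h2 : j + (j - 1 - i) < 2 * j := by omega
  have h3 : g.reverse.drop (j + (j - 1 - i) - j) = (g.take (i + 1)).reverse := by
    rw [List.reverse_take, hg]
    congr 1
    omega
  simp only [connectSet, h1, h2, h3, if_true, connectBlock, List.map_map, List.mem_toFinset,
    List.mem_append, List.mem_drop_map_range, Finset.mem_insert, Finset.mem_union,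
    Finset.mem_image, Finset.mem_range, Function.comp, connectRole, if_false, List.mem_reverse]
  constructor
  · rintro (⟨q, hq, hqj, rfl⟩ | h)
    · rw [if_pos hqj]
      by_cases hqi : q = i
      · subst hqi; exact Or.inl rfl
      · exact Or.inr (Or.inr ⟨j - 1 - q, by omega, rfl⟩)
    · exact Or.inr (Or.inl h)
  · rintro (rfl | h | ⟨q, hq, rfl⟩)
    · exact Or.inl ⟨i, le_rfl, hi, by rw [if_pos hi]⟩
    · exact Or.inr h
    · refine Or.inl ⟨j - 1 - q, by omega, by omega, ?_⟩
      rw [if_pos (by omega)]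
      congr 1
      omega

lemma tight_connect_swap {b : ℕ} (hb : b < j)
    (he : ∀ σ : ℕ → ℕ, (∀ i, σ i < j + 1) → ∀ i < 3 * j,
      ConnectValid j E f g i (fun a => e a (σ a))) :
    TightList j E ((connectBlock j b).map (fun q => e q.1 q.2) ++
      e (2 * j + b) b :: (connectBlock j (b + 1)).map (fun q => e q.1 q.2)) := by
  refine TightList.sandwich (by simp [length_connectBlock]) (by simp [length_connectBlock])
    fun i hi => ?_
  have h := (he (fun q => if q < 2 * j then (if (if q < j then q else 2 * j - 1 - q) < i
    then b + 1 else b) else b) (by intro q; split_ifs <;> omega) (2 * j + b)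
    (by omega)).2 (if b < i then 1 else 0) (by split_ifs <;> omega)
  convert h using 1
  have h1 : ¬ (2 * j + b < j) := by omega
  have h2 : ¬ (2 * j + b < 2 * j) := by omega
  have h3 : 2 * j + b - 2 * j = b := by omega
  have hrole : ∀ a < j, (if a < b + (if b < i then 1 else 0) then
      (fun q => e q (if q < 2 * j then (if (if q < j then q else 2 * j - 1 - q) < i
        then b + 1 else b) else b)) (j + (j - 1 - a)) else
      (fun q => e q (if q < 2 * j then (if (if q < j then q else 2 * j - 1 - q) < i
        then b + 1 else b) else b)) a) =
      if a < i then e (connectRole j (b + 1) a) (b + 1) else e (connectRole j b a) b := by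
    intro a ha
    have e1 : j + (j - 1 - a) < 2 * j := by omega
    have e2 : ¬ (j + (j - 1 - a) < j) := by omega
    have e3 : 2 * j - 1 - (j + (j - 1 - a)) = a := by omega
    have e4 : a < 2 * j := by omega
    simp only [e1, e2, e3, e4, ha, if_true, if_false, connectRole]
    split_ifs <;> first | rfl | omega
  ext x
  simp only [connectSet, h1, h2, h3, connectBlock, List.map_map, List.mem_toFinset,
    List.mem_append, List.mem_cons, List.mem_drop_map_range, List.mem_take_map_range,
    Finset.mem_insert, Finset.mem_image, Finset.mem_range, Function.comp, if_false]
  constructor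
  · rintro (⟨q, hq, hqj, rfl⟩ | h | ⟨q, hq, hqj, rfl⟩)
    · refine Or.inr ⟨q, hqj, ?_⟩
      rw [hrole q hqj, if_neg (by omega)]
    · exact Or.inl h
    · refine Or.inr ⟨q, hqj, ?_⟩
      rw [hrole q hqj, if_pos hq]
  · rintro (h | ⟨q, hq, rfl⟩)
    · exact Or.inr (Or.inl h)
    · rw [hrole q hq]
      by_cases hqi : q < i
      · exact Or.inr (Or.inr ⟨q, hqi, hq, by rw [if_pos hqi]⟩)
      · exact Or.inl ⟨q, by omega, hq, by rw [if_neg hqi]⟩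

lemma tight_connectWalk (hf : f.length = j)
    (he : ∀ σ : ℕ → ℕ, (∀ i, σ i < j + 1) → ∀ i < 3 * j,
      ConnectValid j E f g i (fun a => e a (σ a))) {b : ℕ} (hb : b ≤ j) :
    TightList j E (f ++ (connectWalk j b).map (fun q => e q.1 q.2)) := by
  induction b with
  | zero => exact tight_connect_start hf he
  | succ b ih =>
    obtain ⟨x, hx⟩ := connectWalk_eq_append j b
    have h1 := ih (by omega)
    have h2 := tight_connect_swap (b := b) (by omega) he
    rw [hx, List.map_append, ← List.append_assoc] at h1
    have h3 := TightList.glue (by simp [length_connectBlock]) h1 h2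
    simpa [connectWalk, hx] using h3

end


/-- The connecting lemma. -/
lemma exists_connect {j : ℕ} (hj : 1 ≤ j) {θ : ℝ} (hθ : 0 < θ) :
    ∃ n₀ : ℕ, ∀ {α : Type u} [DecidableEq α] (E : Finset (Finset α)) (Ω R : Finset α),
      DiracInto j E Ω R θ → R ⊆ Ω → n₀ ≤ R.card → ∀ f g : List α,
      f.length = j → f.Nodup → (∀ a ∈ f, a ∉ R) → (∀ a ∈ f, a ∈ Ω) →
      g.length = j → g.Nodup → (∀ a ∈ g, a ∉ R) → (∀ a ∈ g, a ∈ Ω) →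
      ∃ p : List α, p.length ≤ (j + 1) * (j + 1) ∧ p.Nodup ∧ (∀ a ∈ p, a ∈ R) ∧
        TightList j E (f ++ p ++ g) := by
  obtain ⟨n₀, h₀⟩ := exists_blowup_greedy.{u} (3 * j) (j + 1) hθ
  obtain ⟨n₁, h₁⟩ := exists_nat_ge (3 * j / θ)
  refine ⟨n₀ + n₁, fun {α} _ E Ω R hD hRΩ hR f g hf hfn hfR hfΩ hg hgn hgR hgΩ => ?_⟩
  have hlin : (3 * j : ℝ) ≤ θ * R.card := by
    rw [div_le_iff₀ hθ] at h₁
    have : (n₁ : ℝ) ≤ R.card := by exact_mod_cast (by omega)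
    nlinarith
  obtain ⟨e, heR, heinj, he⟩ := h₀ R (by omega) (ConnectValid j E f g)
    (fun i t t' h => ConnectValid.congr h) (fun i hi t ht hv =>
      ConnectValid.card_le hD hRΩ hf hfn hfR hfΩ hg hgn hgR hgΩ (by
        refine le_trans ?_ hlin
        exact_mod_cast hi.le) ht hv)
  refine ⟨(connectWalk j j).map (fun q => e q.1 q.2), ?_, ?_, ?_, ?_⟩
  · rw [List.length_map, length_connectWalk]
    nlinarith
  · refine List.Nodup.map_on ?_ (nodup_connectWalk le_rfl)
    rintro ⟨x, c⟩ hx ⟨y, d⟩ hy hxy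
    have hx' := mem_connectWalk le_rfl hx
    have hy' := mem_connectWalk le_rfl hy
    simp only at hx' hy' hxy
    by_cases hxy' : x = y
    · subst hxy'
      have := heinj x (by omega) (Set.mem_Iio.2 (by omega)) (Set.mem_Iio.2 (by omega)) hxy
      rw [this]
    · exfalso
      have hinj := ConnectValid.injOn (i := 3 * j)
        (he (fun q => if q = x then c else if q = y then d else 0)
          (by intro q; split_ifs <;> omega))
      refine hxy' (hinj (Set.mem_Iio.2 (by omega)) (Set.mem_Iio.2 (by omega)) ?_)
      simpa [Ne.symm hxy'] using hxy
  · intro a ha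
    obtain ⟨⟨x, c⟩, hx, rfl⟩ := List.mem_map.1 ha
    have hx' := mem_connectWalk le_rfl hx
    exact heR x (by simp only at hx'; omega) c (by simp only at hx'; omega)
  · obtain ⟨x, hx⟩ := connectWalk_eq_append j j
    have h1 := tight_connectWalk hf he le_rfl
    rw [hx, List.map_append, ← List.append_assoc] at h1
    have h3 := TightList.glue (by simp [length_connectBlock]) h1 (tight_connect_end hg he)
    simpa [hx] using h3

end Connect

section TightPath
variable {α : Type*} [DecidableEq α]

lemma TightList.cons {j : ℕ} {E : Finset (Finset α)} {x : α} {l : List α} (h : TightList j E l)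
    (hx : insert x (l.take j).toFinset ∈ E) : TightList j E (x :: l) := by
  intro w hw hlen
  rcases List.infix_cons_iff.1 hw with hw | hw
  · have : w = x :: l.take j := by
      rw [List.prefix_iff_eq_take.1 hw, hlen, List.take_succ_cons]
    rw [this, List.toFinset_cons]
    exact hx
  · exact h w hw hlen

lemma exists_sub_shadow_degree {H : Finset (Finset α)} {L : ℕ}
    (h : L * H.shadow.card < H.card) :
    ∃ H' ⊆ H, H'.Nonempty ∧ ∀ T ∈ H'.shadow, L < (H'.filter (fun e => T ⊆ e)).card := by
  obtain ⟨H', hH', hmin⟩ := Finset.exists_min_image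
    (H.powerset.filter (fun H' => L * H'.shadow.card < H'.card)) Finset.card
    ⟨H, by simpa using h⟩
  simp only [Finset.mem_filter, Finset.mem_powerset] at hH' hmin
  refine ⟨H', hH'.1, Finset.card_pos.1 (by omega), fun T hT => ?_⟩
  by_contra! hle
  obtain ⟨e, he, a, ha, hTe⟩ := Finset.mem_shadow_iff.1 hT
  have hsplit := Finset.card_filter_add_card_filter_not (s := H') (fun e => T ⊆ e)
  have hpos : 0 < (H'.filter (fun e => T ⊆ e)).card :=
    Finset.card_pos.2 ⟨e, by simp [he, ← hTe, Finset.erase_subset]⟩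
  have hsh : (H'.filter (fun e => ¬ T ⊆ e)).shadow ⊆ H'.shadow.erase T := by
    intro S hS
    obtain ⟨e', he', b, hb, rfl⟩ := Finset.mem_shadow_iff.1 hS
    rw [Finset.mem_filter] at he'
    refine Finset.mem_erase.2 ⟨?_, Finset.mem_shadow_iff.2 ⟨e', he'.1, b, hb, rfl⟩⟩
    rintro rfl
    exact he'.2 (Finset.erase_subset _ _)
  have hc := Finset.card_le_card hsh
  rw [Finset.card_erase_of_mem hT] at hc
  have hTpos : 0 < H'.shadow.card := Finset.card_pos.2 ⟨T, hT⟩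
  have hlt : L * (H'.filter (fun e => ¬ T ⊆ e)).shadow.card <
      (H'.filter (fun e => ¬ T ⊆ e)).card := by
    obtain ⟨s, hs⟩ : ∃ s, H'.shadow.card = s + 1 := ⟨H'.shadow.card - 1, by omega⟩
    have h1 : L * (H'.filter (fun e => ¬ T ⊆ e)).shadow.card ≤ L * s :=
      Nat.mul_le_mul_left _ (by omega)
    have h2 := hH'.2
    rw [hs, mul_add] at h2
    omega
  have := hmin _ ⟨(Finset.filter_subset _ _).trans hH'.1, hlt⟩
  omega

lemma exists_extension_of_degree {H : Finset (Finset α)} {i L : ℕ}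
    (hH : ∀ e ∈ H, e.card = i + 1) {T : Finset α} (hT : T.card = i)
    (hd : L < (H.filter (fun e => T ⊆ e)).card) {l : List α} (hl : l.length ≤ L) :
    ∃ x, x ∉ l ∧ insert x T ∈ H := by
  by_contra! hcon
  have : (H.filter (fun e => T ⊆ e)) ⊆ l.toFinset.image (fun x => insert x T) := by
    intro e he
    rw [Finset.mem_filter] at he
    have hc : (e \ T).card = 1 := by
      rw [Finset.card_sdiff_of_subset he.2, hH e he.1, hT]
      omega
    obtain ⟨x, hx⟩ := Finset.card_eq_one.1 hc
    have hex : insert x T = e := by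
      rw [Finset.insert_eq, ← hx, Finset.sdiff_union_of_subset he.2]
    refine Finset.mem_image.2 ⟨x, ?_, hex⟩
    by_contra hxl
    exact hcon x (by simpa using hxl) (hex ▸ he.1)
  have h1 := Finset.card_le_card this
  have h2 := Finset.card_image_le (s := l.toFinset) (f := fun x => insert x T)
  have h3 := List.toFinset_card_le l
  omega

/-- A dense uniform hypergraph contains a long tight path. -/
lemma exists_tightList_of_card {H : Finset (Finset α)} {W : Finset α} {i L : ℕ} (hiL : i ≤ L)
    (hH : ∀ e ∈ H, e ⊆ W ∧ e.card = i + 1) (hc : L * W.card ^ i < H.card) :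
    ∃ w : List α, w.length = L ∧ w.Nodup ∧ (∀ a ∈ w, a ∈ W) ∧ TightList i H w := by
  have hsh : H.shadow.card ≤ W.card ^ i := by
    refine le_trans (Finset.card_le_card (t := W.powersetCard i) ?_) ?_
    · intro S hS
      obtain ⟨e, he, a, ha, rfl⟩ := Finset.mem_shadow_iff.1 hS
      rw [Finset.mem_powersetCard, Finset.card_erase_of_mem ha, (hH e he).2]
      exact ⟨(Finset.erase_subset _ _).trans (hH e he).1, by omega⟩
    · rw [Finset.card_powersetCard]
      exact Nat.choose_le_pow _ _
  obtain ⟨H', hH', ⟨e₀, he₀⟩, hd⟩ := exists_sub_shadow_degree (H := H) (L := L)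
    (lt_of_le_of_lt (Nat.mul_le_mul_left _ hsh) hc)
  have key : ∀ m, i + m ≤ L → ∃ w : List α, w.length = i + m ∧ w.Nodup ∧ (∀ a ∈ w, a ∈ W) ∧
      TightList i H' w ∧ (w.take i).toFinset ∈ H'.shadow := by
    intro m
    induction m with
    | zero =>
      intro _
      have hne : e₀.Nonempty := Finset.card_pos.1 (by rw [(hH _ (hH' he₀)).2]; omega)
      obtain ⟨a, ha⟩ := hne
      have hcard : (e₀.erase a).card = i := by
        rw [Finset.card_erase_of_mem ha, (hH _ (hH' he₀)).2]
        omega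
      have hlen : (e₀.erase a).toList.length = i := by rw [Finset.length_toList, hcard]
      refine ⟨(e₀.erase a).toList, hlen, Finset.nodup_toList _, ?_,
        TightList.of_length_le hlen.le, ?_⟩
      · intro b hb
        exact (hH _ (hH' he₀)).1 (Finset.mem_of_mem_erase (Finset.mem_toList.1 hb))
      · rw [List.take_of_length_le hlen.le, Finset.toList_toFinset]
        exact Finset.mem_shadow_iff.2 ⟨e₀, he₀, a, ha, rfl⟩
    | succ m ih =>
      intro hm
      obtain ⟨w, hlen, hnd, hW, ht, hs⟩ := ih (by omega)
      have htc : (w.take i).toFinset.card = i := by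
        rw [List.toFinset_card_of_nodup (hnd.sublist (List.take_sublist _ _)), List.length_take]
        omega
      obtain ⟨x, hx, hxe⟩ := exists_extension_of_degree (fun e he => (hH e (hH' he)).2) htc
        (hd _ hs) (l := w) (by omega)
      refine ⟨x :: w, by simp [hlen]; omega, List.nodup_cons.2 ⟨hx, hnd⟩, ?_, ht.cons hxe, ?_⟩
      · intro b hb
        rcases List.mem_cons.1 hb with rfl | hb
        · exact (hH _ (hH' hxe)).1 (Finset.mem_insert_self _ _)
        · exact hW b hb
      · have hsub : ((x :: w).take i).toFinset ⊆ insert x (w.take i).toFinset := by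
          rw [← List.toFinset_cons]
          intro b
          rw [← List.take_succ_cons, List.mem_toFinset, List.mem_toFinset]
          exact fun h => (List.take_sublist_take_left (Nat.le_succ i)).subset h
        have hc1 : ((x :: w).take i).toFinset.card = i := by
          rw [List.toFinset_card_of_nodup ((List.nodup_cons.2 ⟨hx, hnd⟩).sublist
            (List.take_sublist _ _)), List.length_take, List.length_cons]
          omega
        have hc2 := (hH _ (hH' hxe)).2
        obtain ⟨a, ha⟩ := Finset.card_eq_one.1 (show ((insert x (w.take i).toFinset) \
          ((x :: w).take i).toFinset).card = 1 by rw [Finset.card_sdiff_of_subset hsub]; omega)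
        refine Finset.mem_shadow_iff_insert_mem.2 ⟨a, ?_, ?_⟩
        · have : a ∈ (insert x (w.take i).toFinset) \ ((x :: w).take i).toFinset := by simp [ha]
          exact (Finset.mem_sdiff.1 this).2
        · rw [Finset.insert_eq, ← ha, Finset.sdiff_union_of_subset hsub]
          exact hxe
  obtain ⟨w, h1, h2, h3, h4, -⟩ := key (L - i) (by omega)
  exact ⟨w, by omega, h2, h3, fun v hv hl => hH' (h4 v hv hl)⟩

end TightPath

section Interleave
variable {α : Type*}

/-- Insert the entries of the second list between consecutive blocks of length `j` of the
first one. -/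
def interleave (j : ℕ) : List α → List α → List α
  | w, [] => w.take j
  | w, q :: qs => w.take j ++ q :: interleave j (w.drop j) qs

lemma interleave_perm (j : ℕ) (w qs : List α) :
    (interleave j w qs).Perm (w.take (j * (qs.length + 1)) ++ qs) := by
  induction qs generalizing w with
  | nil => simp [interleave]
  | cons q qs ih =>
    have h : w.take (j * ((q :: qs).length + 1)) =
        w.take j ++ (w.drop j).take (j * (qs.length + 1)) := by
      rw [← List.take_add, List.length_cons]
      congr 1
      ring
    rw [interleave, h, List.append_assoc]
    refine List.Perm.append_left _ ?_
    exact ((ih (w.drop j)).cons q).trans List.perm_middle.symm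

lemma interleave_eq_append (j : ℕ) (w qs : List α) :
    ∃ r, interleave j w qs = w.take j ++ r := by
  cases qs with
  | nil => exact ⟨[], by simp [interleave]⟩
  | cons q qs => exact ⟨_, rfl⟩

lemma List.drop_append_take_isInfix {i j : ℕ} {w : List α} (h : i ≤ j) :
    (w.take j).drop i ++ (w.drop j).take i <:+: w := by
  refine ⟨w.take i, (w.drop j).drop i, ?_⟩
  calc _ = (w.take i ++ (w.take j).drop i) ++ ((w.drop j).take i ++ (w.drop j).drop i) := by
        simp only [List.append_assoc]
    _ = _ := by
      have : w.take i = (w.take j).take i := by rw [List.take_take, min_eq_left h]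
      rw [this, List.take_append_drop, List.take_append_drop, List.take_append_drop]

lemma tightList_interleave [DecidableEq α] {j : ℕ} {E : Finset (Finset α)} (w qs : List α)
    (hl : j * (qs.length + 1) ≤ w.length)
    (h : ∀ v, v <:+: w → v.length = j → ∀ q ∈ qs, insert q v.toFinset ∈ E) :
    TightList j E (interleave j w qs) := by
  induction qs generalizing w with
  | nil => exact TightList.of_length_le (by simp [interleave])
  | cons q qs ih =>
    have hl' : j * (qs.length + 1) + j ≤ w.length := by
      rw [List.length_cons] at hl
      nlinarith
    have hj : j ≤ j * (qs.length + 1) := by nlinarith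
    obtain ⟨r, hr⟩ := interleave_eq_append j (w.drop j) qs
    have hA : (w.take j).length = j := by
      rw [List.length_take]
      omega
    have hB : ((w.drop j).take j).length = j := by
      rw [List.length_take, List.length_drop]
      omega
    have h1 : TightList j E (w.take j ++ q :: (w.drop j).take j) := by
      refine TightList.sandwich hA hB fun i hi => ?_
      have h2 : (w.take j).drop i ++ ((w.drop j).take j).take i <:+: w := by
        rw [List.take_take, min_eq_left hi]
        exact List.drop_append_take_isInfix hi
      have h3 := h _ h2 (by
        rw [List.length_append, List.length_drop, hA, List.length_take, hB]
        omega) q (by simp)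
      convert h3 using 1
      ext a
      simp only [List.mem_toFinset, List.mem_append, List.mem_cons, Finset.mem_insert]
      tauto
    have h4 := ih (w.drop j) (by rw [List.length_drop]; omega) (fun v hv hlen q' hq' =>
      h v (hv.trans (List.drop_suffix _ _).isInfix) hlen q' (by simp [hq']))
    rw [hr] at h4
    have h5 := TightList.glue (x := w.take j ++ [q]) (m := (w.drop j).take j) (y := r) hB.ge
      (by simpa using h1) h4
    rw [interleave, hr]
    simpa using h5

end Interleave

section Cover
variable {α : Type*} [DecidableEq α]

/-- A family of disjoint tight lists in `Y` with lengths in `[s, 2 * s)`. -/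
def IsPacking (j : ℕ) (E : Finset (Finset α)) (Y : Finset α) (s : ℕ) (segs : List (List α)) :
    Prop :=
  segs.flatten.Nodup ∧ (∀ a ∈ segs.flatten, a ∈ Y) ∧
    ∀ P ∈ segs, TightList j E P ∧ s ≤ P.length ∧ P.length < 2 * s

lemma IsPacking.perm {j s : ℕ} {E : Finset (Finset α)} {Y : Finset α} {segs segs' : List (List α)}
    (h : IsPacking j E Y s segs) (hp : segs.Perm segs') : IsPacking j E Y s segs' :=
  ⟨hp.flatten.nodup_iff.1 h.1, fun a ha => h.2.1 a (hp.flatten.mem_iff.2 ha),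
    fun P hP => h.2.2 P (hp.mem_iff.2 hP)⟩

lemma IsPacking.tail {j s : ℕ} {E : Finset (Finset α)} {Y : Finset α} {P : List α}
    {segs : List (List α)} (h : IsPacking j E Y s (P :: segs)) : IsPacking j E Y s segs := by
  obtain ⟨h1, h2, h3⟩ := h
  rw [List.flatten_cons] at h1 h2
  exact ⟨h1.sublist (List.sublist_append_right _ _), fun a ha => h2 a (by simp [ha]),
    fun Q hQ => h3 Q (by simp [hQ])⟩

lemma IsPacking.add {j s : ℕ} (hs : 1 ≤ s) {E : Finset (Finset α)} {Y : Finset α} (p : List α) :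
    ∀ segs : List (List α), IsPacking j E Y s segs → TightList j E p → p.Nodup →
      (∀ a ∈ p, a ∈ Y) → p.Disjoint segs.flatten → s ≤ p.length →
      ∃ segs', IsPacking j E Y s segs' ∧ segs'.flatten.length = segs.flatten.length + p.length := by
  induction hn : p.length using Nat.strong_induction_on generalizing p with
  | _ n ih =>
    subst hn
    intro segs hseg ht hnd hY hd hlen
    by_cases h2 : p.length < 2 * s
    · refine ⟨p :: segs, ⟨?_, ?_, ?_⟩, by simp [add_comm]⟩
      · rw [List.flatten_cons, List.nodup_append']
        exact ⟨hnd, hseg.1, hd⟩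
      · rw [List.flatten_cons]
        intro a ha
        rcases List.mem_append.1 ha with ha | ha
        · exact hY a ha
        · exact hseg.2.1 a ha
      · intro P hP
        rcases List.mem_cons.1 hP with rfl | hP
        · exact ⟨ht, hlen, h2⟩
        · exact hseg.2.2 P hP
    · have hsub1 : p.take s <:+: p := (List.take_prefix _ _).isInfix
      have hsub2 : p.drop s <:+: p := (List.drop_suffix _ _).isInfix
      have hdd : (p.take s).Disjoint (p.drop s) := by
        have := hnd
        rw [← List.take_append_drop s p, List.nodup_append'] at this
        exact this.2.2
      obtain ⟨segs', h3, h4⟩ := ih (p.drop s).length (by rw [List.length_drop]; omega) (p.drop s)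
        rfl (p.take s :: segs) ⟨by
          rw [List.flatten_cons, List.nodup_append']
          exact ⟨hnd.sublist hsub1.sublist, hseg.1, fun a ha hb => hd (hsub1.subset ha) hb⟩, by
          rw [List.flatten_cons]
          intro a ha
          rcases List.mem_append.1 ha with ha | ha
          · exact hY a (hsub1.subset ha)
          · exact hseg.2.1 a ha, by
          intro P hP
          rcases List.mem_cons.1 hP with rfl | hP
          · exact ⟨ht.of_isInfix hsub1, by rw [List.length_take]; omega, by
              rw [List.length_take]; omega⟩
          · exact hseg.2.2 P hP⟩ (ht.of_isInfix hsub2) (hnd.sublist hsub2.sublist)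
        (fun a ha => hY a (hsub2.subset ha)) (by
          rw [List.flatten_cons]
          intro a ha hb
          rcases List.mem_append.1 hb with hb | hb
          · exact hdd hb ha
          · exact hd (hsub2.subset ha) hb) (by rw [List.length_drop]; omega)
      refine ⟨segs', h3, ?_⟩
      rw [h4, List.flatten_cons, List.length_append, List.length_take, List.length_drop]
      omega

lemma exists_max_packing (j : ℕ) (E : Finset (Finset α)) (Y : Finset α) (s : ℕ) :
    ∃ segs, IsPacking j E Y s segs ∧ ∀ segs', IsPacking j E Y s segs' →
      segs'.flatten.length ≤ segs.flatten.length := by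
  have hb : ∀ segs, IsPacking j E Y s segs → segs.flatten.length ≤ Y.card := by
    intro segs h
    rw [← List.toFinset_card_of_nodup h.1]
    exact Finset.card_le_card fun a ha => h.2.1 a (List.mem_toFinset.1 ha)
  obtain ⟨segs, h1, h2⟩ := Nat.findGreatest_spec (P := fun m => ∃ segs, IsPacking j E Y s segs ∧
    segs.flatten.length = m) (m := 0) (n := Y.card)
    (Nat.zero_le _) ⟨[], ⟨by simp, by simp, by simp⟩, rfl⟩
  refine ⟨segs, h1, fun segs' h' => ?_⟩
  rw [h2]
  exact Nat.le_findGreatest (hb _ h') ⟨segs', h', rfl⟩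

end Cover

section Cover
variable {α : Type*} [DecidableEq α]

lemma disjoint_flatten_of_sdiff {Y : Finset α} {p : List α} {segs : List (List α)}
    (hp : ∀ a ∈ p, a ∈ Y \ segs.flatten.toFinset) :
    p.Disjoint segs.flatten := fun a ha hb => by
  have := hp a ha
  simp only [Finset.mem_sdiff, List.mem_toFinset] at this
  exact this.2 hb

/-- In a maximum packing, the uncovered vertices span few edges. -/
lemma IsPacking.card_edges_le {j s : ℕ} (hjs : j ≤ s) (hs : 1 ≤ s) {E : Finset (Finset α)}
    (hE : ∀ e ∈ E, e.card = j + 1) {Y : Finset α} {segs : List (List α)}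
    (h : IsPacking j E Y s segs)
    (hmax : ∀ segs', IsPacking j E Y s segs' → segs'.flatten.length ≤ segs.flatten.length) :
    (E.filter (fun e => e ⊆ Y \ segs.flatten.toFinset)).card ≤
      s * (Y \ segs.flatten.toFinset).card ^ j := by
  by_contra! hlt
  obtain ⟨w, h1, h2, h3, h4⟩ := exists_tightList_of_card hjs (fun e he => by
    rw [Finset.mem_filter] at he
    exact ⟨he.2, hE _ he.1⟩) hlt
  obtain ⟨segs', h5, h6⟩ := IsPacking.add hs w segs h
    (fun v hv hl => (Finset.mem_filter.1 (h4 v hv hl)).1) h2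
    (fun a ha => (Finset.mem_sdiff.1 (h3 a ha)).1)
    (disjoint_flatten_of_sdiff h3) h1.ge
  have := hmax _ h5
  omega

/-- In a maximum packing, few sets of uncovered vertices are completely joined to a given half
of a given segment. -/
lemma IsPacking.card_joined_le {i s : ℕ} (hs : 1 ≤ s) {E : Finset (Finset α)}
    {Y : Finset α} {segs : List (List α)}
    (h : IsPacking (i + 1) E Y s segs)
    (hmax : ∀ segs', IsPacking (i + 1) E Y s segs' → segs'.flatten.length ≤ segs.flatten.length)
    {P : List α} (hP : P ∈ segs) {Q : Finset α} (hQ : Q ⊆ P.toFinset) (hPQ : P.length ≤ 2 * Q.card) :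
    (((Y \ segs.flatten.toFinset).powersetCard (i + 1)).filter
      (fun S => ∀ q ∈ Q, insert q S ∈ E)).card ≤
      ((i + 1) * (2 * s + 1)) * (Y \ segs.flatten.toFinset).card ^ i := by
  by_contra! hlt
  obtain ⟨w, h1, h2, h3, h4⟩ := exists_tightList_of_card (by nlinarith) (fun e he => by
    rw [Finset.mem_filter, Finset.mem_powersetCard] at he
    exact he.1) hlt
  have hQP : ∀ q ∈ Q.toList, q ∈ P := fun q hq => by simpa using hQ (Finset.mem_toList.1 hq)
  have hp : segs.Perm (P :: segs.erase P) := List.perm_cons_erase hP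
  have hpack := h.perm hp
  have hPn : P.Nodup := by
    have := hpack.1
    rw [List.flatten_cons, List.nodup_append'] at this
    exact this.1
  have hQc : Q.card ≤ P.length := by
    rw [← List.toFinset_card_of_nodup hPn]
    exact Finset.card_le_card hQ
  have hPs := h.2.2 P hP
  have hlen : (i + 1) * (Q.toList.length + 1) ≤ w.length := by
    rw [h1, Finset.length_toList]
    exact Nat.mul_le_mul_left _ (by omega)
  have hwd : ∀ a ∈ w, a ∉ segs.flatten := fun a ha => by
    have := h3 a ha
    simp only [Finset.mem_sdiff, List.mem_toFinset] at this
    exact this.2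
  have hPf : ∀ a ∈ P, a ∈ segs.flatten := fun a ha => List.mem_flatten.2 ⟨P, hP, ha⟩
  have hperm := interleave_perm (i + 1) w Q.toList
  have hmem : ∀ a ∈ interleave (i + 1) w Q.toList, a ∈ w ∨ a ∈ P := fun a ha => by
    rcases List.mem_append.1 (hperm.mem_iff.1 ha) with ha | ha
    · exact Or.inl (List.mem_of_mem_take ha)
    · exact Or.inr (hQP a ha)
  have hl := hperm.length_eq
  rw [List.length_append, List.length_take, min_eq_left hlen, Finset.length_toList] at hl
  have hl' : P.length < (interleave (i + 1) w Q.toList).length := by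
    rw [hl]
    nlinarith
  obtain ⟨segs', h5, h6⟩ := IsPacking.add hs (interleave (i + 1) w Q.toList) (segs.erase P)
    hpack.tail (tightList_interleave w _ hlen (fun v hv hvl q hq =>
      (Finset.mem_filter.1 (h4 v hv hvl)).2 q (Finset.mem_toList.1 hq)))
    (hperm.nodup_iff.2 (List.nodup_append'.2 ⟨h2.sublist (List.take_sublist _ _),
      Finset.nodup_toList _, fun a ha hb => hwd a (List.mem_of_mem_take ha) (hPf a (hQP a hb))⟩))
    (fun a ha => by
      rcases hmem a ha with ha | ha
      · exact (Finset.mem_sdiff.1 (h3 a ha)).1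
      · exact h.2.1 a (hPf a ha))
    (fun a ha hb => by
      rcases hmem a ha with ha | ha
      · exact hwd a ha (hp.flatten.mem_iff.2 (by simp [hb]))
      · have := hpack.1
        rw [List.flatten_cons, List.nodup_append'] at this
        exact this.2.2 ha hb) (by omega)
  have := hmax _ h5
  have h7 := hp.flatten.length_eq
  rw [List.flatten_cons, List.length_append] at h7
  omega

lemma IsPacking.sum_extensions_le {i s : ℕ} (hs : 1 ≤ s) {E : Finset (Finset α)}
    {Y : Finset α} {segs : List (List α)}
    (h : IsPacking (i + 1) E Y s segs)
    (hmax : ∀ segs', IsPacking (i + 1) E Y s segs' → segs'.flatten.length ≤ segs.flatten.length)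
    {P : List α} (hP : P ∈ segs) {𝒮 : Finset (Finset α)}
    (h𝒮 : 𝒮 = (Y \ segs.flatten.toFinset).powersetCard (i + 1)) :
    2 * ∑ S ∈ 𝒮, (extensions E P.toFinset S).card ≤
      (𝒮.card + 2 * (2 ^ (2 * s) * (((i + 1) * (2 * s + 1)) * (Y \ segs.flatten.toFinset).card ^ i)))
        * P.length := by
  set ℓ := ((i + 1) * (2 * s + 1)) * (Y \ segs.flatten.toFinset).card ^ i with hℓ
  have hbad : (𝒮.filter (fun S => P.length ≤ 2 * (extensions E P.toFinset S).card)).card ≤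
      2 ^ (2 * s) * ℓ := by
    have hsub : 𝒮.filter (fun S => P.length ≤ 2 * (extensions E P.toFinset S).card) ⊆
        (P.toFinset.powerset.filter (fun Q => P.length ≤ 2 * Q.card)).biUnion
          (fun Q => 𝒮.filter (fun S => ∀ q ∈ Q, insert q S ∈ E)) := by
      intro S hS
      rw [Finset.mem_filter] at hS
      refine Finset.mem_biUnion.2 ⟨extensions E P.toFinset S, ?_, ?_⟩
      · rw [Finset.mem_filter, Finset.mem_powerset]
        exact ⟨Finset.filter_subset _ _, hS.2⟩
      · rw [Finset.mem_filter]
        exact ⟨hS.1, fun q hq => (mem_extensions.1 hq).2⟩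
    refine (Finset.card_le_card hsub).trans ?_
    refine (Finset.card_biUnion_le_card_mul _ _ ℓ ?_).trans ?_
    · intro Q hQ
      rw [Finset.mem_filter, Finset.mem_powerset] at hQ
      rw [h𝒮]
      exact h.card_joined_le hs hmax hP hQ.1 hQ.2
    · refine Nat.mul_le_mul_right _ ((Finset.card_filter_le _ _).trans ?_)
      rw [Finset.card_powerset]
      refine Nat.pow_le_pow_right (by norm_num) ?_
      have := List.toFinset_card_le P
      have := (h.2.2 P hP).2.2
      omega
  have hS : ∀ S ∈ 𝒮, 2 * (extensions E P.toFinset S).card ≤ P.length +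
      2 * P.length * (if P.length ≤ 2 * (extensions E P.toFinset S).card then 1 else 0) := by
    intro S _
    have h1 : (extensions E P.toFinset S).card ≤ P.length :=
      (Finset.card_filter_le _ _).trans (List.toFinset_card_le P)
    split_ifs <;> omega
  rw [Finset.mul_sum]
  refine (Finset.sum_le_sum hS).trans ?_
  rw [Finset.sum_add_distrib, ← Finset.mul_sum, ← Finset.card_filter, Finset.sum_const, smul_eq_mul]
  nlinarith

end Cover

lemma exists_cover (i s : ℕ) (hs : i + 1 ≤ s) {θ : ℝ} (hθ : 0 < θ) :
    ∃ C : ℕ, ∀ {α : Type u} [DecidableEq α] (E : Finset (Finset α)) (Y : Finset α),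
      (∀ e ∈ E, e.card = (i + 1) + 1) → DiracInto (i + 1) E Y Y θ →
      ∃ segs, IsPacking (i + 1) E Y s segs ∧ (Y \ segs.flatten.toFinset).card ≤ C := by
  set K : ℕ := 2 ^ (2 * s) * ((i + 1) * (2 * s + 1)) with hK
  obtain ⟨C, hC⟩ := exists_nat_ge (((i + 2) * s + K : ℕ) * ((i + 1).factorial * 2 ^ (i + 1)) / θ)
  refine ⟨C + 2 * (i + 1), fun {α} _ E Y hE hD => ?_⟩
  obtain ⟨segs, hp, hmax⟩ := exists_max_packing (i + 1) E Y s
  refine ⟨segs, hp, ?_⟩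
  by_contra! hlt
  have hedge := hp.card_edges_le hs (by omega) hE hmax
  have hsum := fun P hP => hp.sum_extensions_le (by omega) hmax (P := P) hP rfl
  set W := Y \ segs.flatten.toFinset with hW
  have hWY : W ⊆ Y := Finset.sdiff_subset
  have h1 : ∑ S ∈ W.powersetCard (i + 1), (extensions E W S).card ≤
      (i + 2) * (s * W.card ^ (i + 1)) := by
    refine le_trans ?_ (Nat.mul_le_mul_left (i + 2) hedge)
    rw [← Finset.card_sigma]
    have : (i + 2) * (E.filter (fun e => e ⊆ W)).card =
        ((E.filter (fun e => e ⊆ W)).sigma (fun e => e)).card := by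
      rw [Finset.card_sigma, Finset.sum_const_nat (m := i + 2), mul_comm]
      intro e he
      exact hE e (Finset.mem_filter.1 he).1
    rw [this]
    refine Finset.card_le_card_of_injOn (fun q => ⟨insert q.2 q.1, q.2⟩) ?_ ?_
    · rintro ⟨S, x⟩ hq
      simp only [Finset.coe_sigma, Set.mem_sigma_iff, Finset.mem_coe, Finset.mem_powersetCard,
        mem_extensions, Finset.mem_filter] at hq ⊢
      exact ⟨⟨hq.2.2, Finset.insert_subset hq.2.1 hq.1.1⟩, Finset.mem_insert_self _ _⟩
    · rintro ⟨S, x⟩ hq ⟨S', x'⟩ hq' heq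
      simp only [Finset.coe_sigma, Set.mem_sigma_iff, Finset.mem_coe, Finset.mem_powersetCard,
        mem_extensions] at hq hq'
      simp only [Sigma.mk.injEq, heq_eq_eq] at heq
      obtain ⟨h6, rfl⟩ := heq
      have := not_mem_of_insert_mem hE hq.1.2 hq.2.2
      have := not_mem_of_insert_mem hE hq'.1.2 hq'.2.2
      have h7 : S = S' := by
        rw [← Finset.erase_insert ‹x ∉ S›, h6, Finset.erase_insert ‹x ∉ S'›]
      rw [h7]
  have h2 : ∀ l : List (List α), (∀ P ∈ l, P ∈ segs) →
      2 * ∑ S ∈ W.powersetCard (i + 1), (extensions E l.flatten.toFinset S).card ≤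
        ((W.powersetCard (i + 1)).card + 2 * (K * W.card ^ i)) * l.flatten.length := by
    intro l
    induction l with
    | nil => simp [extensions]
    | cons P l ih =>
      intro hl
      have h6 := ih fun Q hQ => hl Q (by simp [hQ])
      have h7 := hsum P (hl P (by simp))
      have h8 : ∀ S ∈ W.powersetCard (i + 1), (extensions E (P :: l).flatten.toFinset S).card ≤
          (extensions E P.toFinset S).card + (extensions E l.flatten.toFinset S).card := by
        intro S _
        rw [List.flatten_cons, List.toFinset_append, extensions, Finset.filter_union]
        exact Finset.card_union_le _ _
      have h9 := Finset.sum_le_sum h8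
      rw [Finset.sum_add_distrib] at h9
      have h10 : (P :: l).flatten.length = P.length + l.flatten.length := by simp
      rw [h10, mul_add]
      rw [← mul_assoc (2 ^ (2 * s)), ← hK] at h7
      omega
  have h3 : ∀ S, (extensions E Y S).card ≤ (extensions E W S).card +
      (extensions E segs.flatten.toFinset S).card := by
    intro S
    refine (Finset.card_le_card (t := extensions E W S ∪ extensions E segs.flatten.toFinset S)
      ?_).trans (Finset.card_union_le _ _)
    intro x
    simp only [Finset.mem_union, mem_extensions, hW, Finset.mem_sdiff]
    tauto
  have h4 : segs.flatten.length ≤ Y.card := by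
    rw [← List.toFinset_card_of_nodup hp.1]
    exact Finset.card_le_card fun a ha => hp.2.1 a (List.mem_toFinset.1 ha)
  have h5 : (W.powersetCard (i + 1)).card * ((1 / 2 + θ) * (Y.card : ℝ)) ≤
      ∑ S ∈ W.powersetCard (i + 1), ((extensions E Y S).card : ℝ) := by
    rw [← nsmul_eq_mul]
    refine Finset.card_nsmul_le_sum _ _ _ fun S hS => ?_
    rw [Finset.mem_powersetCard] at hS
    exact hD S (hS.1.trans hWY) hS.2
  have h6 : ∑ S ∈ W.powersetCard (i + 1), ((extensions E Y S).card : ℝ) ≤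
      (i + 2) * (s * W.card ^ (i + 1)) +
        ((W.powersetCard (i + 1)).card / 2 + K * W.card ^ i) * Y.card := by
    have h7 : ∑ S ∈ W.powersetCard (i + 1), ((extensions E Y S).card : ℝ) ≤
        ∑ S ∈ W.powersetCard (i + 1), ((extensions E W S).card : ℝ) +
        ∑ S ∈ W.powersetCard (i + 1), ((extensions E segs.flatten.toFinset S).card : ℝ) := by
      rw [← Finset.sum_add_distrib]
      exact Finset.sum_le_sum fun S _ => by exact_mod_cast h3 S
    have h8 := (h2 segs fun P hP => hP).trans (Nat.mul_le_mul_left _ h4)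
    have h8' : 2 * ∑ S ∈ W.powersetCard (i + 1), ((extensions E segs.flatten.toFinset S).card : ℝ) ≤
        ((W.powersetCard (i + 1)).card + 2 * (K * W.card ^ i)) * Y.card := by
      exact_mod_cast h8
    have h1' : ∑ S ∈ W.powersetCard (i + 1), ((extensions E W S).card : ℝ) ≤
      (i + 2) * (s * W.card ^ (i + 1)) := by exact_mod_cast h1
    linarith
  have hwn : (W.card : ℝ) ≤ Y.card := by exact_mod_cast Finset.card_le_card hWY
  have hwpos : (0 : ℝ) < W.card := by exact_mod_cast (by omega)
  have hwC : (C : ℝ) < W.card := by exact_mod_cast (by omega)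
  have h7 : ((W.card : ℝ) / 2) ^ (i + 1) / (i + 1).factorial ≤ (W.powersetCard (i + 1)).card := by
    rw [Finset.card_powersetCard]
    refine le_trans ?_ (Nat.pow_le_choose (i + 1) W.card)
    gcongr
    rw [div_le_iff₀ (by norm_num)]
    exact_mod_cast (by omega)
  set N : ℝ := ((W.powersetCard (i + 1)).card : ℝ)
  have h8 : N * θ * Y.card ≤ ((i + 2) * s + K) * (W.card ^ i * Y.card) := by
    have : (i + 2) * (s * (W.card : ℝ) ^ (i + 1)) ≤ (i + 2) * (s * (W.card ^ i * Y.card)) := by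
      rw [pow_succ]
      gcongr
    nlinarith
  have h9 : N * θ ≤ ((i + 2) * s + K) * W.card ^ i := by
    refine le_of_mul_le_mul_right ?_ (hwpos.trans_le hwn)
    linarith
  have h10 : (((W.card : ℝ) / 2) ^ (i + 1) / (i + 1).factorial) * θ ≤
      ((i + 2) * s + K) * W.card ^ i := (mul_le_mul_of_nonneg_right h7 hθ.le).trans h9
  have h11 : W.card * θ ≤ ((i + 2) * s + K) * ((i + 1).factorial * 2 ^ (i + 1)) := by
    refine le_of_mul_le_mul_left ?_ (pow_pos hwpos i)
    rw [div_pow, div_div, div_mul_eq_mul_div, div_le_iff₀ (by positivity), pow_succ] at h10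
    linarith
  rw [div_le_iff₀ hθ] at hC
  push_cast at hC
  nlinarith

section Absorb
variable {α : Type*} [DecidableEq α]

/-- Inserting `v` in the middle of the list `a` yields a tight list. -/
def AbsorbsVertex (j : ℕ) (E : Finset (Finset α)) (v : α) (a : List α) : Prop :=
  TightList j E (a.take j ++ v :: a.drop j)

lemma exists_absorbed {j : ℕ} {E : Finset (Finset α)} {f g : List α} (W : Finset α) :
    ∀ (𝒜 : List (List α)) (p : List α), 𝒜.flatten.Nodup →
      (∀ a ∈ 𝒜, a ≠ [] ∧ a.length = 2 * j ∧ a <:+: p) → TightList j E (f ++ p ++ g) →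
      (∀ v ∈ W, W.card ≤ 𝒜.countP (fun a => decide (AbsorbsVertex j E v a))) →
      ∃ p', p'.Perm (W.toList ++ p) ∧ TightList j E (f ++ p' ++ g) := by
  induction W using Finset.induction_on with
  | empty => exact fun 𝒜 p _ _ ht _ => ⟨p, by simp, ht⟩
  | insert v W hv ih =>
    intro 𝒜 p hd ha ht hc
    rw [Finset.card_insert_of_notMem hv] at hc
    obtain ⟨a, ha𝒜, hav⟩ := List.countP_pos_iff.1
      (show 0 < 𝒜.countP (fun a => decide (AbsorbsVertex j E v a)) by
        have := hc v (Finset.mem_insert_self _ _)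
        omega)
    have hav : AbsorbsVertex j E v a := by simpa using hav
    obtain ⟨hne, hlen, x, y, rfl⟩ := ha a ha𝒜
    have hperm : 𝒜.Perm (a :: 𝒜.erase a) := List.perm_cons_erase ha𝒜
    have hd' := hperm.flatten.nodup_iff.1 hd
    rw [List.flatten_cons, List.nodup_append'] at hd'
    have hlt : (a.take j).length = j := by rw [List.length_take]; omega
    have hld : (a.drop j).length = j := by rw [List.length_drop]; omega
    have hins := TightList.insert_mid (x := f ++ x) (y := y ++ g) hlt hld (v := v)
      (by rw [List.take_append_drop]; simpa using ht) hav
    obtain ⟨p', hp', ht'⟩ := ih (𝒜.erase a) (x ++ (a.take j ++ v :: a.drop j) ++ y) hd'.2.1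
      (fun b hb => by
        obtain ⟨hb1, hb2, hb3⟩ := ha b (List.mem_of_mem_erase hb)
        refine ⟨hb1, hb2, ?_⟩
        rcases List.infix_or_infix_of_disjoint hb3 hb1 hne (fun c hcb hca =>
          hd'.2.2 hca (List.mem_flatten.2 ⟨b, hb, hcb⟩)) with h | h
        · exact h.trans ⟨[], (a.take j ++ v :: a.drop j) ++ y, by simp⟩
        · exact h.trans ⟨x ++ (a.take j ++ v :: a.drop j), [], by simp⟩)
      (by simpa using hins) (fun w hw => by
        have h1 := hc w (Finset.mem_insert_of_mem hw)
        have h2 := hperm.countP_eq (fun a => decide (AbsorbsVertex j E w a))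
        rw [List.countP_cons] at h2
        split_ifs at h2 <;> omega)
    refine ⟨p', hp'.trans ?_, ht'⟩
    have h3 : (x ++ (a.take j ++ v :: a.drop j) ++ y).Perm (v :: (x ++ a ++ y)) := by
      have : x ++ (a.take j ++ v :: a.drop j) ++ y = (x ++ a.take j) ++ v :: (a.drop j ++ y) := by
        simp
      rw [this]
      refine List.perm_middle.trans (List.Perm.cons _ ?_)
      rw [List.append_assoc, ← List.append_assoc (a.take j), List.take_append_drop,
        List.append_assoc]
    refine (List.Perm.append_left _ h3).trans ?_
    refine List.perm_middle.trans ?_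
    rw [← List.cons_append]
    exact List.Perm.append_right _ (Finset.toList_insert hv).symm

lemma absorbsVertex_of_windows {j : ℕ} {E : Finset (Finset α)} {v : α} {a : List α}
    (ha : a.length = 2 * j) (h : ∀ w, w <:+: a → w.length = j → insert v w.toFinset ∈ E) :
    AbsorbsVertex j E v a := by
  refine TightList.sandwich (by rw [List.length_take]; omega) (by rw [List.length_drop]; omega)
    fun i hi => ?_
  convert h _ (List.drop_append_take_isInfix hi) (by
    rw [List.length_append, List.length_drop, List.length_take, List.length_take, List.length_drop]
    omega) using 1
  ext b
  simp only [List.mem_toFinset, List.mem_append, List.mem_cons, Finset.mem_insert]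
  tauto

lemma exists_absorber_aux {j : ℕ} (hj : 1 ≤ j) {θ : ℝ} (hθ : 0 < θ) (hθ' : θ ≤ 1 / 2)
    {E : Finset (Finset α)} {Ω R X Z : Finset α} (hD : DiracInto j E Ω R θ) (hR : R ⊆ Ω)
    (hX : X ⊆ Ω) (hXne : X.Nonempty) (hZ : (Z.card : ℝ) + (2 * j + 1) ≤ θ * R.card) {ω : α → ℝ}
    (hω : ∀ v, 0 < ω v) :
    ∀ m ≤ 2 * j, ∃ a : List α, a.length = m ∧ a.Nodup ∧ (∀ b ∈ a, b ∈ R \ Z) ∧ TightList j E a ∧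
      ∃ X' ⊆ X, θ ^ m * ∑ v ∈ X, ω v ≤ ∑ v ∈ X', ω v ∧ ∀ v ∈ X', v ∉ a ∧
        ∀ w, w <:+: a → w.length = j → insert v w.toFinset ∈ E := by
  have hRpos : (0 : ℝ) < R.card := by
    by_contra! h
    nlinarith [(Nat.cast_nonneg Z.card : (0 : ℝ) ≤ Z.card), (Nat.cast_nonneg j : (0 : ℝ) ≤ j)]
  intro m
  induction m with
  | zero =>
    intro _
    refine ⟨[], rfl, List.nodup_nil, by simp, TightList.of_length_le (by simp), X, subset_rfl,
      by simp, fun v hv => ⟨by simp, fun w hw hl => ?_⟩⟩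
    rw [List.infix_nil.1 hw] at hl
    simp at hl
    omega
  | succ m ih =>
    intro hm
    obtain ⟨a, hl, hnd, haR, ht, X', hX', hw, hab⟩ := ih (by omega)
    set good : α → α → Prop := fun v x => x ∉ Z ∧ x ∉ a ∧ x ≠ v ∧
      (j ≤ m → insert x (a.take j).toFinset ∈ E) ∧
      (j ≤ m + 1 → insert x (insert v (a.take (j - 1)).toFinset) ∈ E) with hgood
    have haR' : ∀ i, (a.take i).toFinset ⊆ R := fun i b hb =>
      (Finset.mem_sdiff.1 (haR b (List.mem_of_mem_take (List.mem_toFinset.1 hb)))).1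
    have hcard : ∀ v ∈ X', θ * R.card ≤ ((R.filter (good v)).card : ℝ) := by
      intro v hv
      set F : Finset α := Z ∪ insert v a.toFinset with hF
      have hFc : (F.card : ℝ) ≤ θ * R.card := by
        have h1 : F.card ≤ Z.card + (m + 1) := by
          refine (Finset.card_union_le _ _).trans ?_
          have := Finset.card_insert_le v a.toFinset
          have := List.toFinset_card_le a
          omega
        have h2 : (F.card : ℝ) ≤ Z.card + (2 * j + 1) := by exact_mod_cast (by omega)
        linarith
      have hvT : m + 1 ≥ j → (insert v (a.take (j - 1)).toFinset).card = j := by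
        intro h
        rw [Finset.card_insert_of_notMem, List.toFinset_card_of_nodup
          (hnd.sublist (List.take_sublist _ _)), List.length_take]
        · omega
        · rw [List.mem_toFinset]
          exact fun h => (hab v hv).1 (List.mem_of_mem_take h)
      have hvΩ : insert v (a.take (j - 1)).toFinset ⊆ Ω :=
        Finset.insert_subset (hX (hX' hv)) ((haR' _).trans hR)
      have hT : j ≤ m → (a.take j).toFinset.card = j := by
        intro h
        rw [List.toFinset_card_of_nodup (hnd.sublist (List.take_sublist _ _)), List.length_take]
        omega
      rcases lt_or_ge (m + 1) j with h | h
      · have h1 : R \ F ⊆ R.filter (good v) := by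
          intro x hx
          simp only [hF, Finset.mem_sdiff, Finset.mem_union, Finset.mem_insert,
            List.mem_toFinset, not_or] at hx
          rw [Finset.mem_filter]
          exact ⟨hx.1, hx.2.1, hx.2.2.2, hx.2.2.1, fun h' => by omega, fun h' => by omega⟩
        have h2 : (R.card : ℝ) ≤ F.card + (R.filter (good v)).card := by
          exact_mod_cast (by have := Finset.card_le_card h1; have := Finset.le_card_sdiff F R; omega)
        nlinarith
      · obtain ⟨S, hSΩ, hSc, hS⟩ : ∃ S ⊆ Ω, S.card = j ∧
            (j ≤ m → S = (a.take j).toFinset) := by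
          by_cases hjm : j ≤ m
          · exact ⟨_, (haR' j).trans hR, hT hjm, fun _ => rfl⟩
          · exact ⟨_, hvΩ, hvT h, fun h' => absurd h' hjm⟩
        have h1 := hD.two_le_card hSΩ hSc hvΩ (hvT h) F
        have h2 : (extensions E R S ∩ extensions E R (insert v (a.take (j - 1)).toFinset)) \ F ⊆
            R.filter (good v) := by
          intro x hx
          simp only [hF, Finset.mem_sdiff, Finset.mem_union, Finset.mem_insert,
            List.mem_toFinset, not_or, Finset.mem_inter, mem_extensions] at hx
          rw [Finset.mem_filter]
          exact ⟨hx.1.1.1, hx.2.1, hx.2.2.2, hx.2.2.1, fun h' => hS h' ▸ hx.1.1.2,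
            fun h' => hx.1.2.2⟩
        have h3 : (((extensions E R S ∩ extensions E R (insert v (a.take (j - 1)).toFinset)) \
          F).card : ℝ) ≤ (R.filter (good v)).card := by exact_mod_cast Finset.card_le_card h2
        linarith
    have hpos : 0 < ∑ v ∈ X', ω v :=
      (mul_pos (pow_pos hθ m) (Finset.sum_pos (fun v _ => hω v) hXne)).trans_le hw
    obtain ⟨x, hxR, hx⟩ : ∃ x ∈ R, θ * ∑ v ∈ X', ω v ≤ ∑ v ∈ X'.filter (fun v => good v x), ω v := by
      by_contra! hcon
      have h1 : ∑ x ∈ R, ∑ v ∈ X'.filter (fun v => good v x), ω v <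
          ∑ x ∈ R, θ * ∑ v ∈ X', ω v :=
        Finset.sum_lt_sum_of_nonempty (Finset.card_pos.1 (by exact_mod_cast hRpos)) hcon
      have h2 : ∑ x ∈ R, ∑ v ∈ X'.filter (fun v => good v x), ω v =
          ∑ v ∈ X', (R.filter (good v)).card * ω v := by
        simp_rw [Finset.sum_filter]
        rw [Finset.sum_comm]
        refine Finset.sum_congr rfl fun v _ => ?_
        rw [← Finset.sum_filter, Finset.sum_const, nsmul_eq_mul]
      have h3 : ∑ v ∈ X', θ * R.card * ω v ≤ ∑ v ∈ X', (R.filter (good v)).card * ω v :=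
        Finset.sum_le_sum fun v hv => mul_le_mul_of_nonneg_right (hcard v hv) (hω v).le
      rw [h2, Finset.sum_const, nsmul_eq_mul] at h1
      rw [← Finset.mul_sum] at h3
      nlinarith
    obtain ⟨v₀, hv₀⟩ : (X'.filter (fun v => good v x)).Nonempty := by
      by_contra! h
      rw [h, Finset.sum_empty] at hx
      nlinarith
    rw [Finset.mem_filter] at hv₀
    obtain ⟨-, hxZ, hxa, -, hxt, -⟩ := hv₀
    refine ⟨x :: a, by simp [hl], List.nodup_cons.2 ⟨hxa, hnd⟩, ?_, ?_,
      X'.filter (fun v => good v x), (Finset.filter_subset _ _).trans hX', ?_, ?_⟩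
    · intro b hb
      rcases List.mem_cons.1 hb with rfl | hb
      · exact Finset.mem_sdiff.2 ⟨hxR, hxZ⟩
      · exact haR b hb
    · by_cases h : j ≤ m
      · exact ht.cons (hxt h)
      · exact TightList.of_length_le (by simp; omega)
    · rw [pow_succ]
      nlinarith
    · intro v hv
      rw [Finset.mem_filter] at hv
      obtain ⟨hvX, -, -, hxv, -, hvt⟩ := hv
      refine ⟨by simp [Ne.symm hxv, (hab v hvX).1], fun w hw hwl => ?_⟩
      rcases List.infix_cons_iff.1 hw with hw | hw
      · have h1 : w = x :: a.take (j - 1) := by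
          rw [List.prefix_iff_eq_take.1 hw, hwl]
          obtain ⟨i, rfl⟩ : ∃ i, j = i + 1 := ⟨j - 1, by omega⟩
          rw [List.take_succ_cons, Nat.add_sub_cancel]
        have h2 := hw.length_le
        rw [h1, List.toFinset_cons, Finset.insert_comm]
        exact hvt (by simp at h2; omega)
      · exact (hab v hvX).2 w hw hwl

end Absorb

section Absorb
variable {α : Type*} [DecidableEq α]

lemma exists_absorbers_aux {j : ℕ} (hj : 1 ≤ j) {θ : ℝ} (hθ : 0 < θ) (hθ' : θ ≤ 1 / 2)
    {E : Finset (Finset α)} {Ω R X : Finset α} (hD : DiracInto j E Ω R θ) (hR : R ⊆ Ω)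
    (hX : X ⊆ Ω) (hXne : X.Nonempty) :
    ∀ m : ℕ, (2 * j * m + 1 : ℝ) ≤ θ * R.card →
      ∃ 𝒜 : List (List α), 𝒜.length = m ∧ 𝒜.flatten.Nodup ∧ (∀ b ∈ 𝒜.flatten, b ∈ R) ∧
        (∀ a ∈ 𝒜, a.length = 2 * j ∧ TightList j E a) ∧
        ∑ v ∈ X, (1 / 2 : ℝ) ^ (𝒜.countP (fun a => decide (AbsorbsVertex j E v a))) ≤
          (1 - θ ^ (2 * j) / 2) ^ m * X.card := by
  intro m
  induction m with
  | zero => exact fun _ => ⟨[], by simp⟩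
  | succ m ih =>
    intro hm
    push_cast at hm
    obtain ⟨𝒜, h1, h2, h3, h4, h5⟩ := ih (by nlinarith [(Nat.cast_nonneg j : (0 : ℝ) ≤ j)])
    have hlen : 𝒜.flatten.toFinset.card ≤ 2 * j * m := by
      refine (List.toFinset_card_le _).trans ?_
      rw [List.length_flatten, List.map_congr_left (g := fun _ => 2 * j) (fun a ha => (h4 a ha).1),
        List.map_const', List.sum_replicate, h1, smul_eq_mul, mul_comm]
    have hlen' : (𝒜.flatten.toFinset.card : ℝ) ≤ 2 * j * m := by exact_mod_cast hlen
    set ω : α → ℝ := fun v => (1 / 2 : ℝ) ^ (𝒜.countP (fun a => decide (AbsorbsVertex j E v a)))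
      with hω
    obtain ⟨a, ha1, ha2, ha3, ha4, X', hX', hw, hab⟩ := exists_absorber_aux hj hθ hθ' hD hR hX hXne
      (Z := 𝒜.flatten.toFinset) (ω := ω) (by linarith) (fun v => by positivity) (2 * j) le_rfl
    refine ⟨a :: 𝒜, by simp [h1], ?_, ?_, ?_, ?_⟩
    · rw [List.flatten_cons, List.nodup_append']
      exact ⟨ha2, h2, fun b hb hb' => (Finset.mem_sdiff.1 (ha3 b hb)).2 (List.mem_toFinset.2 hb')⟩
    · rw [List.flatten_cons]
      intro b hb
      rcases List.mem_append.1 hb with hb | hb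
      · exact (Finset.mem_sdiff.1 (ha3 b hb)).1
      · exact h3 b hb
    · intro b hb
      rcases List.mem_cons.1 hb with rfl | hb
      · exact ⟨ha1, ha4⟩
      · exact h4 b hb
    · have h6 : ∑ v ∈ X, (1 / 2 : ℝ) ^ ((a :: 𝒜).countP
          (fun a => decide (AbsorbsVertex j E v a))) ≤
          ∑ v ∈ X, (ω v - if v ∈ X' then ω v / 2 else 0) := by
        refine Finset.sum_le_sum fun v hv => ?_
        have hpos : 0 < ω v := by positivity
        split_ifs with h
        · rw [List.countP_cons_of_pos (by
            simpa using absorbsVertex_of_windows ha1 (hab v h).2), pow_succ]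
          show ω v * (1 / 2) ≤ _
          linarith
        · rw [sub_zero]
          refine pow_le_pow_of_le_one (by norm_num) (by norm_num) ?_
          rw [List.countP_cons]
          omega
      rw [Finset.sum_sub_distrib, ← Finset.sum_filter, Finset.filter_mem_eq_inter,
        Finset.inter_eq_right.2 hX', ← Finset.sum_div] at h6
      have hq : θ ^ (2 * j) ≤ 1 := pow_le_one₀ hθ.le (by linarith)
      have h7 : (1 - θ ^ (2 * j) / 2) * ∑ v ∈ X, ω v ≤
        (1 - θ ^ (2 * j) / 2) * ((1 - θ ^ (2 * j) / 2) ^ m * X.card) :=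
        mul_le_mul_of_nonneg_left h5 (by linarith)
      rw [pow_succ]
      nlinarith

/-- There are many disjoint absorbers such that each vertex is absorbed by a positive
proportion of them. -/
lemma exists_absorbers {j : ℕ} (hj : 1 ≤ j) {θ : ℝ} (hθ : 0 < θ) (hθ' : θ ≤ 1 / 2)
    {E : Finset (Finset α)} {Ω R X : Finset α} (hD : DiracInto j E Ω R θ) (hR : R ⊆ Ω)
    (hX : X ⊆ Ω) (hXne : X.Nonempty) {m : ℕ} (hm : (2 * j * m + 1 : ℝ) ≤ θ * R.card)
    (hXm : (X.card : ℝ) ≤ Real.exp (θ ^ (2 * j) / 4 * m)) :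
      ∃ 𝒜 : List (List α), 𝒜.length = m ∧ 𝒜.flatten.Nodup ∧ (∀ b ∈ 𝒜.flatten, b ∈ R) ∧
        (∀ a ∈ 𝒜, a.length = 2 * j ∧ TightList j E a) ∧
        ∀ v ∈ X, θ ^ (2 * j) / 4 * m ≤
          (𝒜.countP (fun a => decide (AbsorbsVertex j E v a)) : ℝ) := by
  obtain ⟨𝒜, h1, h2, h3, h4, h5⟩ := exists_absorbers_aux hj hθ hθ' hD hR hX hXne m hm
  refine ⟨𝒜, h1, h2, h3, h4, fun v hv => ?_⟩
  set c := 𝒜.countP (fun a => decide (AbsorbsVertex j E v a))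
  set q := θ ^ (2 * j)
  have hq : q ≤ 1 := pow_le_one₀ hθ.le (by linarith)
  have hq0 : 0 < q := pow_pos hθ _
  have h6 : (1 / 2 : ℝ) ^ c ≤ (1 - q / 2) ^ m * X.card :=
    (Finset.single_le_sum (f := fun v => (1 / 2 : ℝ) ^
      (𝒜.countP (fun a => decide (AbsorbsVertex j E v a)))) (fun v _ => by positivity) hv).trans h5
  have h7 : (1 - q / 2) ^ m ≤ Real.exp (-(q / 2) * m) := by
    rw [mul_comm, Real.exp_nat_mul]
    refine pow_le_pow_left₀ (by linarith) ?_ m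
    linarith [Real.add_one_le_exp (-(q / 2))]
  have h8 : Real.exp (-(c : ℝ)) ≤ (1 / 2 : ℝ) ^ c := by
    have : -(c : ℝ) = c * (-1) := by ring
    rw [this, Real.exp_nat_mul]
    refine pow_le_pow_left₀ (Real.exp_pos _).le ?_ c
    rw [Real.exp_neg, one_div]
    exact inv_anti₀ (by norm_num) (by linarith [Real.add_one_le_exp (1 : ℝ)])
  have h9 : Real.exp (-(c : ℝ)) ≤ Real.exp (-(q / 2) * m) * Real.exp (q / 4 * m) :=
    h8.trans (h6.trans (mul_le_mul h7 hXm (by positivity) (by positivity)))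
  rw [← Real.exp_add, Real.exp_le_exp] at h9
  linarith

end Absorb

/-- Disjoint tight segments can be connected into a single tight list. -/
lemma exists_connect_all {j : ℕ} (hj : 1 ≤ j) {θ : ℝ} (hθ : 0 < θ) (hθ' : θ ≤ 1 / 2) :
    ∃ n₀ : ℕ, ∀ {α : Type u} [DecidableEq α] (E : Finset (Finset α)) (Ω R : Finset α),
      DiracInto j E Ω R θ → R ⊆ Ω → n₀ ≤ R.card → ∀ f g : List α,
      f.length = j → f.Nodup → (∀ a ∈ f, a ∉ R) → (∀ a ∈ f, a ∈ Ω) →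
      g.length = j → g.Nodup → (∀ a ∈ g, a ∉ R) → (∀ a ∈ g, a ∈ Ω) →
      ∀ segs : List (List α), segs.flatten.Nodup → (∀ s ∈ segs, TightList j E s ∧ j ≤ s.length) →
      (∀ a ∈ segs.flatten, a ∈ Ω ∧ a ∉ R) →
      ((segs.length + 1 : ℝ) * (j + 1) ^ 2 ≤ θ / 2 * R.card) →
      ∃ p : List α, p.length ≤ segs.flatten.length + (segs.length + 1) * (j + 1) ^ 2 ∧ p.Nodup ∧
        (∀ s ∈ segs, s <:+: p) ∧ (∀ a ∈ p, a ∈ segs.flatten ∨ a ∈ R) ∧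
        TightList j E (f ++ p ++ g) := by
  obtain ⟨n₀, h₀⟩ := exists_connect.{u} hj (half_pos hθ)
  refine ⟨2 * n₀, fun {α} _ E Ω R hD hRΩ hR f g hf hfn hfR hfΩ hg hgn hgR hgΩ segs => ?_⟩
  have hconn : ∀ Z : Finset α, (Z.card : ℝ) ≤ θ / 2 * R.card → ∀ f g : List α,
      f.length = j → f.Nodup → (∀ a ∈ f, a ∉ R) → (∀ a ∈ f, a ∈ Ω) →
      g.length = j → g.Nodup → (∀ a ∈ g, a ∉ R) → (∀ a ∈ g, a ∈ Ω) →
      ∃ p : List α, p.length ≤ (j + 1) * (j + 1) ∧ p.Nodup ∧ (∀ a ∈ p, a ∈ R \ Z) ∧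
        TightList j E (f ++ p ++ g) := by
    intro Z hZ f g hf hfn hfR hfΩ hg hgn hgR hgΩ
    have h1 := hD.sdiff (Z := Z) (ε := θ / 2) (by linarith) hZ
    rw [sub_half] at h1
    refine h₀ E Ω (R \ Z) h1 (Finset.sdiff_subset.trans hRΩ) ?_ f g hf hfn
      (fun a ha h => hfR a ha (Finset.mem_sdiff.1 h).1) hfΩ hg hgn
      (fun a ha h => hgR a ha (Finset.mem_sdiff.1 h).1) hgΩ
    have h2 := Finset.le_card_sdiff Z R
    have h3 : 2 * Z.card ≤ R.card := by
      have : (2 * Z.card : ℝ) ≤ R.card := by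
        nlinarith [(Nat.cast_nonneg R.card : (0 : ℝ) ≤ R.card)]
      exact_mod_cast this
    omega
  have key : ∀ (segs : List (List α)) (Z : Finset α) (f : List α),
      f.length = j → f.Nodup → (∀ a ∈ f, a ∉ R) → (∀ a ∈ f, a ∈ Ω) →
      segs.flatten.Nodup → (∀ s ∈ segs, TightList j E s ∧ j ≤ s.length) →
      (∀ a ∈ segs.flatten, a ∈ Ω ∧ a ∉ R) →
      (Z.card + (segs.length + 1 : ℝ) * (j + 1) ^ 2 ≤ θ / 2 * R.card) →
      ∃ p : List α, p.length ≤ segs.flatten.length + (segs.length + 1) * (j + 1) ^ 2 ∧ p.Nodup ∧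
        (∀ s ∈ segs, s <:+: p) ∧ (∀ a ∈ p, a ∈ segs.flatten ∨ a ∈ R \ Z) ∧
        TightList j E (f ++ p ++ g) := by
    intro segs
    induction segs with
    | nil =>
      intro Z f hf hfn hfR hfΩ _ _ _ hZ
      obtain ⟨p, h1, h2, h3, h4⟩ := hconn Z (by nlinarith) f g hf hfn hfR hfΩ hg hgn hgR hgΩ
      exact ⟨p, by simp; nlinarith, h2, by simp, fun a ha => Or.inr (h3 a ha), h4⟩
    | cons s segs ih =>
      intro Z f hf hfn hfR hfΩ hnd hseg hmem hZ
      rw [List.flatten_cons, List.nodup_append'] at hnd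
      rw [List.flatten_cons] at hmem
      rw [List.length_cons, Nat.cast_succ] at hZ
      obtain ⟨hst, hsl⟩ := hseg s (by simp)
      have hsmem : ∀ a ∈ s, a ∈ Ω ∧ a ∉ R := fun a ha => hmem a (by simp [ha])
      obtain ⟨p₀, h1, h2, h3, h4⟩ := hconn Z (by nlinarith [sq_nonneg (j + 1 : ℝ)]) f (s.take j)
        hf hfn hfR hfΩ (by rw [List.length_take]; omega)
        (hnd.1.sublist (List.take_sublist _ _)) (fun a ha => (hsmem a (List.mem_of_mem_take ha)).2)
        (fun a ha => (hsmem a (List.mem_of_mem_take ha)).1)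
      have hdl : (s.drop (s.length - j)).length = j := by rw [List.length_drop]; omega
      have hp₀c : p₀.toFinset.card ≤ (j + 1) ^ 2 :=
        (List.toFinset_card_le p₀).trans (h1.trans_eq (sq _).symm)
      obtain ⟨q, h5, h6, h7, h8, h9⟩ := ih (Z ∪ p₀.toFinset) (s.drop (s.length - j)) hdl
        (hnd.1.sublist (List.drop_sublist _ _)) (fun a ha => (hsmem a (List.mem_of_mem_drop ha)).2)
        (fun a ha => (hsmem a (List.mem_of_mem_drop ha)).1) hnd.2.1
        (fun s' hs' => hseg s' (by simp [hs'])) (fun a ha => hmem a (by simp [ha])) (by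
          have h10 : ((Z ∪ p₀.toFinset).card : ℝ) ≤ Z.card + (j + 1) ^ 2 := by
            exact_mod_cast (Finset.card_union_le _ _).trans (Nat.add_le_add_left hp₀c _)
          nlinarith)
      have h8' : ∀ a ∈ q, a ∉ s ∧ a ∉ p₀ := by
        intro a ha
        rcases h8 a ha with h | h
        · refine ⟨fun h' => hnd.2.2 h' h, fun h' => ?_⟩
          exact (hmem a (by simp [h])).2 (Finset.mem_sdiff.1 (h3 a h')).1
        · rw [Finset.mem_sdiff, Finset.mem_union, not_or, List.mem_toFinset] at h
          exact ⟨fun h' => (hsmem a h').2 h.1, h.2.2⟩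
      refine ⟨p₀ ++ s ++ q, ?_, ?_, ?_, ?_, ?_⟩
      · simp only [List.length_append, List.flatten_cons, List.length_cons]
        nlinarith
      · rw [List.nodup_append', List.nodup_append']
        refine ⟨⟨h2, hnd.1, fun a ha hb => (hsmem a hb).2 (Finset.mem_sdiff.1 (h3 a ha)).1⟩, h6,
          fun a ha hb => ?_⟩
        rcases List.mem_append.1 ha with ha | ha
        · exact (h8' a hb).2 ha
        · exact (h8' a hb).1 ha
      · intro s' hs'
        rcases List.mem_cons.1 hs' with rfl | hs'
        · exact ⟨p₀, q, rfl⟩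
        · exact (h7 s' hs').trans (List.suffix_append _ _).isInfix
      · intro a ha
        rw [List.flatten_cons, List.mem_append]
        rw [List.mem_append, List.mem_append] at ha
        rcases ha with (ha | ha) | ha
        · exact Or.inr (h3 a ha)
        · exact Or.inl (Or.inl ha)
        · rcases h8 a ha with h | h
          · exact Or.inl (Or.inr h)
          · rw [Finset.mem_sdiff, Finset.mem_union, not_or] at h
            exact Or.inr (Finset.mem_sdiff.2 ⟨h.1, h.2.1⟩)
      · have h10 : TightList j E (f ++ p₀ ++ s) := by
          have := TightList.glue (x := f ++ p₀) (m := s.take j) (y := s.drop j)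
            (by rw [List.length_take]; omega) h4 (by rwa [List.take_append_drop])
          rwa [List.append_assoc, List.take_append_drop] at this
        have h11 := TightList.glue (x := f ++ p₀ ++ s.take (s.length - j))
          (m := s.drop (s.length - j)) (y := q ++ g) hdl.ge
          (by rwa [List.append_assoc, List.take_append_drop])
          (by rwa [← List.append_assoc])
        rw [List.append_assoc (f ++ p₀), List.take_append_drop] at h11
        simpa using h11
  intro hnd hseg hmem hc
  obtain ⟨p, h1, h2, h3, h4, h5⟩ := key segs ∅ f hf hfn hfR hfΩ hnd hseg hmem (by simpa using hc)
  exact ⟨p, h1, h2, h3, fun a ha => by simpa using h4 a ha, h5⟩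

section Random
variable {α : Type*} [DecidableEq α]

lemma choose_sub_le {n a : ℕ} (han : a ≤ n) : ∀ t ≤ a,
    (((n - t).choose (a - t) : ℕ) : ℝ) ≤ n.choose a * ((a : ℝ) / n) ^ t := by
  intro t
  induction t with
  | zero => simp
  | succ t ih =>
    intro ht
    have h1 := ih (by omega)
    obtain ⟨m, hm⟩ : ∃ m, n - t = m + 1 := ⟨n - t - 1, by omega⟩
    obtain ⟨b, hb⟩ : ∃ b, a - t = b + 1 := ⟨a - t - 1, by omega⟩
    have hm' : n - (t + 1) = m := by omega
    have hb' : a - (t + 1) = b := by omega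
    rw [hm, hb] at h1
    rw [hm', hb', pow_succ, ← mul_assoc]
    have hn : n = m + 1 + t := by omega
    have ha : a = b + 1 + t := by omega
    have hbm : b ≤ m := by omega
    have h2 : ((m + 1 : ℕ) : ℝ) * m.choose b = (m + 1).choose (b + 1) * ((b + 1 : ℕ) : ℝ) := by
      exact_mod_cast Nat.add_one_mul_choose_eq m b
    have hmpos : (0 : ℝ) < ((m + 1 : ℕ) : ℝ) := by positivity
    have h3 : ((b + 1 : ℕ) : ℝ) / ((m + 1 : ℕ) : ℝ) ≤ (a : ℝ) / n := by
      have hnpos : (0 : ℝ) < n := by exact_mod_cast (by omega)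
      rw [div_le_div_iff₀ hmpos hnpos]
      have : (b + 1) * n ≤ a * (m + 1) := by rw [hn, ha]; nlinarith
      exact_mod_cast this
    have h4 : (m.choose b : ℝ) = (m + 1).choose (b + 1) * (((b + 1 : ℕ) : ℝ) / ((m + 1 : ℕ) : ℝ)) := by
      rw [mul_div_assoc', ← h2]
      field_simp
    rw [h4]
    exact mul_le_mul h1 h3 (by positivity) (by positivity)

lemma card_supersets_le {V J : Finset α} {a : ℕ} (hJ : J ⊆ V) (ha : a ≤ V.card) :
    (((V.powersetCard a).filter (fun A => J ⊆ A)).card : ℝ) ≤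
      V.card.choose a * ((a : ℝ) / V.card) ^ J.card := by
  by_cases hJa : J.card ≤ a
  · refine le_trans ?_ (choose_sub_le ha J.card hJa)
    rw [← Finset.card_sdiff_of_subset hJ, ← Finset.card_powersetCard]
    refine Nat.cast_le.2 (Finset.card_le_card_of_injOn (fun A => A \ J) ?_ ?_)
    · intro A hA
      simp only [Finset.coe_filter, Set.mem_ofPred_eq, Finset.mem_powersetCard] at hA
      simp only [Finset.mem_coe, Finset.mem_powersetCard]
      exact ⟨Finset.sdiff_subset_sdiff hA.1.1 subset_rfl, by
        rw [Finset.card_sdiff_of_subset hA.2, hA.1.2]⟩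
    · intro A hA B hB hAB
      simp only [Finset.coe_filter, Set.mem_ofPred_eq] at hA hB
      simp only at hAB
      rw [← Finset.sdiff_union_of_subset hA.2, hAB, Finset.sdiff_union_of_subset hB.2]
  · rw [Finset.filter_false_of_mem, Finset.card_empty, Nat.cast_zero]
    · positivity
    · intro A hA h
      rw [Finset.mem_powersetCard] at hA
      exact hJa (hA.2 ▸ Finset.card_le_card h)

lemma sum_pow_inter_le {V N : Finset α} {a : ℕ} (hN : N ⊆ V) (ha : a ≤ V.card) {x : ℝ}
    (hx : 0 ≤ x) :
    ∑ A ∈ V.powersetCard a, (1 + x) ^ (A ∩ N).card ≤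
      V.card.choose a * (1 + x * ((a : ℝ) / V.card)) ^ N.card := by
  have h1 : ∀ M : Finset α, ∀ y : ℝ, (1 + y) ^ M.card = ∑ J ∈ M.powerset, y ^ J.card := by
    intro M y
    rw [add_comm, ← Finset.sum_pow_mul_eq_add_pow]
    simp
  have h2 : ∑ A ∈ V.powersetCard a, (1 + x) ^ (A ∩ N).card =
      ∑ J ∈ N.powerset, x ^ J.card * ((V.powersetCard a).filter (fun A => J ⊆ A)).card := by
    have h3 : ∀ A ∈ V.powersetCard a, (1 + x) ^ (A ∩ N).card =
        ∑ J ∈ N.powerset, if J ⊆ A then x ^ J.card else 0 := by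
      intro A _
      rw [h1, ← Finset.sum_filter]
      refine Finset.sum_congr ?_ fun _ _ => rfl
      ext J
      simp only [Finset.mem_powerset, Finset.mem_filter, Finset.subset_inter_iff]
      tauto
    rw [Finset.sum_congr rfl h3, Finset.sum_comm]
    refine Finset.sum_congr rfl fun J _ => ?_
    rw [← Finset.sum_filter, Finset.sum_const, nsmul_eq_mul, mul_comm]
  rw [h2, h1, Finset.mul_sum]
  refine Finset.sum_le_sum fun J hJ => ?_
  rw [mul_pow, mul_left_comm]
  exact mul_le_mul_of_nonneg_left
    (card_supersets_le ((Finset.mem_powerset.1 hJ).trans hN) ha) (by positivity)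

lemma card_upper_tail_le {V N : Finset α} {a : ℕ} (hN : N ⊆ V) (ha : a ≤ V.card) {ε : ℝ}
    (hε : 0 ≤ ε) (hε' : ε ≤ 1) :
    (((V.powersetCard a).filter (fun A => a * ((N.card : ℝ) / V.card) + ε * a ≤
      ((A ∩ N).card : ℝ))).card : ℝ) ≤ V.card.choose a * Real.exp (-(ε ^ 2 / 4) * a) := by
  set T : ℝ := a * ((N.card : ℝ) / V.card) with hT
  have hTa : T ≤ a := mul_le_of_le_one_right (by positivity)
    (div_le_one_of_le₀ (by exact_mod_cast Finset.card_le_card hN) (by positivity))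
  have hexp := Real.abs_exp_sub_one_sub_id_le (x := ε / 2) (by rw [abs_of_nonneg] <;> linarith)
  have hexp' := (abs_le.1 hexp).2
  have hx : 0 ≤ Real.exp (ε / 2) - 1 := by linarith [Real.add_one_le_exp (ε / 2)]
  have h1 := sum_pow_inter_le hN ha hx
  have h2 : (((V.powersetCard a).filter (fun A => T + ε * a ≤ ((A ∩ N).card : ℝ))).card : ℝ) *
      Real.exp (ε / 2 * (T + ε * a)) ≤
      ∑ A ∈ V.powersetCard a, (1 + (Real.exp (ε / 2) - 1)) ^ (A ∩ N).card := by
    rw [← nsmul_eq_mul]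
    refine (Finset.card_nsmul_le_sum _ (fun A => (1 + (Real.exp (ε / 2) - 1)) ^ (A ∩ N).card) _
      fun A hA => ?_).trans (Finset.sum_le_sum_of_subset_of_nonneg (Finset.filter_subset _ _)
        fun A _ _ => by positivity)
    rw [Finset.mem_filter] at hA
    rw [add_sub_cancel, ← Real.exp_nat_mul, Real.exp_le_exp]
    nlinarith [hA.2]
  have h3 : (1 + (Real.exp (ε / 2) - 1) * ((a : ℝ) / V.card)) ^ N.card ≤
      Real.exp (ε / 2 * T + (ε / 2) ^ 2 * a) := by
    have h0 := Real.add_one_le_exp ((Real.exp (ε / 2) - 1) * ((a : ℝ) / V.card))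
    rw [add_comm] at h0
    refine (pow_le_pow_left₀ (by positivity) h0 _).trans ?_
    rw [← Real.exp_nat_mul, Real.exp_le_exp]
    have h4 : (N.card : ℝ) * ((Real.exp (ε / 2) - 1) * ((a : ℝ) / V.card)) =
        (Real.exp (ε / 2) - 1) * T := by rw [hT]; ring
    have h5 : 0 ≤ T := by positivity
    rw [h4]
    nlinarith [mul_le_mul_of_nonneg_right hexp' h5, mul_le_mul_of_nonneg_left hTa (sq_nonneg (ε / 2))]
  have h6 := h2.trans (h1.trans (mul_le_mul_of_nonneg_left h3 (by positivity)))
  rw [← le_div_iff₀ (Real.exp_pos _), mul_div_assoc, ← Real.exp_sub] at h6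
  refine h6.trans_eq ?_
  congr 2
  ring

lemma card_lower_tail_le {V N : Finset α} {a : ℕ} (hN : N ⊆ V) (ha : a ≤ V.card)
    (hV : 0 < V.card) {ε : ℝ} (hε : 0 ≤ ε) (hε' : ε ≤ 1) :
    (((V.powersetCard a).filter (fun A => ((A ∩ N).card : ℝ) ≤
      a * ((N.card : ℝ) / V.card) - ε * a)).card : ℝ) ≤
      V.card.choose a * Real.exp (-(ε ^ 2 / 4) * a) := by
  refine le_trans ?_ (card_upper_tail_le (N := V \ N) Finset.sdiff_subset ha hε hε')
  refine Nat.cast_le.2 (Finset.card_le_card fun A hA => ?_)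
  rw [Finset.mem_filter] at hA ⊢
  refine ⟨hA.1, ?_⟩
  obtain ⟨hAV, hAc⟩ := Finset.mem_powersetCard.1 hA.1
  have h1 : (A ∩ (V \ N)).card + (A ∩ N).card = a := by
    rw [← hAc, ← Finset.card_sdiff_add_card_inter A N]
    congr 2
    ext x
    simp only [Finset.mem_inter, Finset.mem_sdiff]
    exact ⟨fun h => ⟨h.1, h.2.2⟩, fun h => ⟨h.1, hAV h.1, h.2⟩⟩
  have h2 : ((A ∩ (V \ N)).card : ℝ) + (A ∩ N).card = a := by exact_mod_cast h1
  have h3 : ((V \ N).card : ℝ) = V.card - N.card := by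
    rw [Finset.card_sdiff_of_subset hN, Nat.cast_sub (Finset.card_le_card hN)]
  have hVpos : (0 : ℝ) < V.card := by exact_mod_cast hV
  rw [h3, sub_div, div_self hVpos.ne']
  linarith [hA.2]

/-- Most subsets of a given size inherit the degree condition. -/
lemma DiracInto.card_bad_le {j : ℕ} {E : Finset (Finset α)} {Ω V : Finset α} {θ ε : ℝ}
    (hD : DiracInto j E Ω V θ) {a : ℕ} (ha : a ≤ V.card) (hV : 0 < V.card) (hε : 0 ≤ ε)
    (hε' : ε ≤ 1) :
    (((V.powersetCard a).filter (fun A => ¬ DiracInto j E Ω A (θ - ε))).card : ℝ) ≤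
      (Ω.card : ℝ) ^ j * (V.card.choose a * Real.exp (-(ε ^ 2 / 4) * a)) := by
  have hVpos : (0 : ℝ) < V.card := by exact_mod_cast hV
  have hsub : (V.powersetCard a).filter (fun A => ¬ DiracInto j E Ω A (θ - ε)) ⊆
      (Ω.powersetCard j).biUnion (fun S => (V.powersetCard a).filter (fun A =>
        ((A ∩ extensions E V S).card : ℝ) ≤
          a * (((extensions E V S).card : ℝ) / V.card) - ε * a)) := by
    intro A hA
    rw [Finset.mem_filter] at hA
    obtain ⟨hA1, hA2⟩ := hA
    unfold DiracInto at hA2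
    push Not at hA2
    obtain ⟨S, hS, hSc, hlt⟩ := hA2
    obtain ⟨hAV, hAc⟩ := Finset.mem_powersetCard.1 hA1
    refine Finset.mem_biUnion.2 ⟨S, Finset.mem_powersetCard.2 ⟨hS, hSc⟩,
      Finset.mem_filter.2 ⟨hA1, ?_⟩⟩
    have h1 : A ∩ extensions E V S = extensions E A S := by
      ext x
      simp only [Finset.mem_inter, mem_extensions]
      exact ⟨fun h => ⟨h.1, h.2.2⟩, fun h => ⟨h.1, hAV h.1, h.2⟩⟩
    have h2 := hD S hS hSc
    rw [← le_div_iff₀ hVpos] at h2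
    rw [h1]
    rw [hAc] at hlt
    nlinarith [(Nat.cast_nonneg a : (0 : ℝ) ≤ a)]
  have h1 : (((Ω.powersetCard j).biUnion (fun S => (V.powersetCard a).filter (fun A =>
        ((A ∩ extensions E V S).card : ℝ) ≤
          a * (((extensions E V S).card : ℝ) / V.card) - ε * a))).card : ℝ) ≤
      ∑ S ∈ Ω.powersetCard j, V.card.choose a * Real.exp (-(ε ^ 2 / 4) * a) := by
    refine le_trans (Nat.cast_le.2 Finset.card_biUnion_le) ?_
    rw [Nat.cast_sum]
    exact Finset.sum_le_sum fun S _ => card_lower_tail_le (Finset.filter_subset _ _) ha hV hε hε'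
  refine (Nat.cast_le.2 (Finset.card_le_card hsub)).trans (h1.trans ?_)
  rw [Finset.sum_const, nsmul_eq_mul, Finset.card_powersetCard]
  refine mul_le_mul_of_nonneg_right ?_ (by positivity)
  exact_mod_cast Nat.choose_le_pow _ _

end Random

lemma eventually_le_mul {c : ℝ} (hc : 0 < c) (b : ℝ) : ∀ᶠ n : ℕ in Filter.atTop, b ≤ c * n :=
  (tendsto_natCast_atTop_atTop.const_mul_atTop hc).eventually_ge_atTop b

lemma eventually_add_le_exp {c : ℝ} (hc : 0 < c) (b : ℝ) :
    ∀ᶠ n : ℕ in Filter.atTop, n + b ≤ Real.exp (c * n) := by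
  filter_upwards [eventually_le_mul (pow_pos hc 2) 4, eventually_le_mul one_pos b] with n h1 h2
  have h3 := Real.quadratic_le_exp_of_nonneg (x := c * n) (by positivity)
  have h4 : (0 : ℝ) ≤ n := by positivity
  nlinarith [mul_le_mul_of_nonneg_right h1 h4, mul_nonneg hc.le h4]

section
variable {α : Type*} [DecidableEq α]

lemma IsPacking.length_mul_le {j s : ℕ} {E : Finset (Finset α)} {Y : Finset α}
    {segs : List (List α)} (h : IsPacking j E Y s segs) :
    segs.length * s ≤ segs.flatten.length := by
  induction segs with
  | nil => simp
  | cons P segs ih =>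
    have h1 := ih h.tail
    have h2 := (h.2.2 P (by simp)).2.1
    have h3 : (P :: segs).flatten.length = P.length + segs.flatten.length := by simp
    rw [h3, List.length_cons, add_mul]
    omega

lemma DiracInto.exists_reservoir {j : ℕ} {E : Finset (Finset α)} {Ω V : Finset α} {θ ε : ℝ}
    (hD : DiracInto j E Ω V θ) {r : ℕ} (hr : r ≤ V.card) (hr0 : 0 < r) (hε : 0 ≤ ε)
    (hε' : ε ≤ 1) (hlt : (Ω.card : ℝ) ^ j * Real.exp (-(ε ^ 2 / 4) * r) < 1) :
    ∃ R ⊆ V, R.card = r ∧ DiracInto j E Ω R (θ - ε) := by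
  by_contra! hcon
  have h1 := hD.card_bad_le hr (by omega) hε hε'
  rw [Finset.filter_true_of_mem, Finset.card_powersetCard, mul_left_comm] at h1
  · have h2 : (0 : ℝ) < V.card.choose r := by exact_mod_cast Nat.choose_pos hr
    nlinarith
  · intro A hA
    rw [Finset.mem_powersetCard] at hA
    exact hcon A hA.1 hA.2

lemma DiracInto.sdiff_half {j : ℕ} {E : Finset (Finset α)} {Ω R Z : Finset α} {θ : ℝ}
    (h : DiracInto j E Ω R θ) (hθ : 0 < θ) (hZ : (Z.card : ℝ) ≤ θ / 2 * R.card) :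
    DiracInto j E Ω (R \ Z) (θ / 2) := by
  have := h.sdiff (by linarith) hZ
  rwa [sub_half] at this

end

set_option maxHeartbeats 4000000 in
/-- In a Dirac-type hypergraph, any two disjoint ends can be connected by a tight list through
all vertices. -/
lemma exists_hamilton_connect {j : ℕ} (hj : 1 ≤ j) {θ : ℝ} (hθ : 0 < θ) (hθ' : θ ≤ 1 / 2) :
    ∃ n₀ : ℕ, ∀ {α : Type u} [DecidableEq α] (E : Finset (Finset α)) (U : Finset α) (f g : List α),
      (∀ e ∈ E, e.card = j + 1) → DiracInto j E (U ∪ f.toFinset ∪ g.toFinset) U θ →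
      n₀ ≤ U.card → f.length = j → f.Nodup → (∀ a ∈ f, a ∉ U) →
      g.length = j → g.Nodup → (∀ a ∈ g, a ∉ U) →
      ∃ p : List α, p.Nodup ∧ p.toFinset = U ∧ TightList j E (f ++ p ++ g) := by
  obtain ⟨i, hij⟩ : ∃ i, j = i + 1 := ⟨j - 1, by omega⟩
  obtain ⟨n₁, h₁⟩ := exists_connect_all.{u} hj (half_pos hθ) (by linarith)
  obtain ⟨n₂, h₂⟩ := exists_connect_all.{u} hj (half_pos (half_pos hθ)) (by linarith)
  set L : ℕ := (j + 1) ^ 2 with hL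
  set κ : ℝ := (θ / 2) ^ (2 * j) / 4 with hκ
  have hκ0 : 0 < κ := by positivity
  have hκ1 : κ ≤ 1 / 4 := by
    have := pow_le_one₀ (n := 2 * j) (half_pos hθ).le (by linarith)
    linarith
  set β : ℝ := θ / (8 * (2 * j + L + 1)) with hβ
  have hβ0 : 0 < β := by positivity
  have hβL : (2 * j + L + 1) * β = θ / 8 := by
    rw [hβ]
    field_simp
  set K : ℝ := κ * β / 8 with hK
  have hK0 : 0 < K := by positivity
  obtain ⟨s₀, hs₀⟩ := exists_nat_ge (4 * L / (θ / 4 * K))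
  obtain ⟨C, hC⟩ := exists_cover.{u} i (s₀ + i + 1) (by omega) (half_pos hθ)
  rw [← hij] at hC
  have hev : ∀ᶠ n : ℕ in Filter.atTop, ((j + L + 1) * 16 : ℝ) ≤ θ * n ∧
      2 ≤ β * n ∧ 8 ≤ κ * β * n ∧ (C : ℝ) ≤ K * n ∧ (n₁ : ℝ) ≤ K * n ∧ (n₂ : ℝ) ≤ K * n ∧
      4 * L ≤ θ / 4 * K * n ∧ n + 0 ≤ Real.exp (κ * β / 2 * n) ∧
      n + (2 * j : ℝ) ≤ Real.exp ((θ / 4) ^ 2 * K / (8 * j) * n) := by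
    filter_upwards [eventually_le_mul hθ ((j + L + 1) * 16 : ℝ), eventually_le_mul hβ0 2,
      eventually_le_mul (mul_pos hκ0 hβ0) 8, eventually_le_mul hK0 C, eventually_le_mul hK0 n₁,
      eventually_le_mul hK0 n₂, eventually_le_mul (c := θ / 4 * K) (by positivity) (4 * L),
      eventually_add_le_exp (c := κ * β / 2) (by positivity) 0,
      eventually_add_le_exp (c := (θ / 4) ^ 2 * K / (8 * j)) (by positivity) (2 * j)]
      with n h1 h2 h3 h4 h5 h6 h7 h8 h9
    exact ⟨h1, h2, h3, h4, h5, h6, h7, h8, h9⟩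
  obtain ⟨n₀, hn₀⟩ := Filter.eventually_atTop.1 hev
  refine ⟨n₀, fun {α} _ E U f g hE hD hU hf hfn hfU hg hgn hgU => ?_⟩
  obtain ⟨e1, e2, e3, e4, e5, e6, e7, e8, e9⟩ := hn₀ _ hU
  have hj' : (1 : ℝ) ≤ j := by exact_mod_cast hj
  have hL0 : (0 : ℝ) ≤ L := by positivity
  have hθn : θ * U.card ≤ U.card / 2 := by
    have : (0 : ℝ) ≤ U.card := by positivity
    linarith [mul_le_mul_of_nonneg_right hθ' this]
  have hn32 : (32 : ℝ) * (j + L + 1) ≤ U.card := by linarith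
  have hn0 : (0 : ℝ) < U.card := by linarith
  have hβn : 2 * (j * β * U.card) + L * β * U.card + β * U.card = θ / 8 * U.card := by
    rw [← hβL]
    ring
  have hβj : β * U.card ≤ j * β * U.card := by
    rw [mul_assoc]
    exact le_mul_of_one_le_left (by positivity) hj'
  have hβL' : 0 ≤ L * β * U.card := by positivity
  have hβ0' : 0 < β * U.card := by positivity
  have hKn0 : 0 < K * U.card := by positivity
  have hκβ : κ * β * U.card ≤ 1 / 4 * β * U.card := by gcongr
  have hK8 : K * U.card = κ * β * U.card / 8 := by
    rw [hK]
    ring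
  have hθj : θ * j ≤ 1 / 2 * j := by gcongr
  set Ω := U ∪ f.toFinset ∪ g.toFinset with hΩ
  have hUΩ : U ⊆ Ω := Finset.subset_union_left.trans Finset.subset_union_left
  have hfΩ : ∀ a ∈ f, a ∈ Ω := fun a ha => by simp [hΩ, ha]
  have hgΩ : ∀ a ∈ g, a ∈ Ω := fun a ha => by simp [hΩ, ha]
  have hΩc : (Ω.card : ℝ) ≤ U.card + 2 * j := by
    have h1 := Finset.card_union_le (U ∪ f.toFinset) g.toFinset
    have h2 := Finset.card_union_le U f.toFinset
    have h3 := f.toFinset_card_le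
    have h4 := g.toFinset_card_le
    rw [← hΩ] at h1
    exact_mod_cast (by omega : Ω.card ≤ U.card + 2 * j)
  obtain ⟨H, hHU, hHc⟩ : ∃ H ⊆ U, H.card = j :=
    Finset.exists_subset_card_eq (by exact_mod_cast (by linarith : (j : ℝ) ≤ U.card))
  set h := H.toList with hh
  have hmem : ∀ a, a ∈ h ↔ a ∈ H := fun a => Finset.mem_toList
  have hhl : h.length = j := by simp [hh, hHc]
  have hhn : h.Nodup := H.nodup_toList
  set m := ⌊β * U.card⌋₊ with hm
  have hm1 : (m : ℝ) ≤ β * U.card := Nat.floor_le (by positivity)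
  have hm2 : β * U.card / 2 ≤ m := by
    have := Nat.lt_floor_add_one (β * U.card)
    linarith
  have hκm : κ * β * U.card / 2 ≤ κ * m := by
    rw [mul_assoc, mul_div_assoc]
    gcongr
  have hκm' : κ * m ≤ 1 / 4 * m := by gcongr
  have hjm : (j * m : ℝ) ≤ j * β * U.card := by
    rw [mul_assoc]
    gcongr
  have hLm : (L * m : ℝ) ≤ L * β * U.card := by
    rw [mul_assoc]
    gcongr
  obtain ⟨𝒜, hA1, hA2, hA3, hA4, hA5⟩ := exists_absorbers (m := m) (X := U) hj (half_pos hθ)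
    (by linarith) (hD.sdiff_half (Z := H) hθ (by rw [hHc]; linarith))
    (Finset.sdiff_subset.trans hUΩ) hUΩ (Finset.card_pos.1 (by
      have : (0 : ℝ) < U.card := by linarith
      exact_mod_cast this))
    (by
      rw [Finset.card_sdiff_of_subset hHU, Nat.cast_sub (Finset.card_le_card hHU), hHc]
      linarith)
    (by
      refine le_trans (by linarith) (e8.trans (Real.exp_le_exp.2 ?_))
      rw [← hκ]
      linarith)
  have hAlen : 𝒜.flatten.length = 2 * j * m := by
    rw [List.length_flatten, List.map_congr_left (g := fun _ => 2 * j) fun a ha => (hA4 a ha).1]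
    simp [hA1, mul_comm]
  set Z₁ := H ∪ 𝒜.flatten.toFinset with hZ₁
  have hZ₁U : Z₁ ⊆ U := by
    intro a ha
    rcases Finset.mem_union.1 ha with ha | ha
    · exact hHU ha
    · exact (Finset.mem_sdiff.1 (hA3 a (List.mem_toFinset.1 ha))).1
  have hZ₁c : (Z₁.card : ℝ) ≤ j + 2 * (j * m) := by
    have h1 := Finset.card_union_le H 𝒜.flatten.toFinset
    have h2 := 𝒜.flatten.toFinset_card_le
    rw [hHc, hAlen, ← hZ₁] at *
    have : Z₁.card ≤ j + 2 * j * m := by omega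
    rw [← mul_assoc]
    exact_mod_cast this
  have hR₁c : ((U \ Z₁).card : ℝ) = U.card - Z₁.card := by
    rw [Finset.card_sdiff_of_subset hZ₁U, Nat.cast_sub (Finset.card_le_card hZ₁U)]
  have hR₁c' : (3 / 4 : ℝ) * U.card ≤ ((U \ Z₁).card : ℝ) := by
    rw [hR₁c]
    linarith
  obtain ⟨pA, hp1, hp2, hp3, hp4, hp5⟩ := h₁ E Ω (U \ Z₁)
    (hD.sdiff_half hθ (by linarith)) (Finset.sdiff_subset.trans hUΩ)
    (by exact_mod_cast (by linarith : (n₁ : ℝ) ≤ ((U \ Z₁).card : ℝ))) f h hf hfn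
    (fun a ha => by simp [hfU a ha]) hfΩ hhl hhn
    (fun a ha => by simp [hZ₁, (hmem a).1 ha]) (fun a ha => hUΩ (hHU ((hmem a).1 ha))) 𝒜 hA2
    (fun a ha => ⟨(hA4 a ha).2, by rw [(hA4 a ha).1]; omega⟩)
    (fun a ha => ⟨hUΩ (Finset.mem_sdiff.1 (hA3 a ha)).1, by
      simp only [Finset.mem_sdiff, hZ₁, Finset.mem_union, List.mem_toFinset, ha]
      tauto⟩)
    (by
      rw [hA1, show ((j : ℝ) + 1) ^ 2 = L by rw [hL]; push_cast; ring]
      linarith [mul_le_mul_of_nonneg_left hR₁c' hθ.le])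
  have hpA : ∀ a ∈ pA, a ∈ U ∧ a ∉ H := by
    intro a ha
    rcases hp4 a ha with h1 | h1
    · exact Finset.mem_sdiff.1 (hA3 a h1)
    · rw [Finset.mem_sdiff, hZ₁, Finset.mem_union] at h1
      tauto
  set Z₂ := H ∪ pA.toFinset with hZ₂
  have hZ₂U : Z₂ ⊆ U := by
    intro a ha
    rcases Finset.mem_union.1 ha with ha | ha
    · exact hHU ha
    · exact (hpA a (List.mem_toFinset.1 ha)).1
  have hZ₂c : (Z₂.card : ℝ) ≤ 3 / 16 * (θ * U.card) := by
    have h1 := Finset.card_union_le H pA.toFinset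
    have h2 := pA.toFinset_card_le
    rw [hAlen, hA1] at hp1
    rw [hHc, ← hZ₂] at h1
    have h3 : Z₂.card ≤ j + (2 * j * m + (m + 1) * L) := by omega
    have h4 : (Z₂.card : ℝ) ≤ j + (2 * j * m + (m + 1) * L) := by exact_mod_cast h3
    linarith
  have hR₂c : ((U \ Z₂).card : ℝ) = U.card - Z₂.card := by
    rw [Finset.card_sdiff_of_subset hZ₂U, Nat.cast_sub (Finset.card_le_card hZ₂U)]
  set r := ⌊κ * m / 2⌋₊ with hr
  have hr1 : (r : ℝ) ≤ κ * m / 2 := Nat.floor_le (by positivity)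
  have hr2 : K * U.card ≤ r := by
    have h1 := Nat.lt_floor_add_one (κ * m / 2)
    rw [← hr] at h1
    linarith
  have hrn : (r : ℝ) ≤ θ * U.card / 16 := by linarith
  obtain ⟨R, hRU, hRc, hRD⟩ := (hD.sdiff_half (Z := Z₂) hθ (by linarith)).exists_reservoir
    (r := r) (ε := θ / 2 / 2) (by exact_mod_cast (by linarith : (r : ℝ) ≤ ((U \ Z₂).card : ℝ)))
    (by exact_mod_cast (by linarith : (0 : ℝ) < r)) (by positivity) (by linarith) (by
      have h1 : (Ω.card : ℝ) ^ j ≤ Real.exp ((θ / 4) ^ 2 / 8 * (K * U.card)) := by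
        refine (pow_le_pow_left₀ (by positivity) (hΩc.trans e9) j).trans ?_
        rw [← Real.exp_nat_mul]
        refine Real.exp_le_exp.2 (le_of_eq ?_)
        field_simp
      refine (mul_le_mul_of_nonneg_right h1 (Real.exp_pos _).le).trans_lt ?_
      rw [← Real.exp_add, Real.exp_lt_one_iff]
      have h2 : (θ / 4) ^ 2 / 4 * (K * U.card) ≤ (θ / 4) ^ 2 / 4 * r := by gcongr
      have h3 : 0 < (θ / 4) ^ 2 * (K * U.card) := by positivity
      rw [show θ / 2 / 2 = θ / 4 by ring]
      linarith)
  rw [sub_half] at hRD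
  have hRU' : R ⊆ U := hRU.trans Finset.sdiff_subset
  set Y := U \ (Z₂ ∪ R) with hY
  have hYD : DiracInto j E Y Y (θ / 2) := by
    refine (hD.sdiff_half hθ ?_).mono (Finset.sdiff_subset.trans hUΩ) le_rfl
    have h1 : ((Z₂ ∪ R).card : ℝ) ≤ Z₂.card + R.card := by
      exact_mod_cast Finset.card_union_le _ _
    rw [hRc] at h1
    linarith
  obtain ⟨segs, hseg, hsegC⟩ := hC E Y hE hYD
  have hYR : ∀ a ∈ segs.flatten, a ∈ U ∧ a ∉ Z₂ ∧ a ∉ R := by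
    intro a ha
    have := hseg.2.1 a ha
    rw [hY, Finset.mem_sdiff, Finset.mem_union] at this
    tauto
  have hsegs : (segs.length : ℝ) * L ≤ θ / 4 * K / 4 * U.card := by
    have h1 := hseg.length_mul_le
    have h2 : segs.flatten.length ≤ U.card := by
      rw [← List.toFinset_card_of_nodup hseg.1]
      exact Finset.card_le_card fun a ha => (hYR a (List.mem_toFinset.1 ha)).1
    have h3 : (segs.length * (s₀ + i + 1) : ℝ) ≤ U.card := by exact_mod_cast h1.trans h2
    have h4 : (L : ℝ) ≤ θ / 4 * K / 4 * (s₀ + i + 1) := by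
      rw [div_le_iff₀ (by positivity)] at hs₀
      have : 0 ≤ θ / 4 * K * (i + 1) := by positivity
      linarith
    calc (segs.length : ℝ) * L ≤ segs.length * (θ / 4 * K / 4 * (s₀ + i + 1)) := by gcongr
      _ = θ / 4 * K / 4 * (segs.length * (s₀ + i + 1)) := by ring
      _ ≤ _ := by gcongr
  obtain ⟨q, -, hq2, hq3, hq4, hq5⟩ := h₂ E Ω R hRD (hRU'.trans hUΩ)
    (by rw [hRc]; exact_mod_cast e6.trans hr2) h g hhl hhn
    (fun a ha => fun haR => (Finset.mem_sdiff.1 (hRU haR)).2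
      (Finset.mem_union_left _ ((hmem a).1 ha)))
    (fun a ha => hUΩ (hHU ((hmem a).1 ha))) hg hgn (fun a ha haR => hgU a ha (hRU' haR)) hgΩ
    segs hseg.1 (fun s hs => ⟨(hseg.2.2 s hs).1, by have := (hseg.2.2 s hs).2.1; omega⟩)
    (fun a ha => ⟨hUΩ (hYR a ha).1, (hYR a ha).2.2⟩)
    (by
      rw [show ((j : ℝ) + 1) ^ 2 = L by rw [hL]; push_cast; ring, hRc]
      have : θ / 4 * (K * U.card) ≤ θ / 4 * r := by gcongr
      linarith)
  have hq : ∀ a ∈ q, a ∈ U ∧ a ∉ Z₂ := by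
    intro a ha
    rcases hq4 a ha with h1 | h1
    · exact ⟨(hYR a h1).1, (hYR a h1).2.1⟩
    · exact Finset.mem_sdiff.1 (hRU h1)
  set W := (U \ Z₂) \ q.toFinset with hW
  have hWc : (W.card : ℝ) ≤ κ * m := by
    have h1 : W ⊆ (Y \ segs.flatten.toFinset) ∪ R := by
      intro a ha
      have h2 : a ∈ segs.flatten → a ∈ q := by
        intro h3
        obtain ⟨s, hs, has⟩ := List.mem_flatten.1 h3
        exact (hq3 s hs).subset has
      simp only [hW, hY, Finset.mem_sdiff, Finset.mem_union, List.mem_toFinset] at ha ⊢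
      tauto
    have h2 := (Finset.card_le_card h1).trans (Finset.card_union_le _ _)
    rw [hRc] at h2
    have h3 : (W.card : ℝ) ≤ C + r := by exact_mod_cast h2.trans (by omega)
    linarith
  have htight : TightList j E (f ++ (pA ++ h ++ q) ++ g) := by
    have := TightList.glue (x := f ++ pA) (m := h) (y := q ++ g) hhl.ge hp5 (by simpa using hq5)
    simpa using this
  obtain ⟨p', hperm, hp't⟩ := exists_absorbed W 𝒜 (pA ++ h ++ q) hA2
    (fun a ha => ⟨by
      rintro rfl
      have := (hA4 [] ha).1
      simp at this
      omega, (hA4 a ha).1, (hp3 a ha).trans ⟨[], h ++ q, by simp⟩⟩) htight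
    (fun v hv => by
      have h1 := hA5 v (Finset.mem_sdiff.1 (Finset.mem_sdiff.1 hv).1).1
      exact_mod_cast hWc.trans h1)
  refine ⟨p', hperm.nodup_iff.2 ?_, ?_, hp't⟩
  · rw [List.nodup_append, List.nodup_append, List.nodup_append]
    refine ⟨W.nodup_toList, ⟨⟨hp2, hhn, ?_⟩, hq2, ?_⟩, ?_⟩
    · rintro a ha b hb rfl
      exact (hpA a ha).2 ((hmem a).1 hb)
    · rintro a ha b hb rfl
      refine (hq a hb).2 ?_
      simpa [hZ₂, hmem, or_comm] using ha
    · rintro a ha b hb rfl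
      simp only [Finset.mem_toList, hW, hZ₂, Finset.mem_sdiff, Finset.mem_union,
        List.mem_toFinset] at ha
      simp only [List.mem_append, hmem] at hb
      tauto
  · clear * - hpA hq hHU hperm hmem hW hZ₂
    ext a
    rw [List.mem_toFinset, hperm.mem_iff]
    simp only [List.mem_append, Finset.mem_toList, hmem, hW, hZ₂, Finset.mem_sdiff,
      Finset.mem_union, List.mem_toFinset]
    have h1 := hpA a
    have h2 := hq a
    have h3 := @hHU a
    tauto

section
variable {α : Type*} [DecidableEq α]

/-- The orderings of `U` which form a tight list together with the ends `f` and `g`. -/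
noncomputable def hamLists (j : ℕ) (E : Finset (Finset α)) (f g : List α) (U : Finset α) :
    Finset (List α) :=
  U.toList.permutations.toFinset.filter (fun p => TightList j E (f ++ p ++ g))

lemma mem_hamLists {j : ℕ} {E : Finset (Finset α)} {f g : List α} {U : Finset α} {p : List α} :
    p ∈ hamLists j E f g U ↔ p.Perm U.toList ∧ TightList j E (f ++ p ++ g) := by
  simp [hamLists]

lemma List.perm_toList_iff {U : Finset α} {p : List α} :
    p.Perm U.toList ↔ p.Nodup ∧ p.toFinset = U := by
  refine ⟨fun h => ⟨h.nodup_iff.2 U.nodup_toList, ?_⟩, fun ⟨h1, h2⟩ => ?_⟩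
  · rw [List.toFinset_eq_of_perm _ _ h, Finset.toList_toFinset]
  · rw [List.perm_ext_iff_of_nodup h1 U.nodup_toList]
    intro a
    rw [Finset.mem_toList, ← h2, List.mem_toFinset]

lemma card_mul_le_card_hamLists {j a : ℕ} {E : Finset (Finset α)} {f g M : List α} {U : Finset α}
    {good : Finset (Finset α)} {F₁ F₂ : ℝ} (hF₂ : 0 ≤ F₂) (hM : M.length = j)
    (hMn : M.Nodup) (hMU : ∀ x ∈ M, x ∈ U)
    (hgood : ∀ A ∈ good, A ⊆ U \ M.toFinset ∧ A.card = a ∧ F₁ ≤ (hamLists j E f M A).card ∧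
      F₂ ≤ (hamLists j E M g ((U \ M.toFinset) \ A)).card) :
    good.card * (F₁ * F₂) ≤ (hamLists j E f g U).card := by
  set S := good.sigma fun A => hamLists j E f M A ×ˢ hamLists j E M g ((U \ M.toFinset) \ A) with hS
  have h1 : good.card * (F₁ * F₂) ≤ (S.card : ℝ) := by
    rw [hS, Finset.card_sigma, ← nsmul_eq_mul, Nat.cast_sum]
    refine Finset.card_nsmul_le_sum _ _ _ fun A hA => ?_
    obtain ⟨-, -, h3, h4⟩ := hgood A hA
    rw [Finset.card_product, Nat.cast_mul]
    exact mul_le_mul h3 h4 hF₂ (by positivity)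
  refine h1.trans (Nat.cast_le.2 ?_)
  refine Finset.card_le_card_of_injOn (fun x => x.2.1 ++ M ++ x.2.2) ?_ ?_
  · rintro ⟨A, p₁, p₂⟩ hx
    simp only [hS, Finset.mem_sigma, Finset.mem_product, mem_hamLists, Finset.mem_coe] at hx ⊢
    obtain ⟨hA, ⟨h1, h2⟩, h3, h4⟩ := hx
    have hAU := (hgood A hA).1
    rw [List.perm_toList_iff] at h1 h3 ⊢
    refine ⟨⟨?_, ?_⟩, ?_⟩
    · rw [List.nodup_append, List.nodup_append]
      refine ⟨⟨h1.1, hMn, ?_⟩, h3.1, ?_⟩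
      · rintro x hx y hy rfl
        have : x ∈ A := by rw [← h1.2, List.mem_toFinset]; exact hx
        have := hAU this
        simp [hy] at this
      · rintro x hx y hy rfl
        have h5 : x ∈ (U \ M.toFinset) \ A := by rw [← h3.2, List.mem_toFinset]; exact hy
        rw [← h1.2] at h5
        simp at h5 hx
        tauto
    · rw [List.toFinset_append, List.toFinset_append, h1.2, h3.2]
      ext x
      have := @hAU x
      have := hMU x
      simp only [Finset.mem_union, Finset.mem_sdiff, List.mem_toFinset] at *
      tauto
    · have := TightList.glue (x := f ++ p₁) (m := M) (y := p₂ ++ g) hM.ge h2 (by simpa using h4)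
      simpa using this
  · rintro ⟨A, p₁, p₂⟩ hx ⟨B, q₁, q₂⟩ hy hxy
    simp only [hS, Finset.mem_sigma, Finset.mem_product, mem_hamLists, Finset.mem_coe,
      List.perm_toList_iff] at hx hy hxy
    obtain ⟨hA, ⟨⟨h1, h1'⟩, -⟩, -⟩ := hx
    obtain ⟨hB, ⟨⟨h2, h2'⟩, -⟩, -⟩ := hy
    have h3 : p₁.length = q₁.length := by
      rw [← List.toFinset_card_of_nodup h1, ← List.toFinset_card_of_nodup h2, h1', h2',
        (hgood A hA).2.1, (hgood B hB).2.1]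
    obtain ⟨h4, h5⟩ := List.append_inj hxy (by simp [h3])
    obtain ⟨rfl, -⟩ := List.append_inj h4 h3
    subst h5
    subst h1'
    subst h2'
    rfl

/-- Most balanced splits of `V` preserve the degree condition on both sides. -/
lemma DiracInto.card_good_ge {j a b : ℕ} {E : Finset (Finset α)} {Ω V : Finset α} {θ ε : ℝ}
    (hD : DiracInto j E Ω V θ) (hab : a + b = V.card) (hV : 0 < V.card) (hle : a ≤ b)
    (hε : 0 ≤ ε) (hε' : ε ≤ 1) (hexp : (Ω.card : ℝ) ^ j * Real.exp (-(ε ^ 2 / 4) * a) ≤ 1 / 4) :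
    (V.card.choose a : ℝ) / 2 ≤ ((V.powersetCard a).filter (fun A =>
      DiracInto j E Ω A (θ - ε) ∧ DiracInto j E Ω (V \ A) (θ - ε))).card := by
  have h1 := hD.card_bad_le (a := a) (by omega) hV hε hε'
  have h2 := hD.card_bad_le (a := b) (by omega) hV hε hε'
  have hch : V.card.choose b = V.card.choose a := by
    rw [← hab, Nat.choose_symm_add]
  have h3 : ((V.powersetCard a).filter (fun A => ¬ DiracInto j E Ω (V \ A) (θ - ε))).card ≤
      ((V.powersetCard b).filter (fun A => ¬ DiracInto j E Ω A (θ - ε))).card := by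
    refine Finset.card_le_card_of_injOn (fun A => V \ A) ?_ ?_
    · intro A hA
      simp only [Finset.coe_filter, Finset.mem_powersetCard, Set.mem_ofPred_eq] at hA ⊢
      refine ⟨⟨Finset.sdiff_subset, ?_⟩, hA.2⟩
      rw [Finset.card_sdiff_of_subset hA.1.1]
      omega
    · intro A hA B hB h
      simp only [Finset.coe_filter, Finset.mem_powersetCard, Set.mem_ofPred_eq] at hA hB h
      rw [← Finset.sdiff_sdiff_eq_self hA.1.1, h, Finset.sdiff_sdiff_eq_self hB.1.1]
  have h4 : V.card.choose a ≤ ((V.powersetCard a).filter (fun A =>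
      DiracInto j E Ω A (θ - ε) ∧ DiracInto j E Ω (V \ A) (θ - ε))).card +
      (((V.powersetCard a).filter (fun A => ¬ DiracInto j E Ω A (θ - ε))).card +
      ((V.powersetCard a).filter (fun A => ¬ DiracInto j E Ω (V \ A) (θ - ε))).card) := by
    rw [← Finset.card_powersetCard]
    refine le_trans (Finset.card_le_card ?_) ((Finset.card_union_le _ _).trans
      (Nat.add_le_add_left (Finset.card_union_le _ _) _))
    intro A hA
    simp only [Finset.mem_union, Finset.mem_filter, hA, true_and]
    tauto
  have h5 : (V.card.choose a : ℝ) ≤ ((V.powersetCard a).filter (fun A =>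
      DiracInto j E Ω A (θ - ε) ∧ DiracInto j E Ω (V \ A) (θ - ε))).card +
      (((V.powersetCard a).filter (fun A => ¬ DiracInto j E Ω A (θ - ε))).card +
      ((V.powersetCard b).filter (fun A => ¬ DiracInto j E Ω A (θ - ε))).card) := by
    exact_mod_cast h4.trans (by omega)
  rw [hch] at h2
  have h6 : Real.exp (-(ε ^ 2 / 4) * b) ≤ Real.exp (-(ε ^ 2 / 4) * a) := by
    have : (a : ℝ) ≤ b := by exact_mod_cast hle
    refine Real.exp_le_exp.2 ?_
    nlinarith [sq_nonneg ε]
  have h7 : (0 : ℝ) ≤ V.card.choose a := by positivity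
  have h8 : (0 : ℝ) ≤ (Ω.card : ℝ) ^ j := by positivity
  have h9 := mul_le_mul_of_nonneg_left hexp h7
  have h10 := mul_le_mul_of_nonneg_left (mul_le_mul_of_nonneg_left h6 h7) h8
  nlinarith

end

/-- The loss `n ^ (-1/4)` in the degree condition allowed when halving `n` vertices. -/
noncomputable def halvingLoss (n : ℕ) : ℝ := (√√(n : ℝ))⁻¹

lemma halvingLoss_nonneg (n : ℕ) : 0 ≤ halvingLoss n := by
  rw [halvingLoss]
  positivity

lemma halvingLoss_sq_mul (n : ℕ) : halvingLoss n ^ 2 * n = √(n : ℝ) := by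
  rw [halvingLoss, inv_pow, Real.sq_sqrt (Real.sqrt_nonneg _)]
  rcases Nat.eq_zero_or_pos n with rfl | hn
  · simp
  · rw [inv_mul_eq_div, Real.div_sqrt]

lemma mul_halvingLoss_le {a n : ℕ} (ha : 0 < a) (h : 2 * a ≤ n) :
    1.18 * halvingLoss n ≤ halvingLoss a := by
  have ha' : (0 : ℝ) < a := by exact_mod_cast ha
  have h' : (2 * a : ℝ) ≤ n := by exact_mod_cast h
  have hs : ∀ x : ℝ, 0 ≤ x → √√x ^ 4 = x := fun x hx => by
    rw [show 4 = 2 * 2 by rfl, pow_mul, Real.sq_sqrt (Real.sqrt_nonneg _), Real.sq_sqrt hx]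
  have hpos : 0 < √√(a : ℝ) := by positivity
  have hpos' : 0 < √√(n : ℝ) := by
    have : (0 : ℝ) < n := by linarith
    positivity
  have key : 1.18 * √√(a : ℝ) ≤ √√(n : ℝ) := by
    rw [← pow_le_pow_iff_left₀ (by positivity) hpos'.le (by norm_num : 4 ≠ 0), mul_pow,
      hs _ ha'.le, hs _ (by linarith)]
    norm_num
    linarith
  rw [halvingLoss, halvingLoss, ← div_eq_mul_inv, inv_eq_one_div, div_le_div_iff₀ hpos' hpos]
  linarith

lemma tendsto_sqrt_sqrt_natCast :
    Filter.Tendsto (fun n : ℕ => √√(n : ℝ)) Filter.atTop Filter.atTop :=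
  Real.tendsto_sqrt_atTop.comp (Real.tendsto_sqrt_atTop.comp tendsto_natCast_atTop_atTop)

lemma eventually_halvingLoss_le {c : ℝ} (hc : 0 < c) :
    ∀ᶠ n : ℕ in Filter.atTop, halvingLoss n ≤ c :=
  tendsto_sqrt_sqrt_natCast.inv_tendsto_atTop.eventually_le_const hc

lemma eventually_le_halvingLoss_mul (b : ℝ) :
    ∀ᶠ n : ℕ in Filter.atTop, b ≤ halvingLoss n * n := by
  filter_upwards [eventually_halvingLoss_le one_pos,
    (Real.tendsto_sqrt_atTop.comp tendsto_natCast_atTop_atTop).eventually_ge_atTop b] with n h1 h2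
  refine h2.trans ?_
  rw [Function.comp_apply, ← halvingLoss_sq_mul, sq]
  have := halvingLoss_nonneg n
  gcongr
  exact mul_le_of_le_one_left this h1

lemma eventually_pow_mul_exp_neg_sqrt_le (j : ℕ) :
    ∀ᶠ n : ℕ in Filter.atTop, (n + 2 * j : ℝ) ^ j * Real.exp (-(√(n : ℝ) / 16)) ≤ 1 / 4 := by
  have ht := Real.tendsto_sqrt_atTop.comp (tendsto_natCast_atTop_atTop (R := ℝ))
  set c : ℝ := 1 / (32 * (j + 1)) with hc
  have hc0 : 0 < c := by positivity
  have hcj : c * j ≤ 1 / 32 := by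
    rw [hc, div_mul_eq_mul_div, div_le_div_iff₀ (by positivity) (by norm_num)]
    linarith
  filter_upwards [ht.eventually_ge_atTop (12 / c ^ 3), ht.eventually_ge_atTop (2 * j + 1),
    ht.eventually_ge_atTop 96] with n h1 h2 h3
  simp only [Function.comp_apply] at h1 h2 h3
  set x := √(n : ℝ) with hx
  have hxn : (n : ℝ) = x ^ 2 := (Real.sq_sqrt (by positivity)).symm
  have hx0 : 0 ≤ x := Real.sqrt_nonneg _
  have h4 : (n + 2 * j : ℝ) ≤ Real.exp (c * x) := by
    have h5 := Real.pow_div_factorial_le_exp (c * x) (by positivity) 3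
    rw [div_le_iff₀ (by positivity)] at h1
    refine le_trans ?_ h5
    rw [hxn, mul_pow, le_div_iff₀ (by positivity)]
    have h6 : (Nat.factorial 3 : ℝ) = 6 := by norm_num [Nat.factorial]
    rw [h6]
    nlinarith [mul_le_mul_of_nonneg_right h1 (sq_nonneg x)]
  calc (n + 2 * j : ℝ) ^ j * Real.exp (-(x / 16))
      ≤ Real.exp (c * x) ^ j * Real.exp (-(x / 16)) := by gcongr
    _ = Real.exp (c * j * x - x / 16) := by
        rw [← Real.exp_nat_mul, ← Real.exp_add]
        ring_nf
    _ ≤ Real.exp (-3) := by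
        refine Real.exp_le_exp.2 ?_
        nlinarith
    _ ≤ 1 / 4 := by
        rw [Real.exp_neg, inv_eq_one_div]
        have := Real.add_one_le_exp (3 : ℝ)
        gcongr
        linarith

lemma Nat.factorial_add_le (m j : ℕ) : (m + j).factorial ≤ m.factorial * (m + j) ^ j := by
  rw [← Nat.factorial_mul_ascFactorial]
  gcongr
  exact Nat.ascFactorial_le_pow_add m j

/-- The recursion solved by the lower bound on the number of Hamilton tight lists. -/
lemma halving_recursion_le {a b j : ℕ} {c : ℝ} (hc : 0 ≤ c) (hc' : c ≤ 1)
    (hab : (a + b + j) ^ 2 ≤ 16 * (a * b)) :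
    2 * 16 ^ j * (a + b + j).factorial * (a + b + j : ℝ) ^ j * c ^ (a + b + j) ≤
      ((a + b).choose a : ℝ) / 2 * ((2 * 16 ^ j * a.factorial * (a : ℝ) ^ j * c ^ a) *
        (2 * 16 ^ j * b.factorial * (b : ℝ) ^ j * c ^ b)) := by
  have h1 : ((a + b).choose a : ℝ) * a.factorial * b.factorial = (a + b).factorial := by
    have := Nat.choose_mul_factorial_mul_factorial (n := a + b) (k := a) (by omega)
    rw [Nat.add_sub_cancel_left] at this
    exact_mod_cast this
  have h2 : ((a + b + j).factorial : ℝ) ≤ (a + b).factorial * (a + b + j : ℝ) ^ j := by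
    exact_mod_cast Nat.factorial_add_le (a + b) j
  have h3 : ((a + b + j : ℝ) ^ 2) ^ j ≤ (16 * (a * b)) ^ j := by
    have : (a + b + j : ℝ) ^ 2 ≤ 16 * (a * b) := by exact_mod_cast hab
    gcongr
  calc 2 * 16 ^ j * (a + b + j).factorial * (a + b + j : ℝ) ^ j * c ^ (a + b + j)
      ≤ 2 * 16 ^ j * ((a + b).factorial * (a + b + j : ℝ) ^ j) * (a + b + j : ℝ) ^ j *
          c ^ (a + b) := by
        gcongr ?_ * ?_
        · gcongr
        · exact pow_le_pow_of_le_one hc hc' (by omega)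
    _ = 2 * 16 ^ j * (a + b).factorial * ((a + b + j : ℝ) ^ 2) ^ j * c ^ (a + b) := by
        rw [← pow_mul]
        ring
    _ ≤ 2 * 16 ^ j * (a + b).factorial * (16 * (a * b)) ^ j * c ^ (a + b) := by gcongr
    _ = _ := by
        rw [← h1, mul_pow, mul_pow, pow_add]
        ring

/-- A Dirac-type hypergraph has at least `n! * c ^ n` spanning tight lists with given ends. -/
lemma exists_card_hamLists_ge {j : ℕ} (hj : 1 ≤ j) {θ : ℝ} (hθ : 0 < θ) (hθ' : θ ≤ 1 / 2) :
    ∃ c : ℝ, 0 < c ∧ ∃ N : ℕ, ∀ {α : Type u} [DecidableEq α] (E : Finset (Finset α)) (U : Finset α)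
      (f g : List α), (∀ e ∈ E, e.card = j + 1) →
      DiracInto j E (U ∪ f.toFinset ∪ g.toFinset) U θ → N ≤ U.card →
      f.length = j → f.Nodup → (∀ a ∈ f, a ∉ U) → g.length = j → g.Nodup → (∀ a ∈ g, a ∉ U) →
      U.card.factorial * c ^ U.card ≤ ((hamLists j E f g U).card : ℝ) := by
  obtain ⟨n₀, hn₀⟩ := exists_hamilton_connect.{u} hj (half_pos hθ) (by linarith)
  have hev : ∀ᶠ n : ℕ in Filter.atTop, n₀ ≤ n ∧ 4 * j + 8 ≤ n ∧ halvingLoss n ≤ θ / 24 ∧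
      j ≤ halvingLoss n * n ∧ (n + 2 * j : ℝ) ^ j * Real.exp (-(√(n : ℝ) / 16)) ≤ 1 / 4 := by
    filter_upwards [Filter.eventually_ge_atTop n₀, Filter.eventually_ge_atTop (4 * j + 8),
      eventually_halvingLoss_le (c := θ / 24) (by positivity), eventually_le_halvingLoss_mul j,
      eventually_pow_mul_exp_neg_sqrt_le j] with n h1 h2 h3 h4 h5
    exact ⟨h1, h2, h3, h4, h5⟩
  obtain ⟨N, hN⟩ := Filter.eventually_atTop.1 hev
  set T : ℝ := 2 * 16 ^ j * (4 * N).factorial * (4 * N : ℝ) ^ j + 1 with hT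
  have hT1 : 1 ≤ T := by
    have : 0 ≤ 2 * 16 ^ j * ((4 * N).factorial : ℝ) * (4 * N : ℝ) ^ j := by positivity
    linarith
  have hT0 : 0 < T := by linarith
  have hc1 : T⁻¹ ≤ 1 := inv_le_one_of_one_le₀ hT1
  refine ⟨T⁻¹, by positivity, N, fun {α} _ E => ?_⟩
  have main : ∀ n, N ≤ n → ∀ (U : Finset α) (f g : List α), U.card = n →
      (∀ e ∈ E, e.card = j + 1) →
      DiracInto j E (U ∪ f.toFinset ∪ g.toFinset) U (θ - 12 * halvingLoss n) →
      f.length = j → f.Nodup → (∀ a ∈ f, a ∉ U) → g.length = j → g.Nodup → (∀ a ∈ g, a ∉ U) →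
      2 * 16 ^ j * n.factorial * (n : ℝ) ^ j * T⁻¹ ^ n ≤ ((hamLists j E f g U).card : ℝ) := by
    intro n
    induction n using Nat.strong_induction_on with
    | _ n ih =>
    intro hn U f g hU hE hD hf hfn hfU hg hgn hgU
    obtain ⟨e1, e2, e3, e4, e5⟩ := hN n hn
    by_cases hbase : n < 4 * N
    · obtain ⟨p, hp1, hp2, hp3⟩ := hn₀ E U f g hE (hD.mono subset_rfl (by linarith))
        (by omega) hf hfn hfU hg hgn hgU
      have h1 : 1 ≤ (hamLists j E f g U).card :=
        Finset.card_pos.2 ⟨p, mem_hamLists.2 ⟨List.perm_toList_iff.2 ⟨hp1, hp2⟩, hp3⟩⟩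
      have h2 : (1 : ℝ) ≤ (hamLists j E f g U).card := by exact_mod_cast h1
      refine le_trans ?_ h2
      have h3 : (n : ℝ) ≤ 4 * N := by exact_mod_cast hbase.le
      have h4 : ((n.factorial : ℕ) : ℝ) ≤ (4 * N).factorial := by
        exact_mod_cast Nat.factorial_le hbase.le
      calc 2 * 16 ^ j * n.factorial * (n : ℝ) ^ j * T⁻¹ ^ n
          ≤ 2 * 16 ^ j * (4 * N).factorial * (4 * N : ℝ) ^ j * T⁻¹ ^ 1 := by
            gcongr ?_ * ?_
            · gcongr
            · exact pow_le_pow_of_le_one (by positivity) hc1 (by omega)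
        _ ≤ T * T⁻¹ := by
            rw [pow_one]
            gcongr
            linarith
        _ = 1 := mul_inv_cancel₀ hT0.ne'
    · push Not at hbase
      set ε := halvingLoss n with hε
      have hε0 : 0 ≤ ε := halvingLoss_nonneg n
      obtain ⟨H, hHU, hHc⟩ : ∃ H ⊆ U, H.card = j := Finset.exists_subset_card_eq (by omega)
      set M := H.toList with hM
      have hMH : M.toFinset = H := H.toList_toFinset
      have hMl : M.length = j := by rw [hM, Finset.length_toList, hHc]
      have hMn : M.Nodup := H.nodup_toList
      have hMU : ∀ x ∈ M, x ∈ U := fun x hx => hHU (Finset.mem_toList.1 hx)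
      obtain ⟨a, b, hab, hle, hba⟩ : ∃ a b, a + b + j = n ∧ a ≤ b ∧ b ≤ a + 1 :=
        ⟨(n - j) / 2, n - j - (n - j) / 2, by omega, by omega, by omega⟩
      have hVc : (U \ H).card = a + b := by
        rw [Finset.card_sdiff_of_subset hHU]
        omega
      set Ω := U ∪ f.toFinset ∪ g.toFinset with hΩ
      have hUΩ : U ⊆ Ω := Finset.subset_union_left.trans Finset.subset_union_left
      have hfΩ : f.toFinset ⊆ Ω := Finset.subset_union_right.trans Finset.subset_union_left
      have hgΩ : g.toFinset ⊆ Ω := Finset.subset_union_right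
      have hMΩ : M.toFinset ⊆ Ω := hMH ▸ hHU.trans hUΩ
      have hΩc : Ω.card ≤ n + 2 * j := by
        have h1 := Finset.card_union_le (U ∪ f.toFinset) g.toFinset
        have h2 := Finset.card_union_le U f.toFinset
        have h3 := f.toFinset_card_le
        have h4 := g.toFinset_card_le
        rw [← hΩ] at h1
        omega
      have hD' : DiracInto j E Ω (U \ H) (θ - 12 * ε - ε) :=
        hD.sdiff (by linarith) (by rw [hHc, hU]; exact e4)
      have hgood := hD'.card_good_ge (a := a) (b := b) (ε := ε) hVc.symm (by omega) hle hε0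
        (by linarith) (by
          refine le_trans ?_ e5
          have h1 : (Ω.card : ℝ) ≤ n + 2 * j := by exact_mod_cast hΩc
          have h2 : (n : ℝ) ≤ 4 * a := by exact_mod_cast (by omega : n ≤ 4 * a)
          gcongr
          rw [← halvingLoss_sq_mul, ← hε]
          nlinarith [mul_le_mul_of_nonneg_left h2 (sq_nonneg ε)])
      rw [hVc] at hgood
      have hstep : ∀ x, x = a ∨ x = b → ∀ (A : Finset α) (f' g' : List α), A ⊆ U \ H →
          A.card = x → DiracInto j E Ω A (θ - 12 * ε - ε - ε) → f'.toFinset ⊆ Ω →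
          g'.toFinset ⊆ Ω → f'.length = j → f'.Nodup → (∀ a ∈ f', a ∉ A) → g'.length = j →
          g'.Nodup → (∀ a ∈ g', a ∉ A) →
          2 * 16 ^ j * x.factorial * (x : ℝ) ^ j * T⁻¹ ^ x ≤
            ((hamLists j E f' g' A).card : ℝ) := by
        intro x hx A f' g' hA hAc hAD hf'Ω hg'Ω hf' hf'n hf'A hg' hg'n hg'A
        refine ih x (by omega) (by omega) A f' g' hAc hE (hAD.mono ?_ ?_) hf' hf'n hf'A hg' hg'n
          hg'A
        · exact Finset.union_subset (Finset.union_subset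
            ((hA.trans Finset.sdiff_subset).trans hUΩ) hf'Ω) hg'Ω
        · have := mul_halvingLoss_le (a := x) (n := n) (by omega) (by omega)
          rw [← hε] at this
          linarith
      have hcount := card_mul_le_card_hamLists (a := a) (E := E) (f := f) (g := g) (U := U)
        (good := ((U \ H).powersetCard a).filter (fun A => DiracInto j E Ω A (θ - 12 * ε - ε - ε) ∧
          DiracInto j E Ω ((U \ H) \ A) (θ - 12 * ε - ε - ε)))
        (F₁ := 2 * 16 ^ j * a.factorial * (a : ℝ) ^ j * T⁻¹ ^ a)
        (F₂ := 2 * 16 ^ j * b.factorial * (b : ℝ) ^ j * T⁻¹ ^ b) (by positivity) hMl hMn hMU (by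
          intro A hA
          rw [Finset.mem_filter, Finset.mem_powersetCard] at hA
          obtain ⟨⟨hA1, hA2⟩, hA3, hA4⟩ := hA
          rw [hMH]
          have hAU : A ⊆ U := hA1.trans Finset.sdiff_subset
          have hMA : ∀ x ∈ M, x ∉ U \ H := fun x hx h =>
            (Finset.mem_sdiff.1 h).2 (Finset.mem_toList.1 hx)
          refine ⟨hA1, hA2, hstep a (Or.inl rfl) A f M hA1 hA2 hA3 hfΩ hMΩ hf hfn
            (fun x hx h => hfU x hx (hAU h)) hMl hMn (fun x hx h => hMA x hx (hA1 h)),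
            hstep b (Or.inr rfl) _ M g Finset.sdiff_subset ?_ hA4 hMΩ hgΩ hMl hMn
            (fun x hx h => hMA x hx (Finset.sdiff_subset h)) hg hgn
            (fun x hx h => hgU x hx (Finset.sdiff_subset (Finset.sdiff_subset h)))⟩
          rw [Finset.card_sdiff_of_subset hA1]
          omega)
      have hrec := halving_recursion_le (a := a) (b := b) (j := j) (c := T⁻¹) (by positivity) hc1
        (by nlinarith)
      subst hab
      push_cast
      exact hrec.trans ((mul_le_mul_of_nonneg_right hgood (by positivity)).trans hcount)
  intro U f g hE hD hU hf hfn hfU hg hgn hgU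
  have h12 := halvingLoss_nonneg U.card
  refine le_trans ?_ (main _ hU U f g rfl hE (hD.mono subset_rfl (by linarith))
    hf hfn hfU hg hgn hgU)
  obtain ⟨-, e2, -⟩ := hN _ hU
  have h1 : (1 : ℝ) ≤ (U.card : ℝ) ^ j := one_le_pow₀ (by exact_mod_cast (by omega))
  have h2 : (1 : ℝ) ≤ 2 * 16 ^ j := by
    have : (1 : ℝ) ≤ 16 ^ j := one_le_pow₀ (by norm_num)
    linarith
  gcongr
  calc (U.card.factorial : ℝ) = 1 * U.card.factorial * 1 := by ring
    _ ≤ _ := by gcongr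

/-- There are at most `D ^ m` walks of length `m` from a fixed vertex, in a digraph of
maximum out-degree at most `D`. -/
lemma exists_walks {α : Type*} [DecidableEq α] {nb : α → Finset α} {D : ℕ}
    (hD : ∀ x, (nb x).card ≤ D) (m : ℕ) (x : α) :
    ∃ T : Finset (List α), T.card ≤ D ^ m ∧
      ∀ p : List α, p.length = m → List.IsChain (fun a b => b ∈ nb a) (x :: p) → p ∈ T := by
  induction m generalizing x with
  | zero => exact ⟨{[]}, by simp, fun p hp _ => by simpa using hp⟩
  | succ m ih =>
    choose T hT hT' using ih
    refine ⟨(nb x).biUnion fun y => (T y).image (List.cons y), ?_, fun p hp hc => ?_⟩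
    · refine (Finset.card_biUnion_le_card_mul _ _ (D ^ m)
        fun y _ => Finset.card_image_le.trans (hT y)).trans ?_
      rw [pow_succ']
      exact Nat.mul_le_mul_right _ (hD x)
    · obtain ⟨y, p, rfl⟩ := List.exists_cons_of_length_eq_add_one hp
      rw [List.isChain_cons_cons] at hc
      exact Finset.mem_biUnion.2 ⟨y, hc.1, Finset.mem_image_of_mem _
        (hT' y p (by simpa using hp) hc.2)⟩

/-- The edges of the Hamilton `(k-d)`-cycle with vertex ordering `v`. -/
noncomputable def cycleEdges (n k d : ℕ) (hn : 0 < n) (v : Fin n → Fin n) :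
    Finset (Finset (Fin n)) :=
  (Finset.range (n / d)).image fun i =>
    (Finset.range k).image fun t => v ⟨(i * d + t) % n, Nat.mod_lt _ hn⟩

lemma mem_hamLCycles {n k l : ℕ} (hn : 0 < n) {E C : Finset (Finset (Fin n))} :
    C ∈ hamLCycles n k l E ↔
      C ⊆ E ∧ ∃ v : Fin n → Fin n, Function.Bijective v ∧ C = cycleEdges n k (k - l) hn v := by
  rw [hamLCycles, Finset.mem_filter, Finset.mem_powerset]
  refine and_congr_right fun _ => exists_congr fun v => and_congr_right fun _ => ?_
  have : ∀ C', C = C' ↔ ∀ e, e ∈ C ↔ e ∈ C' := fun C' => Finset.ext_iff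
  rw [this, this]
  refine forall_congr' fun e => ?_
  have h : ∀ s : ℕ, Finset.image (fun j : Fin k => v ⟨(s + (j : ℕ)) % n, Nat.mod_lt _ hn⟩)
      Finset.univ = (Finset.range k).image fun t => v ⟨(s + t) % n, Nat.mod_lt _ hn⟩ := by
    intro s
    ext x
    simp only [Finset.mem_image, Finset.mem_univ, true_and, Fin.exists_iff, Finset.mem_range]
    exact ⟨fun ⟨i, h, hi⟩ => ⟨i, h, hi⟩, fun ⟨i, h, hi⟩ => ⟨i, h, hi⟩⟩
  simp only [cycleEdges, h, Finset.mem_image, Finset.mem_univ, true_and, Fin.exists_iff,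
    Finset.mem_range]
  exact iff_congr Iff.rfl ⟨fun ⟨i, h, hi⟩ => ⟨i, h, hi⟩, fun ⟨i, h, hi⟩ => ⟨i, h, hi⟩⟩

lemma card_hamLCycles_le {n k l : ℕ} (hn : 0 < n) (E : Finset (Finset (Fin n))) :
    (hamLCycles n k l E).card ≤ n.factorial := by
  have h : hamLCycles n k l E ⊆ (Finset.univ : Finset (Equiv.Perm (Fin n))).image
      fun σ : Equiv.Perm (Fin n) => cycleEdges n k (k - l) hn σ := by
    intro C hC
    obtain ⟨-, v, hv, rfl⟩ := (mem_hamLCycles hn).1 hC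
    exact Finset.mem_image.2 ⟨Equiv.ofBijective v hv, Finset.mem_univ _, rfl⟩
  refine (Finset.card_le_card h).trans (Finset.card_image_le.trans ?_)
  rw [Finset.card_univ, Fintype.card_perm, Fintype.card_fin]

lemma card_of_mem_cycleEdges {n k d : ℕ} {hn : 0 < n} {v : Fin n → Fin n} {e : Finset (Fin n)}
    (he : e ∈ cycleEdges n k d hn v) : e.card ≤ k := by
  obtain ⟨i, -, rfl⟩ := Finset.mem_image.1 he
  exact Finset.card_image_le.trans (by simp)

lemma mul_add_le_of_lt_div {n d i : ℕ} (hi : i < n / d) : i * d + d ≤ n := by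
  rw [← Nat.succ_mul]
  exact (Nat.mul_le_mul_right d hi).trans (Nat.div_mul_le_self n d)

lemma card_filter_mem_cycleEdges_le {n k d : ℕ} (hn : 0 < n) (hd : 0 < d) (hk : k ≤ n)
    {v : Fin n → Fin n} (hv : Function.Bijective v) (x : Fin n) :
    ((cycleEdges n k d hn v).filter (x ∈ ·)).card ≤ k := by
  obtain ⟨q, rfl⟩ := hv.2 x
  have h : (cycleEdges n k d hn v).filter (v q ∈ ·) ⊆ (Finset.range k).image fun t =>
      (Finset.range k).image fun t' => v ⟨((q + n - t) % n + t') % n, Nat.mod_lt _ hn⟩ := by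
    intro e he
    obtain ⟨he, hq⟩ := Finset.mem_filter.1 he
    obtain ⟨i, hi, rfl⟩ := Finset.mem_image.1 he
    obtain ⟨t, ht, htq⟩ := Finset.mem_image.1 hq
    have hid := mul_add_le_of_lt_div (Finset.mem_range.1 hi)
    have ht' := Finset.mem_range.1 ht
    have h1 : (i * d + t) % n = q := congrArg Fin.val (hv.1 htq)
    refine Finset.mem_image.2 ⟨t, ht, ?_⟩
    have h2 : ((q : ℕ) + n - t) % n = i * d := by
      by_cases hlt : i * d + t < n
      · rw [Nat.mod_eq_of_lt hlt] at h1
        rw [← h1, show i * d + t + n - t = i * d + n by omega, Nat.add_mod_right,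
          Nat.mod_eq_of_lt (by omega)]
      · rw [Nat.mod_eq_sub_mod (by omega), Nat.mod_eq_of_lt (by omega)] at h1
        rw [← h1, show i * d + t - n + n - t = i * d by omega, Nat.mod_eq_of_lt (by omega)]
    rw [h2]
  exact (Finset.card_le_card h).trans (Finset.card_image_le.trans (by simp))

lemma bijective_getD {n : ℕ} {w : List (Fin n)} (hw : w.Nodup) (hwl : w.length = n) (x : Fin n) :
    Function.Bijective fun i : Fin n => w.getD i x := by
  rw [← Finite.injective_iff_bijective]
  intro a b hab
  have ha : (a : ℕ) < w.length := by omega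
  have hb : (b : ℕ) < w.length := by omega
  simp only [List.getD_eq_getElem _ _ ha, List.getD_eq_getElem _ _ hb] at hab
  exact Fin.ext ((hw.getElem_inj_iff).1 hab)

lemma cycleEdges_subset_of_tightList {n j d : ℕ} (hn : 0 < n) (hd : 0 < d) (hj : j ≤ n)
    {E : Finset (Finset (Fin n))} {c p : List (Fin n)} (hc : c.length = j)
    (hcp : (c ++ p).length = n) (ht : TightList j E (c ++ p ++ c)) (x : Fin n) :
    cycleEdges n (j + 1) d hn (fun i => (c ++ p).getD i x) ⊆ E := by
  intro e he
  obtain ⟨i, hi, rfl⟩ := Finset.mem_image.1 he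
  have hid := mul_add_le_of_lt_div (Finset.mem_range.1 hi)
  set s := i * d
  have hlen : (c ++ p ++ c).length = n + j := by rw [List.length_append, hcp, hc]
  have hget : ∀ q (hq : q < (c ++ p ++ c).length),
      (c ++ p ++ c)[q] = (c ++ p).getD (q % n) x := by
    intro q hq
    by_cases hqn : q < n
    · rw [Nat.mod_eq_of_lt hqn, List.getD_eq_getElem _ _ (by omega),
        List.getElem_append_left (by omega)]
    · rw [Nat.mod_eq_sub_mod (by omega), Nat.mod_eq_of_lt (by omega),
        List.getD_eq_getElem _ _ (by omega), List.getElem_append_right (by omega),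
        List.getElem_append_left (by omega)]
      simp only [hcp]
  have hw := ht (((c ++ p ++ c).drop s).take (j + 1))
    ((List.take_prefix _ _).isInfix.trans (List.drop_suffix _ _).isInfix)
    (by rw [List.length_take, List.length_drop]; omega)
  convert hw using 1
  ext y
  rw [List.mem_toFinset, List.mem_iff_getElem, Finset.mem_image]
  constructor
  · rintro ⟨t, ht, rfl⟩
    rw [Finset.mem_range] at ht
    refine ⟨t, by rw [List.length_take, List.length_drop]; omega, ?_⟩
    rw [List.getElem_take, List.getElem_drop, hget]
  · rintro ⟨t, ht, rfl⟩
    refine ⟨t, ?_, ?_⟩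
    · rw [List.length_take, List.length_drop] at ht
      exact Finset.mem_range.2 (by omega)
    · rw [List.getElem_take, List.getElem_drop, hget]

lemma isChain_cycleEdges {n k d : ℕ} (hn : 0 < n) (hd : 0 < d) (hdk : d < k) (hdn : d ∣ n)
    {w : List (Fin n)} (hw : w.length = n) (x : Fin n) :
    w.IsChain fun a b => ∃ e ∈ cycleEdges n k d hn (fun i => w.getD i x), a ∈ e ∧ b ∈ e := by
  rw [List.isChain_iff_getElem]
  intro q hq
  have hmod := Nat.mod_lt q hd
  have hdm := Nat.div_add_mod' q d
  have hqd : q / d < n / d := Nat.div_lt_div_of_lt_of_dvd hdn (by omega)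
  refine ⟨_, Finset.mem_image_of_mem _ (Finset.mem_range.2 hqd), ?_, ?_⟩
  · refine Finset.mem_image.2 ⟨q % d, Finset.mem_range.2 (by omega), ?_⟩
    simp only [hdm]
    rw [Nat.mod_eq_of_lt (by omega), List.getD_eq_getElem _ _ (by omega)]
  · refine Finset.mem_image.2 ⟨q % d + 1, Finset.mem_range.2 (by omega), ?_⟩
    simp only [← add_assoc, hdm]
    rw [Nat.mod_eq_of_lt (by omega), List.getD_eq_getElem _ _ (by omega)]

/-- Hamilton `l`-cycles are at least as many as closed spanning tight lists, up to an
exponential factor. -/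
lemma card_hamLists_le {n j l : ℕ} (hl : 1 ≤ l) (hlj : l ≤ j) (hjn : j + 1 ≤ n)
    (hdn : (j + 1 - l) ∣ n) (E : Finset (Finset (Fin n))) {c : List (Fin n)} (hc : c.length = j)
    (hcn : c.Nodup) :
    (hamLists j E c c (Finset.univ \ c.toFinset)).card ≤
      ((j + 1) * (j + 1)) ^ (n - j) * (hamLCycles n (j + 1) l E).card := by
  have hn : 0 < n := by omega
  have hd : 0 < j + 1 - l := by omega
  obtain ⟨c', x, rfl⟩ : ∃ c' x, c = c' ++ [x] := by
    rcases List.eq_nil_or_concat c with rfl | ⟨c', x, rfl⟩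
    · simp at hc
      omega
    · exact ⟨c', x, by simp⟩
  set c := c' ++ [x] with hcx
  have hp : ∀ p ∈ hamLists j E c c (Finset.univ \ c.toFinset),
      p.length = n - j ∧ (c ++ p).length = n ∧ (c ++ p).Nodup ∧ TightList j E (c ++ p ++ c) := by
    intro p hp
    rw [mem_hamLists] at hp
    obtain ⟨hp, ht⟩ := hp
    have h1 := hp.length_eq
    rw [Finset.length_toList, Finset.card_sdiff_of_subset (Finset.subset_univ _),
      List.toFinset_card_of_nodup hcn, Finset.card_univ, Fintype.card_fin, hc] at h1
    refine ⟨h1, by rw [List.length_append]; omega, ?_, ht⟩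
    rw [List.nodup_append]
    refine ⟨hcn, hp.nodup_iff.2 (Finset.nodup_toList _), ?_⟩
    rintro a ha b hb rfl
    rw [hp.mem_iff] at hb
    simp [ha] at hb
  set F : List (Fin n) → Finset (Finset (Fin n)) := fun p =>
    cycleEdges n (j + 1) (j + 1 - l) hn (fun i => (c ++ p).getD i x) with hF
  refine Finset.card_le_mul_card_image_of_maps_to (f := F) ?_ _ ?_
  · intro p h
    obtain ⟨-, h2, h3, h4⟩ := hp p h
    exact (mem_hamLCycles hn).2 ⟨cycleEdges_subset_of_tightList hn hd (by omega) hc h2 h4 x,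
      _, bijective_getD h3 h2 x, rfl⟩
  · intro C hC
    obtain ⟨-, v, hv, hCv⟩ := (mem_hamLCycles hn).1 hC
    obtain ⟨T, hT, hT'⟩ := exists_walks (nb := fun a => (C.filter (a ∈ ·)).biUnion id)
      (D := (j + 1) * (j + 1)) (fun a => by
        refine (Finset.card_biUnion_le_card_mul _ _ (j + 1) fun e he => ?_).trans ?_
        · rw [hCv] at he
          exact card_of_mem_cycleEdges (Finset.mem_filter.1 he).1
        · rw [hCv]
          exact Nat.mul_le_mul_right _ (card_filter_mem_cycleEdges_le hn hd hjn hv a)) (n - j) x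
    refine (Finset.card_le_card fun p h => ?_).trans hT
    obtain ⟨h, hFp⟩ := Finset.mem_filter.1 h
    obtain ⟨h1, h2, h3, h4⟩ := hp p h
    refine hT' p h1 ?_
    have h5 : (c ++ p).IsChain fun a b => ∃ e ∈ C, a ∈ e ∧ b ∈ e := by
      rw [← hFp]
      exact isChain_cycleEdges hn hd (by omega) hdn h2 x
    rw [hcx, List.append_assoc] at h5
    refine h5.right_of_append.imp fun a b ⟨e, he, hae, hbe⟩ => ?_
    simp only [Finset.mem_biUnion, Finset.mem_filter, id]
    exact ⟨e, ⟨he, hae⟩, hbe⟩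

lemma Real.exp_natCast_mul_log {n : ℕ} (hn : 0 < n) :
    Real.exp (n * Real.log n) = (n : ℝ) ^ n := by
  rw [Real.exp_nat_mul, Real.exp_log (by exact_mod_cast hn)]

lemma exp_le_factorial_sub_mul_pow {n j : ℕ} (hn : 0 < n) (hj : j ≤ n) {b : ℝ} (hb : 0 < b)
    (hb' : b ≤ 1) :
    Real.exp (n * Real.log n - (1 + j - Real.log b) * n) ≤ (n - j).factorial * b ^ (n - j) := by
  have h1 : (n : ℝ) ^ n ≤ n.factorial * Real.exp n := by
    have := Real.pow_div_factorial_le_exp (n : ℝ) (by positivity) n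
    rwa [div_le_iff₀' (by positivity)] at this
  have h2 : (n.factorial : ℝ) ≤ (n - j).factorial * (n : ℝ) ^ j := by
    have := Nat.factorial_add_le (n - j) j
    rw [Nat.sub_add_cancel hj] at this
    exact_mod_cast this
  have h3 : (n : ℝ) ^ j ≤ Real.exp (j * n) := by
    rw [Real.exp_nat_mul]
    have := Real.add_one_le_exp (n : ℝ)
    gcongr
    linarith
  have h4 : b ^ n ≤ b ^ (n - j) := pow_le_pow_of_le_one hb.le hb' (Nat.sub_le _ _)
  have h5 : Real.exp (n * Real.log n - (1 + j - Real.log b) * n) =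
      (n : ℝ) ^ n * b ^ n / (Real.exp n * Real.exp (j * n)) := by
    have : b ^ n = Real.exp (n * Real.log b) := by rw [Real.exp_nat_mul, Real.exp_log hb]
    rw [this, ← Real.exp_natCast_mul_log hn, ← Real.exp_add, ← Real.exp_add, ← Real.exp_sub]
    ring_nf
  rw [h5, div_le_iff₀ (by positivity)]
  calc (n : ℝ) ^ n * b ^ n ≤ ((n - j).factorial * Real.exp (j * n)) * Real.exp n * b ^ (n - j) := by
        refine mul_le_mul (h1.trans ?_) h4 (by positivity) (by positivity)
        gcongr
        exact h2.trans (by gcongr)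
    _ = _ := by ring

lemma factorial_le_exp {n : ℕ} (hn : 2 ≤ n) :
    (n.factorial : ℝ) ≤ Real.exp (n * Real.log n - Real.log 2 / 3 * n) := by
  obtain ⟨m, r, hmr, hm, hm'⟩ : ∃ m r, m + r = n ∧ 2 * m ≤ n ∧ n ≤ 3 * m :=
    ⟨n / 2, n - n / 2, by omega, by omega, by omega⟩
  have h1 : (n.factorial : ℝ) ≤ (m : ℝ) ^ m * (n : ℝ) ^ r := by
    have h2 := Nat.factorial_add_le m r
    rw [hmr] at h2
    exact_mod_cast h2.trans (Nat.mul_le_mul_right _ (Nat.factorial_le_pow m))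
  have h2 : (m : ℝ) ≤ n / 2 := by
    have : (2 * m : ℝ) ≤ n := by exact_mod_cast hm
    linarith
  have h3 : (m : ℝ) ^ m * (n : ℝ) ^ r ≤ (n : ℝ) ^ n * (2 ^ m)⁻¹ := by
    calc (m : ℝ) ^ m * (n : ℝ) ^ r ≤ (n / 2 : ℝ) ^ m * (n : ℝ) ^ r := by gcongr
      _ = (n : ℝ) ^ n * (2 ^ m)⁻¹ := by
        rw [← hmr, pow_add, div_pow]
        ring
  refine (h1.trans h3).trans ?_
  rw [Real.exp_sub, Real.exp_natCast_mul_log (by omega), div_eq_mul_inv]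
  gcongr
  rw [show (2 : ℝ) ^ m = Real.exp (m * Real.log 2) by rw [Real.exp_nat_mul, Real.exp_log two_pos]]
  refine Real.exp_le_exp.2 ?_
  have h4 : (n : ℝ) ≤ 3 * m := by exact_mod_cast hm'
  have h5 := Real.log_pos one_lt_two
  nlinarith

lemma DiracInto.of_codegree {n j : ℕ} {E : Finset (Finset (Fin n))} {γ : ℝ}
    (hE : ∀ e ∈ E, e.card = j + 1) (h : ∀ S : Finset (Fin n), S.card = j →
      (1 / 2 + γ) * (n : ℝ) ≤ ((E.filter (fun e => S ⊆ e)).card : ℝ)) :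
    DiracInto j E Finset.univ Finset.univ γ := by
  intro S _ hS
  rw [Finset.card_univ, Fintype.card_fin]
  refine (h S hS).trans (Nat.cast_le.2 ?_)
  refine (Finset.card_le_card (t := (extensions E Finset.univ S).image (insert · S)) ?_).trans
    Finset.card_image_le
  intro e he
  obtain ⟨he, hSe⟩ := Finset.mem_filter.1 he
  obtain ⟨x, -, rfl⟩ := (Finset.covBy_iff_card_sdiff_eq_one.2
    ⟨hSe, by rw [Finset.card_sdiff_of_subset hSe, hE e he, hS]; omega⟩).exists_finset_insert
  exact Finset.mem_image.2 ⟨x, mem_extensions.2 ⟨Finset.mem_univ _, he⟩, rfl⟩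

/-- For every integer `k ≥ 2`, every `l ∈ {1,…,k−1}` and every `γ > 0` there exist
constants `c₁, c₂ > 0` and `n₀` such that for all `n ≥ n₀` with `(k−l) ∣ n`, every
`k`-graph on `n` vertices with minimum codegree at least `(1/2 + γ)n` contains at
least `exp(n ln n − c₂ n)` and at most `exp(n ln n − c₁ n)` Hamilton `l`-cycles. -/
theorem stmt_2 :
    ∀ k : ℕ, 2 ≤ k → ∀ l : ℕ, 1 ≤ l → l ≤ k - 1 → ∀ γ : ℝ, 0 < γ →
    ∃ c₁ c₂ : ℝ, 0 < c₁ ∧ 0 < c₂ ∧ ∃ n₀ : ℕ, ∀ n : ℕ, n₀ ≤ n → (k - l) ∣ n →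
    ∀ E : Finset (Finset (Fin n)),
      (∀ e ∈ E, e.card = k) →
      (∀ S : Finset (Fin n), S.card = k - 1 →
        (1/2 + γ) * (n : ℝ) ≤ ((E.filter (fun e => S ⊆ e)).card : ℝ)) →
      Real.exp ((n : ℝ) * Real.log n - c₂ * n) ≤ ((hamLCycles n k l E).card : ℝ) ∧
      ((hamLCycles n k l E).card : ℝ) ≤ Real.exp ((n : ℝ) * Real.log n - c₁ * n) := by
  intro k hk l hl hlk γ hγ
  obtain ⟨j, rfl⟩ : ∃ j, k = j + 1 := ⟨k - 1, by omega⟩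
  rw [Nat.add_sub_cancel] at *
  have hj : 1 ≤ j := by omega
  set θ := min γ (1 / 2) with hθ
  have hθ0 : 0 < θ := lt_min hγ (by norm_num)
  have hθ1 : θ ≤ 1 / 2 := min_le_right _ _
  obtain ⟨a, ha, N, hN⟩ := exists_card_hamLists_ge.{0} hj (half_pos hθ0) (by linarith)
  set D : ℕ := (j + 1) * (j + 1) with hD
  have hD1 : (1 : ℝ) ≤ D := by exact_mod_cast Nat.mul_pos j.succ_pos j.succ_pos
  set b : ℝ := min a 1 / D with hb
  have hb0 : 0 < b := by positivity
  have hb1 : b ≤ 1 := div_le_one_of_le₀ ((min_le_right _ _).trans hD1) (by positivity)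
  obtain ⟨M, hM⟩ := Filter.eventually_atTop.1 (eventually_le_mul (half_pos hθ0) (j : ℝ))
  refine ⟨Real.log 2 / 3, 1 + j - Real.log b, by positivity, ?_, N + M + 2 * j + 2, ?_⟩
  · have := Real.log_nonpos hb0.le hb1
    linarith [(Nat.cast_nonneg j : (0 : ℝ) ≤ j)]
  intro n hn hdn E hE hcod
  have hn0 : 0 < n := by omega
  refine ⟨(exp_le_factorial_sub_mul_pow hn0 (by omega) hb0 hb1).trans ?_, ?_⟩
  · obtain ⟨H, -, hHc⟩ : ∃ H ⊆ (Finset.univ : Finset (Fin n)), H.card = j :=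
      Finset.exists_subset_card_eq (by rw [Finset.card_univ, Fintype.card_fin]; omega)
    have hdir : DiracInto j E Finset.univ (Finset.univ \ H) (θ / 2) := by
      refine ((DiracInto.of_codegree hE hcod).mono subset_rfl (min_le_left _ _)).sdiff_half hθ0 ?_
      rw [hHc, Finset.card_univ, Fintype.card_fin]
      exact hM n (by omega)
    set c := H.toList with hc
    have hcH : c.toFinset = H := H.toList_toFinset
    have hcl : c.length = j := by rw [hc, Finset.length_toList, hHc]
    have hU : (Finset.univ \ H : Finset (Fin n)).card = n - j := by
      rw [Finset.card_sdiff_of_subset (Finset.subset_univ _), Finset.card_univ, Fintype.card_fin,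
        hHc]
    have hcU : ∀ x ∈ c, x ∉ Finset.univ \ H := fun x hx h =>
      (Finset.mem_sdiff.1 h).2 (Finset.mem_toList.1 hx)
    have h1 := hN E (Finset.univ \ H) c c hE (hdir.mono (Finset.subset_univ _) le_rfl)
      (by omega) hcl H.nodup_toList hcU hcl H.nodup_toList hcU
    have h2 := card_hamLists_le hl hlk (by omega) hdn E hcl H.nodup_toList
    rw [hcH, ← hD] at h2
    rw [hU] at h1
    have h3 : ((n - j).factorial : ℝ) * min a 1 ^ (n - j) ≤
        (D : ℝ) ^ (n - j) * (hamLCycles n (j + 1) l E).card := by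
      refine le_trans ?_ (h1.trans (by exact_mod_cast h2))
      gcongr
      exact min_le_left _ _
    rw [hb, div_pow, ← mul_div_assoc, div_le_iff₀' (by positivity)]
    exact h3
  · exact (Nat.cast_le.2 (card_hamLCycles_le hn0 E)).trans (factorial_le_exp (by omega))
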